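/- For all integers k ≥ 2 and n ≥ 2 one has ω̄_{2n−1,k} ∈ R[ω_{3,k}, …, ω_{2n−1,k}]. Furthermore, for all admissible n and k, both ω_{2n−1,k} and ω̄_{2n−1,k} are central elements of the subalgebra BC_{k−1,k−1}. -/

import Mathlib

open Polynomial

noncomputable section

/-- Transposition `(a b)` (0-based indices) in the symmetric group on `Fin n`;
it is `1` if an index is out of range. -/
def sw (n a b : ℕ) : Equiv.Perm (Fin n) :=
  if h : a < n ∧ b < n then Equiv.swap ⟨a, h.1⟩ ⟨b, h.2⟩ else 1

/-- The permutation word `s_{i,j}` of the paper (1-based indices):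
`s_{i,j} = s_i s_{i+1,j}` for `i < j`, `s_{i,i} = 1`, `s_{i,j} = s_{i,j+1} s_j` for `i > j`. -/
def sIJ (n i j : ℕ) : Equiv.Perm (Fin n) :=
  if i < j then ((List.range' i (j - i)).map (fun k => sw n (k - 1) k)).prod
  else ((List.range' j (i - j)).reverse.map (fun k => sw n (k - 1) k)).prod

/-- The coefficients `a_{2n+1,j}` of the paper: `acoef ω n j = a_{2n+1,j}`, defined by the
recursion `a_{1,0} = -1`, `a_{2n+1,j+1} = a_{2n-1,j}` and
`a_{2n+1,0} = ∑_{j=0}^{n-1} a_{2n-1,j} ω_{2j+1}`. -/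
def acoef {A : Type} [Ring A] (ω : ℕ → A) : ℕ → ℕ → A
  | 0, _ => -1
  | n + 1, 0 => ∑ j ∈ Finset.range (n + 1), acoef ω n j * ω (2 * j + 1)
  | n + 1, j + 1 => acoef ω n j

/-- The parameters `ω̄_k` determined by the parameters `ω` as in Corollary 3.5:
`ω̄_{2n} = 0` and `ω̄_{2n+1} = ∑_{j=0}^{n} a_{2n+1,j} ω_{2j+1}`. -/
def obar {R : Type} [CommRing R] (ω : ℕ → R) (k : ℕ) : R :=
  if k % 2 = 0 then 0
  else ∑ j ∈ Finset.range (k / 2 + 1), acoef ω (k / 2) j * ω (2 * j + 1)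

/-- Data for the presentation of the walled Brauer–Clifford superalgebra `BC_{r,t}`
(Definition 2.1 together with relations (2.1)–(2.3)) on an `R`-algebra `A`.
The images of the two symmetric groups are recorded as monoid homomorphisms, so the
symmetric group relations among the `s_i` (resp. `s̄_j`) hold automatically. -/
structure WBC (R A : Type) [CommRing R] [Ring A] [Algebra R A] (r t : ℕ) : Type where
  σ : Equiv.Perm (Fin r) →* A
  σb : Equiv.Perm (Fin t) →* A
  c : Fin r → A
  cb : Fin t → A
  e : A
  c_sq : ∀ i, c i * c i = -1
  c_anti : ∀ i j, i ≠ j → c i * c j = -(c j * c i)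
  c_conj : ∀ w i, σ w * c i * σ (w⁻¹) = c (w i)
  cb_sq : ∀ i, cb i * cb i = 1
  cb_anti : ∀ i j, i ≠ j → cb i * cb j = -(cb j * cb i)
  cb_conj : ∀ w i, σb w * cb i * σb (w⁻¹) = cb (w i)
  comm_σσb : ∀ w v, σ w * σb v = σb v * σ w
  comm_σcb : ∀ w j, σ w * cb j = cb j * σ w
  comm_σbc : ∀ v i, σb v * c i = c i * σb v
  anti_ccb : ∀ i j, c i * cb j = -(cb j * c i)
  e_c1 : ∀ (h1 : 0 < r) (h2 : 0 < t), e * c ⟨0, h1⟩ = e * cb ⟨0, h2⟩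
  c1_e : ∀ (h1 : 0 < r) (h2 : 0 < t), c ⟨0, h1⟩ * e = cb ⟨0, h2⟩ * e
  e_sq : e * e = 0
  e_s_e : 1 < r → e * σ (sw r 0 1) * e = e
  e_sb_e : 1 < t → e * σb (sw t 0 1) * e = e
  s_e_comm : ∀ i : ℕ, 0 < i → i + 1 < r → σ (sw r i (i + 1)) * e = e * σ (sw r i (i + 1))
  sb_e_comm : ∀ j : ℕ, 0 < j → j + 1 < t → σb (sw t j (j + 1)) * e = e * σb (sw t j (j + 1))
  braid1 : 1 < r → 1 < t →
    e * σ (sw r 0 1) * σb (sw t 0 1) * e * σ (sw r 0 1)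
      = e * σ (sw r 0 1) * σb (sw t 0 1) * e * σb (sw t 0 1)
  braid2 : 1 < r → 1 < t →
    σ (sw r 0 1) * e * σ (sw r 0 1) * σb (sw t 0 1) * e
      = σb (sw t 0 1) * e * σ (sw r 0 1) * σb (sw t 0 1) * e
  c_e_comm : ∀ i : Fin r, (i : ℕ) ≠ 0 → c i * e = e * c i
  cb_e_comm : ∀ j : Fin t, (j : ℕ) ≠ 0 → cb j * e = e * cb j
  e_c_e : ∀ h : 0 < r, e * c ⟨0, h⟩ * e = 0
  e_cb_e : ∀ h : 0 < t, e * cb ⟨0, h⟩ * e = 0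

namespace WBC

variable {R A : Type} [CommRing R] [Ring A] [Algebra R A] {r t : ℕ}

/-- The transposition `(i,j) ∈ Σ_r` (1-based indices). -/
def tr (d : WBC R A r t) (i j : ℕ) : A := d.σ (sw r (i - 1) (j - 1))

/-- The transposition `(ī,j̄) ∈ Σ_t` (1-based indices). -/
def trb (d : WBC R A r t) (i j : ℕ) : A := d.σb (sw t (i - 1) (j - 1))

/-- The generator `s_j = (j, j+1)` (1-based). -/
def s (d : WBC R A r t) (j : ℕ) : A := d.σ (sw r (j - 1) j)

/-- The generator `s̄_j` (1-based). -/
def sb (d : WBC R A r t) (j : ℕ) : A := d.σb (sw t (j - 1) j)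

/-- The generator `c_i` (1-based). -/
def cn (d : WBC R A r t) (i : ℕ) : A := if h : i - 1 < r then d.c ⟨i - 1, h⟩ else 0

/-- The generator `c̄_i` (1-based). -/
def cbn (d : WBC R A r t) (i : ℕ) : A := if h : i - 1 < t then d.cb ⟨i - 1, h⟩ else 0

/-- `e_{i,j} = (1̄,j̄)(1,i) e_1 (1,i)(1̄,j̄)` (1-based). -/
def E (d : WBC R A r t) (i j : ℕ) : A := d.trb 1 j * d.tr 1 i * d.e * d.tr 1 i * d.trb 1 j

/-- `ē_{i,j} = c_i e_{i,j} c_i`. -/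
def Eb (d : WBC R A r t) (i j : ℕ) : A := d.cn i * d.E i j * d.cn i

/-- `L'_i = ∑_{j=1}^{i-1} (j,i)`. -/
def LL (d : WBC R A r t) (i : ℕ) : A := ∑ j ∈ Finset.Ico 1 i, d.tr j i

/-- The Jucys–Murphy element `L_i = L'_i + c_i L'_i c_i`. -/
def L (d : WBC R A r t) (i : ℕ) : A := d.LL i + d.cn i * d.LL i * d.cn i

/-- `L̄'_i = ∑_{j=1}^{i-1} (j̄,ī)`. -/
def LLb (d : WBC R A r t) (i : ℕ) : A := ∑ j ∈ Finset.Ico 1 i, d.trb j i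

/-- The Jucys–Murphy element `L̄_i = L̄'_i - c̄_i L̄'_i c̄_i`. -/
def Lb (d : WBC R A r t) (i : ℕ) : A := d.LLb i - d.cbn i * d.LLb i * d.cbn i

/-- `y_i = ∑_{j=1}^{i-1} (e_{i,j} + ē_{i,j}) - L_i`. -/
def y (d : WBC R A r t) (i : ℕ) : A := (∑ j ∈ Finset.Ico 1 i, (d.E i j + d.Eb i j)) - d.L i

/-- `ȳ_i = ∑_{j=1}^{i-1} (e_{j,i} - ē_{j,i}) - L̄_i`. -/
def yb (d : WBC R A r t) (i : ℕ) : A := (∑ j ∈ Finset.Ico 1 i, (d.E j i - d.Eb j i)) - d.Lb i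

/-- `c^α = c_1^{α_1} ⋯ c_r^{α_r}`. -/
def cpow (d : WBC R A r t) (α : Fin r → Fin 2) : A :=
  ((List.finRange r).map (fun i => d.c i ^ (α i : ℕ))).prod

/-- `c̄^β = c̄_1^{β_1} ⋯ c̄_t^{β_t}`. -/
def cbpow (d : WBC R A r t) (β : Fin t → Fin 2) : A :=
  ((List.finRange t).map (fun j => d.cb j ^ (β j : ℕ))).prod

/-- `e^f = e_1 e_2 ⋯ e_f`. -/
def epow (d : WBC R A r t) (f : ℕ) : A :=
  ((List.range f).map (fun i => d.E (i + 1) (i + 1))).prod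

/-- Generators of the subalgebra `BC_{m,m}`: the elements `e_1`, `s_1, …, s_{m-1}`,
`s̄_1, …, s̄_{m-1}`, `c_1` and `c̄_1` (interpreted as `∅` when `m = 0`). -/
def lowerGens (d : WBC R A r t) (m : ℕ) : Set A :=
  {x | (1 ≤ m ∧ x = d.e) ∨ (∃ j : ℕ, 1 ≤ j ∧ j + 1 ≤ m ∧ x = d.s j)
    ∨ (∃ j : ℕ, 1 ≤ j ∧ j + 1 ≤ m ∧ x = d.sb j)
    ∨ (1 ≤ m ∧ x = d.cn 1) ∨ (1 ≤ m ∧ x = d.cbn 1)}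

end WBC

/-- `φ` intertwines two sets of walled Brauer–Clifford data. -/
structure WBCHom {R A B : Type} [CommRing R] [Ring A] [Algebra R A] [Ring B] [Algebra R B]
    {r t : ℕ} (d : WBC R A r t) (d' : WBC R B r t) (φ : A →ₐ[R] B) : Prop where
  map_σ : ∀ w, φ (d.σ w) = d'.σ w
  map_σb : ∀ w, φ (d.σb w) = d'.σb w
  map_c : ∀ i, φ (d.c i) = d'.c i
  map_cb : ∀ j, φ (d.cb j) = d'.cb j
  map_e : φ d.e = d'.e

/-- `A` (with the data `d`) *is* the walled Brauer–Clifford superalgebra `BC_{r,t}`: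
it is initial among all algebras with such data. -/
def WBC.IsUniversal {R A : Type} [CommRing R] [Ring A] [Algebra R A] {r t : ℕ}
    (d : WBC R A r t) : Prop :=
  ∀ (B : Type) [Ring B] [Algebra R B], ∀ d' : WBC R B r t, ∃! φ : A →ₐ[R] B, WBCHom d d' φ

/-- An element of `D^f_{r,t}`: data `1 ≤ i_1 < ⋯ < i_f ≤ r` and `k ≤ j_k ≤ t`
(all 1-based) describing `s_{f,i_f} s̄_{f,j_f} ⋯ s_{1,i_1} s̄_{1,j_1}`. -/
structure DElt (r t f : ℕ) : Type where
  a : Fin f → ℕ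
  b : Fin f → ℕ
  ha_mono : StrictMono a
  ha_lb : ∀ k, 1 ≤ a k
  ha_ub : ∀ k, a k ≤ r
  hb_lb : ∀ k : Fin f, (k : ℕ) + 1 ≤ b k
  hb_ub : ∀ k, b k ≤ t

/-- The `Σ_r`-component `s_{f,i_f} ⋯ s_{1,i_1}` of the element of `D^f_{r,t}`. -/
def DElt.pr {r t f : ℕ} (x : DElt r t f) : Equiv.Perm (Fin r) :=
  ((List.finRange f).reverse.map (fun (k : Fin f) => sIJ r ((k : ℕ) + 1) (x.a k))).prod

/-- The `Σ_t`-component `s̄_{f,j_f} ⋯ s̄_{1,j_1}` of the element of `D^f_{r,t}`. -/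
def DElt.pt {r t f : ℕ} (x : DElt r t f) : Equiv.Perm (Fin t) :=
  ((List.finRange f).reverse.map (fun (k : Fin f) => sIJ t ((k : ℕ) + 1) (x.b k))).prod

/-- Index for the basis `{c^α d_1⁻¹ e^f w d_2 c̄^β}` of `BC_{r,t}`; the component
`w ∈ Σ_{r-f} × Σ_{t-f}` is a pair of permutations fixing `1, …, f` pointwise. -/
structure BCIndex (r t : ℕ) : Type where
  α : Fin r → Fin 2
  β : Fin t → Fin 2
  f : ℕ
  hf : f ≤ min r t
  d1 : DElt r t f
  d2 : DElt r t f
  w : Equiv.Perm (Fin r)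
  wb : Equiv.Perm (Fin t)
  hw : ∀ i : Fin r, (i : ℕ) < f → w i = i
  hwb : ∀ j : Fin t, (j : ℕ) < f → wb j = j

/-- The basis element `c^α d_1⁻¹ e^f w d_2 c̄^β` of Theorem 2.4. -/
def WBC.basElt {R A : Type} [CommRing R] [Ring A] [Algebra R A] {r t : ℕ}
    (d : WBC R A r t) (x : BCIndex r t) : A :=
  d.cpow x.α * d.σ (x.d1.pr⁻¹) * d.σb (x.d1.pt⁻¹) * d.epow x.f *
    d.σ x.w * d.σb x.wb * d.σ x.d2.pr * d.σb x.d2.pt * d.cbpow x.β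

/-- Data for the presentation of the affine walled Brauer–Clifford superalgebra
`BC^aff_{r,t}` (Definition 3.1) with distinguished parameter `ω_1 ∈ R`.
`om k` is `ω_k` (with `ω_1` the scalar `ω1` and `ω_{2k} = 0`), `omb k` is `ω̄_k`. -/
structure AWBC (R A : Type) [CommRing R] [Ring A] [Algebra R A] (r t : ℕ) (ω1 : R)
    extends WBC R A r t : Type where
  x1 : A
  xb1 : A
  om : ℕ → A
  omb : ℕ → A
  om_one : om 1 = algebraMap R A ω1
  om_even : ∀ k, om (2 * k) = 0
  omb_zero : omb 0 = 0
  om_comm : ∀ k, (∀ w, om k * σ w = σ w * om k) ∧ (∀ w, om k * σb w = σb w * om k) ∧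
    (∀ i, om k * c i = c i * om k) ∧ (∀ j, om k * cb j = cb j * om k) ∧
    om k * e = e * om k ∧ om k * x1 = x1 * om k ∧ om k * xb1 = xb1 * om k ∧
    (∀ l, om k * om l = om l * om k) ∧ (∀ l, om k * omb l = omb l * om k)
  omb_comm : ∀ k, (∀ w, omb k * σ w = σ w * omb k) ∧ (∀ w, omb k * σb w = σb w * omb k) ∧
    (∀ i, omb k * c i = c i * omb k) ∧ (∀ j, omb k * cb j = cb j * omb k) ∧
    omb k * e = e * omb k ∧ omb k * x1 = x1 * omb k ∧ omb k * xb1 = xb1 * omb k ∧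
    (∀ l, omb k * omb l = omb l * omb k)
  x_comm : ∀ h : 1 < r, x1 * (σ (sw r 0 1) * x1 * σ (sw r 0 1)
      - (1 - c ⟨0, by omega⟩ * c ⟨1, h⟩) * σ (sw r 0 1))
    = (σ (sw r 0 1) * x1 * σ (sw r 0 1)
      - (1 - c ⟨0, by omega⟩ * c ⟨1, h⟩) * σ (sw r 0 1)) * x1
  x1_c1 : ∀ h : 0 < r, x1 * c ⟨0, h⟩ = -(c ⟨0, h⟩ * x1)
  x1_c : ∀ i : Fin r, (i : ℕ) ≠ 0 → x1 * c i = c i * x1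
  s_x1 : ∀ i : ℕ, 0 < i → i + 1 < r → σ (sw r i (i + 1)) * x1 = x1 * σ (sw r i (i + 1))
  xb_comm : ∀ h : 1 < t, xb1 * (σb (sw t 0 1) * xb1 * σb (sw t 0 1)
      - (1 + cb ⟨0, by omega⟩ * cb ⟨1, h⟩) * σb (sw t 0 1))
    = (σb (sw t 0 1) * xb1 * σb (sw t 0 1)
      - (1 + cb ⟨0, by omega⟩ * cb ⟨1, h⟩) * σb (sw t 0 1)) * xb1
  xb1_cb1 : ∀ h : 0 < t, xb1 * cb ⟨0, h⟩ = -(cb ⟨0, h⟩ * xb1)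
  xb1_cb : ∀ j : Fin t, (j : ℕ) ≠ 0 → xb1 * cb j = cb j * xb1
  sb_xb1 : ∀ j : ℕ, 0 < j → j + 1 < t → σb (sw t j (j + 1)) * xb1 = xb1 * σb (sw t j (j + 1))
  e_xsum : e * (x1 + xb1) = 0
  xsum_e : (x1 + xb1) * e = 0
  e_sxs : 1 < r → e * (σ (sw r 0 1) * x1 * σ (sw r 0 1)) = (σ (sw r 0 1) * x1 * σ (sw r 0 1)) * e
  x_mixed : ∀ h : 0 < r, x1 * (e + xb1 - c ⟨0, h⟩ * e * c ⟨0, h⟩)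
      = (e - c ⟨0, h⟩ * e * c ⟨0, h⟩ + xb1) * x1
  e_sbxbsb : 1 < t →
    e * (σb (sw t 0 1) * xb1 * σb (sw t 0 1)) = (σb (sw t 0 1) * xb1 * σb (sw t 0 1)) * e
  e_xodd : ∀ k : ℕ, e * x1 ^ (2 * k + 1) * e = om (2 * k + 1) * e
  e_xeven : ∀ k : ℕ, 1 ≤ k → e * x1 ^ (2 * k) * e = 0
  e_xb : ∀ k : ℕ, 1 ≤ k → e * xb1 ^ k * e = omb k * e
  x1_cb_comm : ∀ j, x1 * cb j = cb j * x1
  xb1_c_comm : ∀ i, xb1 * c i = c i * xb1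
  x1_σb : ∀ w, σb w * x1 = x1 * σb w
  xb1_σ : ∀ w, σ w * xb1 = xb1 * σ w

namespace AWBC

variable {R A : Type} [CommRing R] [Ring A] [Algebra R A] {r t : ℕ} {ω1 : R}

/-- `x'_i = s_{i-1} ⋯ s_1 x_1 s_1 ⋯ s_{i-1}` (1-based). -/
def xp (d : AWBC R A r t ω1) (i : ℕ) : A :=
  ((List.range (i - 1)).reverse.map (fun k => d.toWBC.s (k + 1))).prod * d.x1 *
    ((List.range (i - 1)).map (fun k => d.toWBC.s (k + 1))).prod

/-- `x̄'_j = s̄_{j-1} ⋯ s̄_1 x̄_1 s̄_1 ⋯ s̄_{j-1}` (1-based). -/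
def xbp (d : AWBC R A r t ω1) (j : ℕ) : A :=
  ((List.range (j - 1)).reverse.map (fun k => d.toWBC.sb (k + 1))).prod * d.xb1 *
    ((List.range (j - 1)).map (fun k => d.toWBC.sb (k + 1))).prod

/-- `x_i = x'_i - L_i`. -/
def xv (d : AWBC R A r t ω1) (i : ℕ) : A := d.xp i - d.toWBC.L i

/-- `x̄_j = x̄'_j - L̄_j`. -/
def xbv (d : AWBC R A r t ω1) (j : ℕ) : A := d.xbp j - d.toWBC.Lb j

/-- `x^α = x_1^{α_1} ⋯ x_r^{α_r}`. -/
def xpow (d : AWBC R A r t ω1) (α : Fin r → ℕ) : A :=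
  ((List.finRange r).map (fun (i : Fin r) => d.xv ((i : ℕ) + 1) ^ α i)).prod

/-- `x̄^β = x̄_1^{β_1} ⋯ x̄_t^{β_t}`. -/
def xbpow (d : AWBC R A r t ω1) (β : Fin t → ℕ) : A :=
  ((List.finRange t).map (fun (j : Fin t) => d.xbv ((j : ℕ) + 1) ^ β j)).prod

/-- `∏_{n ∈ ℤ^{>0}} ω_{2n+1}^{a_{2n+1}}`, where `g i` is the exponent of `ω_{2(i+1)+1}`. -/
def ompow (d : AWBC R A r t ω1) (g : ℕ →₀ ℕ) : A :=
  ((g.support.sort (· ≤ ·)).map (fun n => d.om (2 * n + 3) ^ g n)).prod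

/-- `z_i = x'_i + y_i`. -/
def z (d : AWBC R A r t ω1) (i : ℕ) : A := d.xp i + d.toWBC.y i

/-- `z̄_j = x̄'_j + ȳ_j`. -/
def zb (d : AWBC R A r t ω1) (j : ℕ) : A := d.xbp j + d.toWBC.yb j

/-- Generators of the subalgebra `BC_{2,m,m}`-type subalgebra:
`e_1, s_1, …, s_{m-1}, s̄_1, …, s̄_{m-1}, c_1, c̄_1, x_1, x̄_1`. -/
def lowerGensA (d : AWBC R A r t ω1) (m : ℕ) : Set A :=
  d.toWBC.lowerGens m ∪ {x | 1 ≤ m ∧ (x = d.x1 ∨ x = d.xb1)}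

end AWBC

/-- `φ` intertwines two sets of affine walled Brauer–Clifford data. -/
structure AWBCHom {R A B : Type} [CommRing R] [Ring A] [Algebra R A] [Ring B] [Algebra R B]
    {r t : ℕ} {ω1 : R} (d : AWBC R A r t ω1) (d' : AWBC R B r t ω1) (φ : A →ₐ[R] B) : Prop where
  map_σ : ∀ w, φ (d.σ w) = d'.σ w
  map_σb : ∀ w, φ (d.σb w) = d'.σb w
  map_c : ∀ i, φ (d.c i) = d'.c i
  map_cb : ∀ j, φ (d.cb j) = d'.cb j
  map_e : φ d.e = d'.e
  map_x1 : φ d.x1 = d'.x1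
  map_xb1 : φ d.xb1 = d'.xb1
  map_om : ∀ k, φ (d.om k) = d'.om k
  map_omb : ∀ k, φ (d.omb k) = d'.omb k

/-- `A` (with the data `d`) is the affine walled Brauer–Clifford superalgebra
`BC^aff_{r,t}` of Definition 3.1. -/
def AWBC.IsUniversal {R A : Type} [CommRing R] [Ring A] [Algebra R A] {r t : ℕ} {ω1 : R}
    (d : AWBC R A r t ω1) : Prop :=
  ∀ (B : Type) [Ring B] [Algebra R B], ∀ d' : AWBC R B r t ω1,
    ∃! φ : A →ₐ[R] B, AWBCHom d d' φ

/-- Assumption 3.6: the parameters `ω̄` are determined by the `ω`'s as in Corollary 3.5. -/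
def AWBC.Ass36 {R A : Type} [CommRing R] [Ring A] [Algebra R A] {r t : ℕ} {ω1 : R}
    (d : AWBC R A r t ω1) : Prop :=
  (∀ n, d.omb (2 * n) = 0) ∧
  (∀ n, d.omb (2 * n + 1) = ∑ j ∈ Finset.range (n + 1), acoef d.om n j * d.om (2 * j + 1))

/-- `A` (with the data `d`) is the affine walled Brauer–Clifford superalgebra
`BC^aff_{r,t}` subject to Assumption 3.6. -/
def AWBC.IsUniversal36 {R A : Type} [CommRing R] [Ring A] [Algebra R A] {r t : ℕ} {ω1 : R}
    (d : AWBC R A r t ω1) : Prop :=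
  d.Ass36 ∧ ∀ (B : Type) [Ring B] [Algebra R B], ∀ d' : AWBC R B r t ω1,
    d'.Ass36 → ∃! φ : A →ₐ[R] B, AWBCHom d d' φ

/-- The parameters `ω_k`, `ω̄_k` are the scalars `ω k`, `obar ω k` (specialization defining
the algebra `B̃C_{r,t}` of Definition 3.13). -/
def AWBC.IsSpec {R A : Type} [CommRing R] [Ring A] [Algebra R A] {r t : ℕ} {ω1 : R}
    (d : AWBC R A r t ω1) (ω : ℕ → R) : Prop :=
  (∀ k, d.om k = algebraMap R A (ω k)) ∧ (∀ k, 1 ≤ k → d.omb k = algebraMap R A (obar ω k))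

/-- `A` (with the data `d`) is the algebra `B̃C_{r,t}` of Definition 3.13 with parameters
`ω_{2n+1} ∈ R`. -/
def AWBC.IsSpecUniversal {R A : Type} [CommRing R] [Ring A] [Algebra R A] {r t : ℕ} {ω1 : R}
    (d : AWBC R A r t ω1) (ω : ℕ → R) : Prop :=
  d.IsSpec ω ∧ ∀ (B : Type) [Ring B] [Algebra R B], ∀ d' : AWBC R B r t ω1,
    d'.IsSpec ω → ∃! φ : A →ₐ[R] B, AWBCHom d d' φ

/-- The cyclotomic relations `f(x_1) = 0` and `g(x̄_1) = 0`. -/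
def AWBC.IsCyc {R A : Type} [CommRing R] [Ring A] [Algebra R A] {r t : ℕ} {ω1 : R}
    (d : AWBC R A r t ω1) (f g : Polynomial R) : Prop :=
  Polynomial.aeval d.x1 f = 0 ∧ Polynomial.aeval d.xb1 g = 0

/-- `A` (with the data `d`) is the cyclotomic walled Brauer–Clifford superalgebra
`BC_{ℓ,r,t}` of Definition 3.14 attached to `f`, `g` and the scalar parameters `ω`. -/
def AWBC.IsCycUniversal {R A : Type} [CommRing R] [Ring A] [Algebra R A] {r t : ℕ} {ω1 : R}
    (d : AWBC R A r t ω1) (ω : ℕ → R) (f g : Polynomial R) : Prop :=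
  d.IsSpec ω ∧ d.IsCyc f g ∧ ∀ (B : Type) [Ring B] [Algebra R B], ∀ d' : AWBC R B r t ω1,
    d'.IsSpec ω → d'.IsCyc f g → ∃! φ : A →ₐ[R] B, AWBCHom d d' φ

/-- Index of a regular monomial `x^α d x̄^β ∏_{n≥1} ω_{2n+1}^{a_{2n+1}}` of `BC^aff_{r,t}`. -/
structure ARIndex (r t : ℕ) : Type where
  α : Fin r → ℕ
  β : Fin t → ℕ
  dIdx : BCIndex r t
  g : ℕ →₀ ℕ

/-- The regular monomial `x^α d x̄^β ∏_{n≥1} ω_{2n+1}^{a_{2n+1}}` of Definition 3.11. -/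
def AWBC.regElt {R A : Type} [CommRing R] [Ring A] [Algebra R A] {r t : ℕ} {ω1 : R}
    (d : AWBC R A r t ω1) (x : ARIndex r t) : A :=
  d.xpow x.α * d.toWBC.basElt x.dIdx * d.xbpow x.β * d.ompow x.g

/-- Index of a regular monomial `x^α d x̄^β` of `B̃C_{r,t}`. -/
structure SIndex (r t : ℕ) : Type where
  α : Fin r → ℕ
  β : Fin t → ℕ
  dIdx : BCIndex r t

/-- The regular monomial `x^α d x̄^β` of `B̃C_{r,t}`. -/
def AWBC.sregElt {R A : Type} [CommRing R] [Ring A] [Algebra R A] {r t : ℕ} {ω1 : R}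
    (d : AWBC R A r t ω1) (x : SIndex r t) : A :=
  d.xpow x.α * d.toWBC.basElt x.dIdx * d.xbpow x.β

/-- Index of a regular monomial `x^α d x̄^β` of the level `ℓ` algebra `BC_{ℓ,r,t}`,
with exponents in `{0, 1, …, ℓ-1}`. -/
structure CIndex (r t ℓ : ℕ) : Type where
  α : Fin r → Fin ℓ
  β : Fin t → Fin ℓ
  dIdx : BCIndex r t

/-- The regular monomial `x^α d x̄^β` of `BC_{ℓ,r,t}`. -/
def AWBC.cregElt {R A : Type} [CommRing R] [Ring A] [Algebra R A] {r t ℓ : ℕ} {ω1 : R}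
    (d : AWBC R A r t ω1) (x : CIndex r t ℓ) : A :=
  d.xpow (fun i => (x.α i : ℕ)) * d.toWBC.basElt x.dIdx * d.xbpow (fun j => (x.β j : ℕ))

/-- Admissibility (Definition 6.4): writing `f(x) = x^{k+2m} + ∑_{i=1}^{2m} a_i x^{k+2m-i}`,
one has `ω_L = -(a_1 ω_{L-1} + ⋯ + a_{2m} ω_{L-2m})` for all `L ≥ k + 2m`. -/
def AdmissibleParam {R : Type} [CommRing R] (ω : ℕ → R) (f : Polynomial R) (k m : ℕ) : Prop :=
  ∀ L, k + 2 * m ≤ L →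
    ω L = -∑ i ∈ Finset.Icc 1 (2 * m), f.coeff (k + 2 * m - i) * ω (L - i)

/-- The parameters `ω_0 = 0`, `ω_1 = -2m(2p-2m+1)`, `ω_i = p(p+1) ω_{i-2}` of (4.16). -/
def omSeq (m : ℕ) (p : ℂ) : ℕ → ℂ
  | 0 => 0
  | 1 => -2 * (m : ℂ) * (2 * p - 2 * (m : ℂ) + 1)
  | n + 2 => p * (p + 1) * omSeq m p n

/-- Index of a monomial `d_1^{-1} c^α x'^β e^f x̄'^{β̄} c̄^{ᾱ} w d_2` of (4.20). -/
structure L2Index (r t : ℕ) : Type where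
  α : Fin r → Fin 2
  βx : Fin r → Fin 2
  αb : Fin t → Fin 2
  βxb : Fin t → Fin 2
  f : ℕ
  hf : f ≤ min r t
  d1 : DElt r t f
  d2 : DElt r t f
  w : Equiv.Perm (Fin r)
  wb : Equiv.Perm (Fin t)
  hw : ∀ i : Fin r, (i : ℕ) < f → w i = i
  hwb : ∀ j : Fin t, (j : ℕ) < f → wb j = j

/-- The monomial `d_1^{-1} c^α x'^β e^f x̄'^{β̄} c̄^{ᾱ} w d_2` of (4.20), where
`x'^β = x'_r{}^{β_r} ⋯ x'_1{}^{β_1}` and `x̄'^{β̄} = x̄'_t{}^{β̄_t} ⋯ x̄'_1{}^{β̄_1}`. -/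
def AWBC.l2Elt {R A : Type} [CommRing R] [Ring A] [Algebra R A] {r t : ℕ} {ω1 : R}
    (d : AWBC R A r t ω1) (x : L2Index r t) : A :=
  d.toWBC.σ (x.d1.pr⁻¹) * d.toWBC.σb (x.d1.pt⁻¹) * d.toWBC.cpow x.α *
    ((List.finRange r).reverse.map (fun (i : Fin r) => d.xp ((i : ℕ) + 1) ^ (x.βx i : ℕ))).prod *
    d.toWBC.epow x.f *
    ((List.finRange t).reverse.map (fun (j : Fin t) => d.xbp ((j : ℕ) + 1) ^ (x.βxb j : ℕ))).prod *
    d.toWBC.cbpow x.αb *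
    d.toWBC.σ x.w * d.toWBC.σb x.wb * d.toWBC.σ x.d2.pr * d.toWBC.σb x.d2.pt

open Polynomial
noncomputable section

/-! ### A Clifford algebra given by generators and relations -/

inductive ClRel (R ι : Type) [CommRing R] : FreeAlgebra R ι → FreeAlgebra R ι → Prop
  | sq (i : ι) : ClRel R ι (FreeAlgebra.ι R i * FreeAlgebra.ι R i) (-1)
  | anti (i j : ι) (h : i ≠ j) : ClRel R ι (FreeAlgebra.ι R i * FreeAlgebra.ι R j)
      (-(FreeAlgebra.ι R j * FreeAlgebra.ι R i))

def Cl (R ι : Type) [CommRing R] : Type := RingQuot (ClRel R ι)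

instance (R ι : Type) [CommRing R] : Ring (Cl R ι) := inferInstanceAs (Ring (RingQuot (ClRel R ι)))

instance (R ι : Type) [CommRing R] : Algebra R (Cl R ι) :=
  inferInstanceAs (Algebra R (RingQuot (ClRel R ι)))

namespace Cl

variable {R ι : Type} [CommRing R]

def mk (R ι : Type) [CommRing R] : FreeAlgebra R ι →ₐ[R] Cl R ι :=
  RingQuot.mkAlgHom R (ClRel R ι)

theorem mk_surj : Function.Surjective (mk R ι) := RingQuot.mkAlgHom_surjective R (ClRel R ι)

theorem mk_rel {a b : FreeAlgebra R ι} (h : ClRel R ι a b) : mk R ι a = mk R ι b :=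
  RingQuot.mkAlgHom_rel R h

def g (R : Type) {ι : Type} [CommRing R] (i : ι) : Cl R ι :=
  mk R ι (FreeAlgebra.ι R i)

theorem g_sq (i : ι) : g R i * g R i = -1 := by
  have := mk_rel (ClRel.sq (R := R) i)
  simpa [g] using this

theorem g_anti (i j : ι) (h : i ≠ j) : g R i * g R j = -(g R j * g R i) := by
  have := mk_rel (ClRel.anti (R := R) i j h)
  simpa [g] using this

theorem g_sq' (i : ι) (y : Cl R ι) : g R i * (g R i * y) = -y := by
  rw [← mul_assoc, g_sq, neg_one_mul]

theorem g_anti' (i j : ι) (h : i ≠ j) (y : Cl R ι) :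
    g R i * (g R j * y) = -(g R j * (g R i * y)) := by
  rw [← mul_assoc, g_anti i j h, neg_mul, mul_assoc]

/-- universal property -/
def lift {B : Type} [Ring B] [Algebra R B] (u : ι → B) (hsq : ∀ i, u i * u i = -1)
    (ha : ∀ i j, i ≠ j → u i * u j = -(u j * u i)) : Cl R ι →ₐ[R] B :=
  RingQuot.liftAlgHom R ⟨FreeAlgebra.lift R u, by
    intro x y h
    cases h with
    | sq i => simp [hsq]
    | anti i j h => simp [ha i j h]⟩

@[simp] theorem lift_g {B : Type} [Ring B] [Algebra R B] (u : ι → B) (hsq : ∀ i, u i * u i = -1)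
    (ha : ∀ i j, i ≠ j → u i * u j = -(u j * u i)) (i : ι) :
    lift (R := R) u hsq ha (g R i) = u i := by
  have := RingQuot.liftAlgHom_mkAlgHom_apply R (FreeAlgebra.lift R u) (s := ClRel R ι) (by
    intro x y h
    cases h with
    | sq i => simp [hsq]
    | anti i j h => simp [ha i j h]) (FreeAlgebra.ι R i)
  rw [FreeAlgebra.lift_ι_apply] at this
  exact this

theorem induct (p : Submodule R (Cl R ι)) (h1 : 1 ∈ p)
    (hg : ∀ i, ∀ y ∈ p, g R i * y ∈ p) (y : Cl R ι) : y ∈ p := by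
  have key : ∀ a : FreeAlgebra R ι, ∀ y ∈ p, mk R ι a * y ∈ p := by
    intro a
    induction a using FreeAlgebra.induction with
    | grade0 x =>
      intro y hy
      rw [AlgHom.commutes, ← Algebra.smul_def]
      exact p.smul_mem _ hy
    | grade1 x => intro y hy; exact hg x y hy
    | mul a b ha hb => intro y hy; rw [map_mul, mul_assoc]; exact ha _ (hb _ hy)
    | add a b ha hb => intro y hy; rw [map_add, add_mul]; exact p.add_mem (ha _ hy) (hb _ hy)
  obtain ⟨a, rfl⟩ := mk_surj y
  simpa using key a 1 h1

theorem induct1 (i₁ : ι) (p : Submodule R (Cl R ι)) (h1 : 1 ∈ p) (h2 : g R i₁ ∈ p)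
    (hg : ∀ i, i ≠ i₁ → ∀ y ∈ p, g R i * y ∈ p) (y : Cl R ι) : y ∈ p := by
  have := induct (p ⊓ p.comap (LinearMap.mulLeft R (g R i₁))) (by simp [h1, h2]) (by
    rintro i y ⟨hy, hy'⟩
    simp only [Submodule.comap_coe, Set.mem_preimage, SetLike.mem_coe,
      LinearMap.mulLeft_apply] at hy'
    by_cases h : i = i₁
    · subst h
      refine ⟨hy', ?_⟩
      simp only [Submodule.comap_coe, Set.mem_preimage, SetLike.mem_coe, LinearMap.mulLeft_apply]
      rw [g_sq']; exact p.neg_mem hy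
    · refine ⟨hg i h y hy, ?_⟩
      simp only [Submodule.comap_coe, Set.mem_preimage, SetLike.mem_coe, LinearMap.mulLeft_apply]
      rw [g_anti' _ _ (Ne.symm h)]; exact p.neg_mem (hg i h _ hy')) y
  exact this.1

theorem induct2 (i₁ i₂ : ι) (h12 : i₁ ≠ i₂) (p : Submodule R (Cl R ι)) (h1 : 1 ∈ p)
    (h2 : g R i₁ ∈ p) (h3 : g R i₂ ∈ p) (h4 : g R i₂ * g R i₁ ∈ p)
    (hg : ∀ i, i ≠ i₁ → i ≠ i₂ → ∀ y ∈ p, g R i * y ∈ p) (y : Cl R ι) : y ∈ p := by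
  have := induct1 i₁ (p ⊓ p.comap (LinearMap.mulLeft R (g R i₂))) (by simp [h1, h3])
    (by simp [h2, h4]) (by
    rintro i hi y ⟨hy, hy'⟩
    simp only [Submodule.comap_coe, Set.mem_preimage, SetLike.mem_coe,
      LinearMap.mulLeft_apply] at hy'
    by_cases h : i = i₂
    · subst h
      refine ⟨hy', ?_⟩
      simp only [Submodule.comap_coe, Set.mem_preimage, SetLike.mem_coe, LinearMap.mulLeft_apply]
      rw [g_sq']; exact p.neg_mem hy
    · refine ⟨hg i hi h y hy, ?_⟩
      simp only [Submodule.comap_coe, Set.mem_preimage, SetLike.mem_coe, LinearMap.mulLeft_apply]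
      rw [g_anti' _ _ (Ne.symm h)]; exact p.neg_mem (hg i hi h _ hy')) y
  exact this.1

theorem lin_ext (F G : Cl R ι →ₗ[R] Cl R ι) (h1 : F 1 = G 1)
    (hg : ∀ i y, F y = G y → F (g R i * y) = G (g R i * y)) : F = G := by
  ext y
  have := induct (LinearMap.eqLocus F G) (by simpa using h1)
    (fun i y hy => by simpa using hg i y (by simpa using hy)) y
  simpa using this

theorem lin_ext1 (i₁ : ι) (F G : Cl R ι →ₗ[R] Cl R ι) (h1 : F 1 = G 1)
    (h2 : F (g R i₁) = G (g R i₁))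
    (hg : ∀ i, i ≠ i₁ → ∀ y, F y = G y → F (g R i * y) = G (g R i * y)) : F = G := by
  ext y
  have := induct1 i₁ (LinearMap.eqLocus F G) (by simpa using h1) (by simpa using h2)
    (fun i hi y hy => by simpa using hg i hi y (by simpa using hy)) y
  simpa using this

theorem lin_ext2 (i₁ i₂ : ι) (h12 : i₁ ≠ i₂) (F G : Cl R ι →ₗ[R] Cl R ι) (h1 : F 1 = G 1)
    (h2 : F (g R i₁) = G (g R i₁)) (h3 : F (g R i₂) = G (g R i₂))
    (h4 : F (g R i₂ * g R i₁) = G (g R i₂ * g R i₁))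
    (hg : ∀ i, i ≠ i₁ → i ≠ i₂ → ∀ y, F y = G y → F (g R i * y) = G (g R i * y)) : F = G := by
  ext y
  have := induct2 i₁ i₂ h12 (LinearMap.eqLocus F G) (by simpa using h1) (by simpa using h2)
    (by simpa using h3) (by simpa using h4)
    (fun i hi hi' y hy => by simpa using hg i hi hi' y (by simpa using hy)) y
  simpa using this

/-- grading involution -/
def inv (R ι : Type) [CommRing R] : Cl R ι →ₐ[R] Cl R ι :=
  lift (fun i => - g R i) (fun i => by simp [g_sq]) (fun i j h => by rw [neg_mul_neg, neg_mul_neg, g_anti i j h])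

@[simp] theorem inv_g (i : ι) : inv R ι (g R i) = - g R i := by simp [inv]

@[simp] theorem inv_inv (y : Cl R ι) : inv R ι (inv R ι y) = y := by
  have := lin_ext ((inv R ι).toLinearMap ∘ₗ (inv R ι).toLinearMap) LinearMap.id (by simp)
    (by intro i y h; simp at h; simp [h])
  exact LinearMap.congr_fun this y

/-- permutation automorphisms -/
def pm (w : Equiv.Perm ι) : Cl R ι →ₐ[R] Cl R ι :=
  lift (fun i => g R (w i)) (fun i => g_sq _)
    (fun i j h => g_anti _ _ (fun hh => h (w.injective hh)))

@[simp] theorem pm_g (w : Equiv.Perm ι) (i : ι) : pm (R := R) w (g R i) = g R (w i) := by simp [pm]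

theorem pm_mul (w v : Equiv.Perm ι) (y : Cl R ι) : pm (w * v) y = pm w (pm v y) := by
  have := lin_ext (pm (R := R) (w * v)).toLinearMap ((pm w).toLinearMap ∘ₗ (pm v).toLinearMap)
    (by simp) (by intro i y h; simp at h; simp [h])
  exact LinearMap.congr_fun this y

theorem pm_one (y : Cl R ι) : pm (1 : Equiv.Perm ι) y = y := by
  have := lin_ext (pm (R := R) (1 : Equiv.Perm ι)).toLinearMap LinearMap.id
    (by simp) (by intro i y h; simp at h; simp [h])
  exact LinearMap.congr_fun this y

theorem pm_inv (w : Equiv.Perm ι) (y : Cl R ι) : pm w (inv R ι y) = inv R ι (pm w y) := by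
  have := lin_ext ((pm (R := R) w).toLinearMap ∘ₗ (inv R ι).toLinearMap)
    ((inv R ι).toLinearMap ∘ₗ (pm w).toLinearMap)
    (by simp) (by intro i y h; simp at h; simp [h])
  exact LinearMap.congr_fun this y

/-- The substitution operator `y + z γ₁ ↦ y + z γ_j` -/
def sub (q : R) (i₁ j : ι) : Cl R ι →ₗ[R] Cl R ι :=
  q • (LinearMap.mulRight R (1 - g R i₁ * g R j)
    - LinearMap.mulLeft R (g R i₁) ∘ₗ LinearMap.mulRight R (g R i₁ - g R j)
      ∘ₗ (inv R ι).toLinearMap)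

theorem sub_g_mul (q : R) (i₁ j : ι) (x : ι) (hx : x ≠ i₁) (y : Cl R ι) :
    sub q i₁ j (g R x * y) = g R x * sub q i₁ j y := by
  simp only [sub, LinearMap.smul_apply, LinearMap.sub_apply, LinearMap.mulRight_apply,
    LinearMap.comp_apply, LinearMap.mulLeft_apply, AlgHom.toLinearMap_apply, map_mul, inv_g,
    mul_smul_comm]
  congr 1
  rw [neg_mul, neg_mul, mul_neg, mul_assoc (g R x) (inv R ι y), g_anti' _ _ (Ne.symm hx)]
  noncomm_ring

theorem sub_one (q : R) (hq : q * 2 = 1) (i₁ j : ι) : sub q i₁ j 1 = 1 := by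
  have : sub q i₁ j 1 = (q * 2) • (1 : Cl R ι) := by
    simp only [sub, LinearMap.smul_apply, LinearMap.sub_apply, LinearMap.mulRight_apply,
      LinearMap.comp_apply, LinearMap.mulLeft_apply, AlgHom.toLinearMap_apply, map_one,
      mul_smul, one_mul, mul_sub, g_sq]
    congr 1
    rw [two_smul]; noncomm_ring
  rw [this, hq, one_smul]

theorem sub_g (q : R) (hq : q * 2 = 1) (i₁ j : ι) (h : j ≠ i₁) : sub q i₁ j (g R i₁) = g R j := by
  have : sub q i₁ j (g R i₁) = (q * 2) • (g R j) := by
    simp only [sub, LinearMap.smul_apply, LinearMap.sub_apply, LinearMap.mulRight_apply,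
      LinearMap.comp_apply, LinearMap.mulLeft_apply, AlgHom.toLinearMap_apply, inv_g,
      mul_smul, mul_sub, neg_mul, mul_neg, g_sq', mul_one, g_sq]
    congr 1
    rw [two_smul]; noncomm_ring
  rw [this, hq, one_smul]

theorem sub_g' (q : R) (hq : q * 2 = 1) (i₁ j : ι) (x : ι) (hx : x ≠ i₁) :
    sub q i₁ j (g R x) = g R x := by
  have := sub_g_mul q i₁ j x hx 1
  simpa [sub_one q hq] using this

end Cl
end

open Polynomial
noncomputable section

/-! ### The flipped regular module -/

namespace FM
open Cl

variable {R : Type} [CommRing R] {r t : ℕ}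

abbrev II (r t : ℕ) : Type := Fin r ⊕ Fin t
abbrev PP (r t : ℕ) : Type := Equiv.Perm (II r t)
abbrev MM (R : Type) [CommRing R] (r t : ℕ) : Type := PP r t →₀ Cl R (II r t)

def Op (p : PP r t → PP r t) (f : PP r t → Cl R (II r t) →ₗ[R] Cl R (II r t)) :
    Module.End R (MM R r t) :=
  Finsupp.lsum R (fun π => Finsupp.lsingle (p π) ∘ₗ f π)

@[simp] theorem Op_single (p : PP r t → PP r t) (f : PP r t → Cl R (II r t) →ₗ[R] Cl R (II r t))
    (π : PP r t) (y : Cl R (II r t)) :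
    Op p f (Finsupp.single π y) = Finsupp.single (p π) (f π y) := by
  simp [Op]

theorem op_ext {S T : Module.End R (MM R r t)}
    (h : ∀ π y, S (Finsupp.single π y) = T (Finsupp.single π y)) : S = T :=
  Finsupp.lhom_ext h

def lw (t : ℕ) (w : Equiv.Perm (Fin r)) : PP r t := Equiv.Perm.sumCongr w 1
def rw' (r : ℕ) (v : Equiv.Perm (Fin t)) : PP r t := Equiv.Perm.sumCongr 1 v

@[simp] theorem lw_inl (w : Equiv.Perm (Fin r)) (i : Fin r) :
    lw t w (Sum.inl i) = Sum.inl (w i) := by simp [lw]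
@[simp] theorem lw_inr (w : Equiv.Perm (Fin r)) (i : Fin t) :
    lw t w (Sum.inr i) = Sum.inr i := by simp [lw]
@[simp] theorem rw_inl (w : Equiv.Perm (Fin t)) (i : Fin r) :
    rw' r w (Sum.inl i) = Sum.inl i := by simp [rw']
@[simp] theorem rw_inr (w : Equiv.Perm (Fin t)) (i : Fin t) :
    rw' r w (Sum.inr i) = Sum.inr (w i) := by simp [rw']

theorem lw_mul (w v : Equiv.Perm (Fin r)) : lw t (w * v) = lw t w * lw t v := by
  ext x; cases x <;> simp
theorem rw_mul (w v : Equiv.Perm (Fin t)) : rw' r (w * v) = rw' r w * rw' r v := by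
  ext x; cases x <;> simp
@[simp] theorem lw_one : lw t (1 : Equiv.Perm (Fin r)) = 1 := by
  ext x; cases x <;> simp
@[simp] theorem rw_one : rw' r (1 : Equiv.Perm (Fin t)) = 1 := by
  ext x; cases x <;> simp
theorem lw_inv (w : Equiv.Perm (Fin r)) : lw t w⁻¹ = (lw t w)⁻¹ := by
  rw [eq_inv_iff_mul_eq_one, ← lw_mul]; simp
theorem rw_inv (w : Equiv.Perm (Fin t)) : rw' r w⁻¹ = (rw' r w)⁻¹ := by
  rw [eq_inv_iff_mul_eq_one, ← rw_mul]; simp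

def Xσ (R : Type) [CommRing R] (r t : ℕ) : Equiv.Perm (Fin r) →* Module.End R (MM R r t) where
  toFun w := Op (fun π => lw t w * π) (fun _ => (pm (lw t w)).toLinearMap)
  map_one' := op_ext (by intro π y; simp [pm_one])
  map_mul' w v := op_ext (by
    intro π y; simp [pm_mul, lw_mul, mul_assoc])

def Xσb (R : Type) [CommRing R] (r t : ℕ) : Equiv.Perm (Fin t) →* Module.End R (MM R r t) where
  toFun v := Op (fun π => π * (rw' r v)⁻¹) (fun _ => LinearMap.id)
  map_one' := op_ext (by intro π y; simp)
  map_mul' w v := op_ext (by intro π y; simp [rw_mul, mul_assoc])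

@[simp] theorem Xσ_single (w : Equiv.Perm (Fin r)) (π : PP r t) (y : Cl R (II r t)) :
    Xσ R r t w (Finsupp.single π y) = Finsupp.single (lw t w * π) (pm (lw t w) y) := by
  simp [Xσ]

@[simp] theorem Xσb_single (w : Equiv.Perm (Fin t)) (π : PP r t) (y : Cl R (II r t)) :
    Xσb R r t w (Finsupp.single π y) = Finsupp.single (π * (rw' r w)⁻¹) y := by
  simp [Xσb]

def Xc (R : Type) [CommRing R] (r t : ℕ) (i : II r t) : Module.End R (MM R r t) :=
  Op id (fun _ => LinearMap.mulLeft R (g R i))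

@[simp] theorem Xc_single (i : II r t) (π : PP r t) (y : Cl R (II r t)) :
    Xc R r t i (Finsupp.single π y) = Finsupp.single π (g R i * y) := by
  simp [Xc]

def Xcb (R : Type) [CommRing R] (r t : ℕ) (j : Fin t) : Module.End R (MM R r t) :=
  Op id (fun π => LinearMap.mulRight R (g R (π (Sum.inr j))) ∘ₗ (Cl.inv R (II r t)).toLinearMap)

@[simp] theorem Xcb_single (j : Fin t) (π : PP r t) (y : Cl R (II r t)) :
    Xcb R r t j (Finsupp.single π y) =
      Finsupp.single π (Cl.inv R _ y * g R (π (Sum.inr j))) := by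
  simp [Xcb]

def Xe (q : R) (i₁ a : II r t) : Module.End R (MM R r t) :=
  Op (fun π => Equiv.swap i₁ (π a) * π) (fun π => if π a = i₁ then 0 else Cl.sub q i₁ (π a))

theorem Xe_zero (q : R) (i₁ a : II r t) (π : PP r t) (y : Cl R (II r t)) (h : π a = i₁) :
    Xe q i₁ a (Finsupp.single π y) = 0 := by
  simp [Xe, h]

theorem Xe_single (q : R) (i₁ a : II r t) (π : PP r t) (y : Cl R (II r t)) (h : π a ≠ i₁) :
    Xe q i₁ a (Finsupp.single π y) =
      Finsupp.single (Equiv.swap i₁ (π a) * π) (Cl.sub q i₁ (π a) y) := by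
  simp [Xe, h]

end FM

namespace Cl
variable {R ι : Type} [CommRing R]

theorem sub_free (q : R) (hq : q * 2 = 1) (i₁ j : ι) (hj : j ≠ i₁) (y : Cl R ι) :
    g R i₁ * sub q i₁ j y = inv R ι (sub q i₁ j y) * g R i₁ := by
  have := lin_ext1 i₁ (LinearMap.mulLeft R (g R i₁) ∘ₗ sub q i₁ j)
    (LinearMap.mulRight R (g R i₁) ∘ₗ (inv R ι).toLinearMap ∘ₗ sub q i₁ j)
    (by simp [sub_one q hq]) (by simp [sub_g q hq i₁ j hj, g_anti _ _ hj])
    (by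
      intro i hi y h
      simp at h
      simp [sub_g_mul q i₁ j i hi, g_anti' _ _ hi.symm, h, mul_assoc])
  exact LinearMap.congr_fun this y

theorem sub_c1 (q : R) (hq : q * 2 = 1) (i₁ j : ι) (hj : j ≠ i₁) (y : Cl R ι) :
    sub q i₁ j (g R i₁ * y) = sub q i₁ j (inv R ι y * g R j) := by
  have := lin_ext1 i₁ (sub q i₁ j ∘ₗ LinearMap.mulLeft R (g R i₁))
    (sub q i₁ j ∘ₗ LinearMap.mulRight R (g R j) ∘ₗ (inv R ι).toLinearMap)
    (by simp [sub_g q hq i₁ j hj, sub_g' q hq i₁ j j hj])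
    (by simp [g_sq, sub_one q hq, g_anti _ _ hj.symm, sub_g_mul q i₁ j j hj, sub_g q hq i₁ j hj])
    (by
      intro i hi y h
      simp at h
      simp [sub_g_mul q i₁ j i hi, g_anti' _ _ hi.symm, h, mul_assoc])
  exact LinearMap.congr_fun this y

/-- `sub` fixes elements in the image of `sub`. -/
theorem sub_sub (q : R) (hq : q * 2 = 1) (i₁ j j' : ι) (hj : j ≠ i₁) (y : Cl R ι) :
    sub q i₁ j' (sub q i₁ j y) = sub q i₁ j y := by
  have := lin_ext1 i₁ (sub q i₁ j' ∘ₗ sub q i₁ j) (sub q i₁ j)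
    (by simp [sub_one q hq]) (by simp [sub_g q hq i₁ j hj, sub_g' q hq i₁ j' j hj])
    (by
      intro i hi y h
      simp at h
      simp [sub_g_mul q i₁ _ i hi, h])
  exact LinearMap.congr_fun this y

theorem sub_pm (q : R) (hq : q * 2 = 1) (i₁ j : ι) (hj : j ≠ i₁) (w : Equiv.Perm ι)
    (hw : w i₁ = i₁) (y : Cl R ι) :
    pm w (sub q i₁ j y) = sub q i₁ (w j) (pm w y) := by
  have hwj : w j ≠ i₁ := fun h => hj (w.injective (h.trans hw.symm))
  have := lin_ext1 i₁ ((pm w).toLinearMap ∘ₗ sub q i₁ j) (sub q i₁ (w j) ∘ₗ (pm w).toLinearMap)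
    (by simp [sub_one q hq]) (by simp [sub_g q hq i₁ j hj, hw, sub_g q hq i₁ _ hwj])
    (by
      intro i hi y h
      simp at h
      have hwi : w i ≠ i₁ := fun h => hi (w.injective (h.trans hw.symm))
      simp [sub_g_mul q i₁ _ i hi, h, sub_g_mul q i₁ _ _ hwi])
  exact LinearMap.congr_fun this y

theorem sub_cb [DecidableEq ι] (q : R) (hq : q * 2 = 1) (i₁ l x : ι) (hl : l ≠ i₁) (hx : x ≠ l)
    (y : Cl R ι) :
    sub q i₁ l (inv R ι y * g R x) = inv R ι (sub q i₁ l y) * g R (Equiv.swap i₁ l x) := by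
  have := lin_ext1 i₁ (sub q i₁ l ∘ₗ LinearMap.mulRight R (g R x) ∘ₗ (inv R ι).toLinearMap)
    (LinearMap.mulRight R (g R (Equiv.swap i₁ l x)) ∘ₗ (inv R ι).toLinearMap ∘ₗ sub q i₁ l)
    (by
      by_cases h : x = i₁
      · subst h; simp [sub_one q hq, sub_g q hq _ l hl]
      · simp [sub_one q hq, sub_g' q hq i₁ l x h, Equiv.swap_apply_of_ne_of_ne h hx])
    (by
      by_cases h : x = i₁
      · subst h; simp [sub_one q hq, sub_g q hq _ l hl, g_sq]
      · simp [sub_g q hq i₁ l hl, sub_g' q hq i₁ l x h, Equiv.swap_apply_of_ne_of_ne h hx,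
          g_anti _ _ (Ne.symm h), g_anti _ _ hx, sub_g_mul q i₁ l x h])
    (by
      intro i hi y h
      simp at h
      simp [sub_g_mul q i₁ _ i hi, h, mul_assoc])
  exact LinearMap.congr_fun this y

end Cl
end

open Polynomial
noncomputable section

namespace FM
open Cl

variable {R : Type} [CommRing R] {r t : ℕ}

theorem lw_swap (i j : Fin r) : lw t (Equiv.swap i j) = Equiv.swap (Sum.inl i) (Sum.inl j) := by
  ext x; cases x with
  | inl x => simp [Equiv.swap_apply_def]; split_ifs <;> rfl
  | inr x => simp [Equiv.swap_apply_def]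

theorem rw_swap (i j : Fin t) : rw' r (Equiv.swap i j) = Equiv.swap (Sum.inr i) (Sum.inr j) := by
  ext x; cases x with
  | inr x => simp [Equiv.swap_apply_def]; split_ifs <;> rfl
  | inl x => simp [Equiv.swap_apply_def]

theorem swap_one_apply {ι : Type} [DecidableEq ι] (π : Equiv.Perm ι) (i a : ι) :
    (Equiv.swap i (π a) * π) a = i := by simp

theorem perm1 {ι : Type} [DecidableEq ι] (π : Equiv.Perm ι) (i₁ i₂ a a₂ : ι) (hi : i₁ ≠ i₂)
    (ha : a ≠ a₂) (h1 : π a ≠ i₂) (h2 : π a₂ ≠ i₁) (h3 : ¬ (π a = i₁ ∧ π a₂ = i₂)) :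
    let q := Equiv.swap i₂ (π a) (π a₂)
    let q' := Equiv.swap i₁ i₂ (Equiv.swap i₁ (π a₂) (π a))
    Equiv.swap i₁ q * (Equiv.swap i₂ (π a) * (π * Equiv.swap a a₂))
      = Equiv.swap i₁ q' * (Equiv.swap i₁ i₂ * (Equiv.swap i₁ (π a₂) * π)) := by
  intro q q'
  have hq0 : q = Equiv.swap i₂ (π a) (π a₂) := rfl
  have hq0' : q' = Equiv.swap i₁ i₂ (Equiv.swap i₁ (π a₂) (π a)) := rfl
  clear_value q q'
  have hh : π a ≠ π a₂ := fun h => ha (π.injective h)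
  rw [show π * Equiv.swap a a₂ = Equiv.swap (π a) (π a₂) * π by
    rw [Equiv.swap_apply_apply]; simp]
  simp only [← mul_assoc]
  congr 1
  generalize π a = l at *
  generalize π a₂ = m at *
  by_cases hl : l = i₁
  · subst hl
    have hm : m ≠ i₂ := fun h => h3 ⟨rfl, h⟩
    have e1 : q = m → q' = m → _ := fun e1 e2 => (by
      rw [e1, e2]
      ext x
      simp only [Equiv.Perm.mul_apply, Equiv.swap_apply_def]
      grind : Equiv.swap l q * Equiv.swap i₂ l * Equiv.swap l m
        = Equiv.swap l q' * Equiv.swap l i₂ * Equiv.swap l m)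
    refine e1 ?_ ?_
    · rw [hq0, Equiv.swap_apply_of_ne_of_ne hm hh.symm]
    · rw [hq0', Equiv.swap_apply_left, Equiv.swap_apply_of_ne_of_ne h2 hm]
  · by_cases hm : m = i₂
    · subst hm
      have e1 : q = l → q' = l → _ := fun e1 e2 => (by
        rw [e1, e2]
        ext x
        simp only [Equiv.Perm.mul_apply, Equiv.swap_apply_def]
        grind : Equiv.swap i₁ q * Equiv.swap m l * Equiv.swap l m
          = Equiv.swap i₁ q' * Equiv.swap i₁ m * Equiv.swap i₁ m)
      refine e1 ?_ ?_
      · rw [hq0, Equiv.swap_apply_left]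
      · rw [hq0', Equiv.swap_apply_of_ne_of_ne hl h1, Equiv.swap_apply_of_ne_of_ne hl h1]
    · have e1 : q = m → q' = l → _ := fun e1 e2 => (by
        rw [e1, e2]
        ext x
        simp only [Equiv.Perm.mul_apply]
        rcases eq_or_ne x i₁ with rfl | x1
        · simp only [Equiv.swap_apply_def]; grind
        rcases eq_or_ne x i₂ with rfl | x2
        · simp only [Equiv.swap_apply_def]; grind
        rcases eq_or_ne x l with rfl | x3
        · simp only [Equiv.swap_apply_def]; grind
        rcases eq_or_ne x m with rfl | x4
        · simp only [Equiv.swap_apply_def]; grind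
        simp [Equiv.swap_apply_of_ne_of_ne, *] : Equiv.swap i₁ q * Equiv.swap i₂ l * Equiv.swap l m
          = Equiv.swap i₁ q' * Equiv.swap i₁ i₂ * Equiv.swap i₁ m)
      refine e1 ?_ ?_
      · rw [hq0, Equiv.swap_apply_of_ne_of_ne hm hh.symm]
      · rw [hq0', Equiv.swap_apply_of_ne_of_ne hl hh, Equiv.swap_apply_of_ne_of_ne hl h1]

theorem perm2 {ι : Type} [DecidableEq ι] (π : Equiv.Perm ι) (i₁ i₂ a a₂ : ι) (hi : i₁ ≠ i₂)
    (h1 : π a = i₁) (h2 : π a₂ ≠ i₂) (h3 : π a₂ ≠ i₁) :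
    Equiv.swap i₂ (π a₂) * (π * Equiv.swap a a₂) =
      Equiv.swap i₁ (π a₂) * (Equiv.swap i₁ i₂ * π) := by
  rw [show π * Equiv.swap a a₂ = Equiv.swap (π a) (π a₂) * π by
    rw [Equiv.swap_apply_apply]; simp]
  simp only [← mul_assoc]
  congr 1
  rw [h1]
  generalize π a₂ = m at *
  ext x
  simp only [Equiv.Perm.mul_apply, Equiv.swap_apply_def]
  grind

theorem cliff1 {ι : Type} [DecidableEq ι] (q : R) (hq : q * 2 = 1) (i₁ i₂ l m : ι) (hi : i₁ ≠ i₂)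
    (hlm : l ≠ m) (h1 : l ≠ i₂) (h2 : m ≠ i₁) (h3 : ¬ (l = i₁ ∧ m = i₂)) (y : Cl R ι) :
    let s := Equiv.swap i₁ i₂
    sub q i₁ (Equiv.swap i₂ l m) (pm s (sub q i₁ (s l) (pm s y))) =
      sub q i₁ (s (Equiv.swap i₁ m l)) (pm s (sub q i₁ m y)) := by
  intro s
  have hs1 : s i₁ = i₂ := by simp [s]
  have hs2 : s i₂ = i₁ := by simp [s]
  have hs3 : ∀ x, x ≠ i₁ → x ≠ i₂ → s x = x := fun x h h' => Equiv.swap_apply_of_ne_of_ne h h'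
  have hss : ∀ x, s (s x) = x := fun x => by simp [s]
  have hsl : s l ≠ i₁ := fun h => h1 (s.injective (h.trans hs2.symm))
  have hi' := hi.symm
  have hA : Equiv.swap i₂ l m ≠ i₁ := by
    rw [Equiv.swap_apply_def]; split_ifs <;> grind
  have hB : s (Equiv.swap i₁ m l) ≠ i₁ := by
    rw [← hs2]; refine fun h => ?_
    have := s.injective h
    rw [Equiv.swap_apply_def] at this; split_ifs at this <;> grind
  have key := lin_ext2 i₁ i₂ hi
    (sub q i₁ (Equiv.swap i₂ l m) ∘ₗ (pm s).toLinearMap ∘ₗ sub q i₁ (s l) ∘ₗ (pm s).toLinearMap)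
    (sub q i₁ (s (Equiv.swap i₁ m l)) ∘ₗ (pm s).toLinearMap ∘ₗ sub q i₁ m)
    (by simp [sub_one q hq])
    (by
      simp only [LinearMap.comp_apply, AlgHom.toLinearMap_apply, pm_g, hs1,
        sub_g' q hq i₁ _ i₂ hi', hs2, sub_g q hq i₁ _ hA, sub_g q hq i₁ _ h2]
      by_cases hm : m = i₂
      · subst hm
        rw [hs2, sub_g q hq i₁ _ hB]
        have : l ≠ i₁ := fun h => h3 ⟨h, rfl⟩
        rw [Equiv.swap_apply_left, Equiv.swap_apply_of_ne_of_ne this h1, hs3 _ this h1]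
      · rw [hs3 m h2 hm, sub_g' q hq i₁ _ m h2, Equiv.swap_apply_of_ne_of_ne hm hlm.symm])
    (by
      simp only [LinearMap.comp_apply, AlgHom.toLinearMap_apply, pm_g, hs2,
        sub_g' q hq i₁ _ i₂ hi', sub_g q hq i₁ _ hsl, sub_g q hq i₁ _ hB, hss]
      by_cases hl : l = i₁
      · subst hl
        rw [sub_g q hq _ _ hA]
        have : m ≠ i₂ := fun h => h3 ⟨rfl, h⟩
        rw [Equiv.swap_apply_left, Equiv.swap_apply_of_ne_of_ne this h2, hs3 _ h2 this]
      · rw [sub_g' q hq i₁ _ l hl, Equiv.swap_apply_of_ne_of_ne hl hlm, hs3 _ hl h1])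
    (by
      simp only [LinearMap.comp_apply, AlgHom.toLinearMap_apply]
      rw [map_mul (pm s), pm_g, pm_g, hs1, hs2, g_anti i₁ i₂ hi, map_neg (sub q i₁ (s l)),
        map_neg (pm s), map_neg (sub q i₁ _)]
      rw [sub_g_mul q i₁ (s l) i₂ hi', sub_g q hq i₁ _ hsl, map_mul (pm s), pm_g, pm_g, hs2, hss]
      rw [sub_g_mul q i₁ m i₂ hi', sub_g q hq i₁ _ h2, map_mul (pm s), pm_g, pm_g, hs2]
      by_cases hl : l = i₁
      · subst hl
        have hm : m ≠ i₂ := fun h => h3 ⟨rfl, h⟩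
        rw [hs3 m h2 hm, g_sq, g_anti l m hlm, map_neg, map_neg, sub_g_mul q _ _ m h2,
          sub_g q hq _ _ hB, sub_one q hq]
        rw [Equiv.swap_apply_left, hs3 _ h2 hm, g_sq]
      · by_cases hm : m = i₂
        · subst hm
          rw [hs2, g_sq, g_anti i₁ l (Ne.symm hl), map_neg, map_neg, sub_g_mul q _ _ l hl,
            sub_g q hq _ _ hA, sub_one q hq, Equiv.swap_apply_left, g_sq]; simp
        · rw [g_anti i₁ l (Ne.symm hl), hs3 m h2 hm, g_anti i₁ m (Ne.symm h2)]
          simp only [map_neg, sub_g_mul q _ _ m h2, sub_g_mul q _ _ l hl, sub_g q hq _ _ hA,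
            sub_g q hq _ _ hB]
          rw [Equiv.swap_apply_of_ne_of_ne hm hlm.symm, Equiv.swap_apply_of_ne_of_ne hl hlm,
            hs3 _ hl h1, g_anti l m hlm]; simp)
    (by
      intro i hi1 hi2 y h
      simp only [LinearMap.comp_apply, AlgHom.toLinearMap_apply] at h
      simp only [LinearMap.comp_apply, AlgHom.toLinearMap_apply, map_mul, pm_g, hs3 i hi1 hi2,
        sub_g_mul q i₁ _ i hi1, h])
  exact LinearMap.congr_fun key y

theorem cliff2 {ι : Type} [DecidableEq ι] (q : R) (hq : q * 2 = 1) (i₁ i₂ l p : ι) (hi : i₁ ≠ i₂)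
    (h1 : l ≠ i₁) (h2 : p ≠ i₁) (h3 : p ≠ i₂) (y : Cl R ι) :
    let s := Equiv.swap i₁ i₂
    pm s (sub q i₁ p (pm s (sub q i₁ l y))) = sub q i₁ p (pm s (sub q i₁ l y)) := by
  intro s
  have hs1 : s i₁ = i₂ := by simp [s]
  have hs2 : s i₂ = i₁ := by simp [s]
  have hs3 : ∀ x, x ≠ i₁ → x ≠ i₂ → s x = x := fun x h h' => Equiv.swap_apply_of_ne_of_ne h h'
  have hi' := hi.symm
  have hl : pm s (sub q i₁ p (pm s (g R l))) = sub q i₁ p (pm s (g R l)) := by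
    by_cases hl : l = i₂
    · subst hl; rw [pm_g, hs2, sub_g q hq _ _ h2, pm_g, hs3 p h2 h3]
    · rw [pm_g, hs3 l h1 hl, sub_g' q hq _ _ l h1, pm_g, hs3 l h1 hl]
  have key := lin_ext2 i₁ i₂ hi
    ((pm s).toLinearMap ∘ₗ sub q i₁ p ∘ₗ (pm s).toLinearMap ∘ₗ sub q i₁ l)
    (sub q i₁ p ∘ₗ (pm s).toLinearMap ∘ₗ sub q i₁ l)
    (by simp [sub_one q hq])
    (by
      simp only [LinearMap.comp_apply, AlgHom.toLinearMap_apply, sub_g q hq _ _ h1]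
      exact hl)
    (by
      simp only [LinearMap.comp_apply, AlgHom.toLinearMap_apply, sub_g' q hq _ _ i₂ hi', pm_g,
        hs2, sub_g q hq _ _ h2, hs3 p h2 h3])
    (by
      simp only [LinearMap.comp_apply, AlgHom.toLinearMap_apply, sub_g_mul q i₁ l i₂ hi',
        sub_g q hq _ _ h1, map_mul, pm_g, hs2]
      by_cases hl : l = i₂
      · subst hl; rw [hs2, g_sq, map_neg, map_neg, sub_one q hq, map_one]
      · rw [hs3 l h1 hl, g_anti _ _ (Ne.symm h1), map_neg, map_neg, sub_g_mul q _ _ l h1,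
          sub_g q hq _ _ h2, map_mul, pm_g, pm_g, hs3 l h1 hl, hs3 p h2 h3])
    (by
      intro i hi1 hi2 y h
      simp only [LinearMap.comp_apply, AlgHom.toLinearMap_apply] at h
      simp only [LinearMap.comp_apply, AlgHom.toLinearMap_apply, map_mul, pm_g, hs3 i hi1 hi2,
        sub_g_mul q i₁ _ i hi1, h])
  exact LinearMap.congr_fun key y

end FM
end

open Polynomial
noncomputable section

namespace FM
open Cl

variable {R : Type} [CommRing R] {r t : ℕ}

theorem cliff0 {ι : Type} [DecidableEq ι] (q : R) (hq : q * 2 = 1) (i₁ i₂ l : ι) (hi : i₁ ≠ i₂)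
    (h1 : l ≠ i₁) (y : Cl R ι) :
    sub q i₁ i₂ (pm (Equiv.swap i₁ i₂) (sub q i₁ l y)) = sub q i₁ l y := by
  set s := Equiv.swap i₁ i₂ with hs
  have hs2 : s i₂ = i₁ := by simp [s]
  have hs3 : ∀ x, x ≠ i₁ → x ≠ i₂ → s x = x := fun x h h' => Equiv.swap_apply_of_ne_of_ne h h'
  have hi' := hi.symm
  have hl : sub q i₁ i₂ (pm s (g R l)) = g R l := by
    by_cases hl : l = i₂
    · subst hl; rw [pm_g, hs2, sub_g q hq _ _ h1]
    · rw [pm_g, hs3 l h1 hl, sub_g' q hq _ _ l h1]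
  have key := lin_ext2 i₁ i₂ hi
    (sub q i₁ i₂ ∘ₗ (pm s).toLinearMap ∘ₗ sub q i₁ l) (sub q i₁ l)
    (by simp [sub_one q hq])
    (by
      simp only [LinearMap.comp_apply, AlgHom.toLinearMap_apply, sub_g q hq _ _ h1]
      exact hl)
    (by
      simp only [LinearMap.comp_apply, AlgHom.toLinearMap_apply, sub_g' q hq _ _ i₂ hi', pm_g,
        hs2, sub_g q hq _ _ hi'])
    (by
      simp only [LinearMap.comp_apply, AlgHom.toLinearMap_apply, sub_g_mul q i₁ l i₂ hi',
        sub_g q hq _ _ h1, map_mul, pm_g, hs2]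
      by_cases hl : l = i₂
      · subst hl; rw [hs2, g_sq, map_neg, sub_one q hq, g_sq]
      · rw [hs3 l h1 hl, g_anti _ _ (Ne.symm h1), map_neg, sub_g_mul q _ _ l h1,
          sub_g q hq _ _ hi', g_anti i₂ l (Ne.symm hl)])
    (by
      intro i hi1 hi2 y h
      simp only [LinearMap.comp_apply, AlgHom.toLinearMap_apply] at h
      simp only [LinearMap.comp_apply, AlgHom.toLinearMap_apply, map_mul, pm_g, hs3 i hi1 hi2,
        sub_g_mul q i₁ _ i hi1, h])
  exact LinearMap.congr_fun key y

section fields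
variable (q : R) (hq : q * 2 = 1) (i i2 : Fin r) (j j2 : Fin t) (hi : i ≠ i2) (hj : j ≠ j2)

theorem X_e_sq : Xe q (Sum.inl i) (Sum.inr j) * Xe q (Sum.inl i) (Sum.inr j) =
    (0 : Module.End R (MM R r t)) := by
  refine op_ext fun π y => ?_
  by_cases h : π (Sum.inr j) = Sum.inl i
  · simp [Xe_zero q _ _ _ _ h]
  · simp only [Module.End.mul_apply]
    rw [Xe_single q _ _ _ _ h, Xe_zero _ _ _ _ _ (by simp)]; rfl

theorem X_e_c_e : Xe q (Sum.inl i) (Sum.inr j) * Xc R r t (Sum.inl i) *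
    Xe q (Sum.inl i) (Sum.inr j) = (0 : Module.End R (MM R r t)) := by
  refine op_ext fun π y => ?_
  by_cases h : π (Sum.inr j) = Sum.inl i
  · simp [Xe_zero q _ _ _ _ h]
  · simp only [Module.End.mul_apply]
    rw [Xe_single q _ _ _ _ h, Xc_single, Xe_zero _ _ _ _ _ (by simp)]; rfl

theorem X_e_cb_e : Xe q (Sum.inl i) (Sum.inr j) * Xcb R r t j *
    Xe q (Sum.inl i) (Sum.inr j) = (0 : Module.End R (MM R r t)) := by
  refine op_ext fun π y => ?_
  by_cases h : π (Sum.inr j) = Sum.inl i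
  · simp [Xe_zero q _ _ _ _ h]
  · simp only [Module.End.mul_apply]
    rw [Xe_single q _ _ _ _ h, Xcb_single, Xe_zero _ _ _ _ _ (by simp)]; rfl

include hq

theorem X_e_c1 : Xe q (Sum.inl i) (Sum.inr j) * Xc R r t (Sum.inl i) =
    Xe q (Sum.inl i) (Sum.inr j) * Xcb R r t j := by
  refine op_ext fun π y => ?_
  by_cases h : π (Sum.inr j) = Sum.inl i
  · simp only [Module.End.mul_apply]
    rw [Xc_single, Xcb_single, Xe_zero q _ _ _ _ h, Xe_zero q _ _ _ _ h]
  · simp only [Module.End.mul_apply]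
    rw [Xc_single, Xcb_single, Xe_single q _ _ _ _ h, Xe_single q _ _ _ _ h, sub_c1 q hq _ _ h]

theorem X_c1_e : Xc R r t (Sum.inl i) * Xe q (Sum.inl i) (Sum.inr j) =
    Xcb R r t j * Xe q (Sum.inl i) (Sum.inr j) := by
  refine op_ext fun π y => ?_
  by_cases h : π (Sum.inr j) = Sum.inl i
  · simp [Xe_zero q _ _ _ _ h]
  · simp only [Module.End.mul_apply]
    rw [Xe_single q _ _ _ _ h, Xc_single, Xcb_single, swap_one_apply, sub_free q hq _ _ h]

theorem X_c_e (x : II r t) (hx : x ≠ Sum.inl i) :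
    Xc R r t x * Xe q (Sum.inl i) (Sum.inr j) = Xe q (Sum.inl i) (Sum.inr j) * Xc R r t x := by
  refine op_ext fun π y => ?_
  by_cases h : π (Sum.inr j) = Sum.inl i
  · simp only [Module.End.mul_apply]
    rw [Xc_single, Xe_zero q _ _ _ _ h, Xe_zero q _ _ _ _ h, map_zero]
  · simp only [Module.End.mul_apply]
    rw [Xe_single q _ _ _ _ h, Xc_single, Xc_single, Xe_single q _ _ _ _ h, sub_g_mul q _ _ _ hx]

include hj in
theorem X_cb_e : Xcb R r t j2 * Xe q (Sum.inl i) (Sum.inr j) =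
    Xe q (Sum.inl i) (Sum.inr j) * Xcb R r t j2 := by
  refine op_ext fun π y => ?_
  by_cases h : π (Sum.inr j) = Sum.inl i
  · simp only [Module.End.mul_apply]
    rw [Xcb_single, Xe_zero q _ _ _ _ h, Xe_zero q _ _ _ _ h, map_zero]
  · simp only [Module.End.mul_apply]
    rw [Xe_single q _ _ _ _ h, Xcb_single, Xcb_single, Xe_single q _ _ _ _ h, sub_cb q hq _ _ _ h]
    · rfl
    · simpa using hj.symm

theorem X_s_e (w : Equiv.Perm (Fin r)) (hw : w i = i) :
    Xσ R r t w * Xe q (Sum.inl i) (Sum.inr j) = Xe q (Sum.inl i) (Sum.inr j) * Xσ R r t w := by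
  have hw' : lw t w (Sum.inl i) = Sum.inl i := by simp [hw]
  refine op_ext fun π y => ?_
  by_cases h : π (Sum.inr j) = Sum.inl i
  · simp only [Module.End.mul_apply]
    rw [Xe_zero q _ _ _ _ h, Xσ_single, Xe_zero, map_zero]
    simp [h, hw]
  · simp only [Module.End.mul_apply]
    have h' : (lw t w * π) (Sum.inr j) ≠ Sum.inl i := by
      intro h'
      exact h ((lw t w).injective (h'.trans hw'.symm))
    rw [Xe_single q _ _ _ _ h, Xσ_single, Xσ_single, Xe_single q _ _ _ _ h',
      sub_pm q hq _ _ h _ hw', Equiv.Perm.mul_apply, ← mul_assoc, ← mul_assoc]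
    congr 2
    nth_rw 2 [← hw']
    rw [Equiv.swap_apply_apply]; simp

omit hq in
theorem X_sb_e (w : Equiv.Perm (Fin t)) (hw : w j = j) :
    Xσb R r t w * Xe q (Sum.inl i) (Sum.inr j) = Xe q (Sum.inl i) (Sum.inr j) * Xσb R r t w := by
  refine op_ext fun π y => ?_
  have hh : (π * (rw' r w)⁻¹) (Sum.inr j) = π (Sum.inr j) := by
    rw [← rw_inv]
    have : w⁻¹ j = j := by rw [Equiv.Perm.inv_eq_iff_eq, hw]
    simp only [Equiv.Perm.mul_apply, rw_inr, this]
  by_cases h : π (Sum.inr j) = Sum.inl i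
  · simp only [Module.End.mul_apply]
    rw [Xe_zero q _ _ _ _ h, Xσb_single, Xe_zero, map_zero]
    rw [hh, h]
  · simp only [Module.End.mul_apply]
    rw [Xe_single q _ _ _ _ h, Xσb_single, Xσb_single, Xe_single q _ _ _ _ (by rw [hh]; exact h),
      hh, mul_assoc]

include hi in
theorem X_e_s_e : Xe q (Sum.inl i) (Sum.inr j) * Xσ R r t (Equiv.swap i i2) *
    Xe q (Sum.inl i) (Sum.inr j) = Xe q (Sum.inl i) (Sum.inr j) := by
  refine op_ext fun π y => ?_
  by_cases h : π (Sum.inr j) = Sum.inl i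
  · simp [Xe_zero q _ _ _ _ h]
  · simp only [Module.End.mul_apply]
    have h2 : (Equiv.swap (Sum.inl i : II r t) (Sum.inl i2) *
      (Equiv.swap (Sum.inl i) (π (Sum.inr j)) * π)) (Sum.inr j) = Sum.inl i2 := by simp
    have hi' : (Sum.inl i : II r t) ≠ Sum.inl i2 := by simpa using hi
    rw [Xe_single q _ _ _ _ h, Xσ_single, lw_swap, Xe_single, h2, cliff0 q hq _ _ _ hi' h,
      ← mul_assoc, Equiv.swap_mul_self, one_mul]
    rw [h2]; exact hi'.symm

include hj in
theorem X_e_sb_e : Xe q (Sum.inl i) (Sum.inr j) * Xσb R r t (Equiv.swap j j2) *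
    Xe q (Sum.inl i) (Sum.inr j) = Xe q (Sum.inl i) (Sum.inr j) := by
  refine op_ext fun π y => ?_
  by_cases h : π (Sum.inr j) = Sum.inl i
  · simp [Xe_zero q _ _ _ _ h]
  · simp only [Module.End.mul_apply]
    rw [Xe_single q _ _ _ _ h, Xσb_single, rw_swap, Equiv.swap_inv]
    have h1 : (Equiv.swap (Sum.inl i) (π (Sum.inr j)) * π) (Sum.inr j) = Sum.inl i := by simp
    generalize Equiv.swap (Sum.inl i) (π (Sum.inr j)) * π = π1 at *
    have h2 : (π1 * Equiv.swap (Sum.inr j : II r t) (Sum.inr j2)) (Sum.inr j) = π1 (Sum.inr j2) := by simp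
    have h3 : π1 (Sum.inr j2) ≠ Sum.inl i := by
      rw [← h1]; intro h; exact hj (Sum.inr_injective (π1.injective h)).symm
    rw [Xe_single, h2, sub_sub q hq _ _ _ h, ← h1, Equiv.swap_apply_apply]
    · congr 1; simp [mul_assoc]
    · rw [h2]; exact h3

theorem X_braid1 (i₁ i₂ a a₂ : II r t) (hi' : i₁ ≠ i₂) (hj' : a ≠ a₂)
    (S T : Module.End R (MM R r t))
    (hS : ∀ π y, S (Finsupp.single π y) =
      Finsupp.single (Equiv.swap i₁ i₂ * π) (pm (Equiv.swap i₁ i₂) y))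
    (hT : ∀ π y, T (Finsupp.single π y) = Finsupp.single (π * Equiv.swap a a₂) y) :
    Xe q i₁ a * S * T * Xe q i₁ a * S = Xe q i₁ a * S * T * Xe q i₁ a * T := by
  refine op_ext fun π y => ?_
  have hh : π a ≠ π a₂ := fun h => hj' (π.injective h)
  simp only [Module.End.mul_apply]
  rw [hS, hT]
  set s := Equiv.swap i₁ i₂ with hs
  set s' := Equiv.swap a a₂ with hs'
  have hs1 : s i₁ = i₂ := by simp [s]
  have hs2 : s i₂ = i₁ := by simp [s]
  have hsi : s⁻¹ = s := by simp [s]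
  have hss : ∀ x, s (s x) = x := fun x => by simp [s]
  have hsl : (s * π) a = s (π a) := rfl
  have hsr : (π * s') a = π a₂ := by simp [s']
  have hP : s * (Equiv.swap i₁ (s (π a)) * (s * π) * s') = Equiv.swap i₂ (π a) * (π * s') := by
    have : Equiv.swap i₂ (π a) = s * Equiv.swap i₁ (s (π a)) * s⁻¹ := by
      rw [← Equiv.swap_apply_apply, hs1, hss]
    rw [this, hsi]; simp only [mul_assoc]
  have hP' : Equiv.swap i₁ (π a₂) * (π * s') * s' = Equiv.swap i₁ (π a₂) * π := by
    simp [mul_assoc, s']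
  have hPa : (Equiv.swap i₂ (π a) * (π * s')) a = Equiv.swap i₂ (π a) (π a₂) := by
    simp [s']
  have hPa' : (s * (Equiv.swap i₁ (π a₂) * π)) a = s (Equiv.swap i₁ (π a₂) (π a)) := rfl
  have L1 : π a = i₂ → Xe q i₁ a (Finsupp.single (s * π) (pm s y)) = 0 := fun h =>
    Xe_zero _ _ _ _ _ (by rw [hsl, h, hs2])
  have L2 : π a ≠ i₂ → S (T (Xe q i₁ a (Finsupp.single (s * π) (pm s y)))) =
      Finsupp.single (Equiv.swap i₂ (π a) * (π * s')) (pm s (sub q i₁ (s (π a)) (pm s y))) := by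
    intro h
    rw [Xe_single _ _ _ _ _ (by rw [hsl]; intro h'; exact h (s.injective (h'.trans hs2.symm))),
      hT, hS, hsl, hP]
  have R1 : π a₂ = i₁ → Xe q i₁ a (Finsupp.single (π * s') y) = 0 := fun h =>
    Xe_zero _ _ _ _ _ (by rw [hsr, h])
  have R2 : π a₂ ≠ i₁ → S (T (Xe q i₁ a (Finsupp.single (π * s') y))) =
      Finsupp.single (s * (Equiv.swap i₁ (π a₂) * π)) (pm s (sub q i₁ (π a₂) y)) := by
    intro h
    rw [Xe_single _ _ _ _ _ (by rw [hsr]; exact h), hT, hS, hsr, hP']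
  by_cases h1 : π a = i₂
  · rw [L1 h1]
    simp only [map_zero]
    by_cases h2 : π a₂ = i₁
    · rw [R1 h2]; simp
    · rw [R2 h2, Xe_zero]
      rw [hPa', Equiv.swap_apply_of_ne_of_ne (by rw [h1]; exact hi'.symm) hh, h1, hs2]
  by_cases h2 : π a₂ = i₁
  · rw [R1 h2, L2 h1]
    simp only [map_zero]
    rw [Xe_zero]
    rw [hPa, Equiv.swap_apply_of_ne_of_ne (by rw [h2]; exact hi') hh.symm, h2]
  rw [L2 h1, R2 h2]
  by_cases h3 : π a = i₁ ∧ π a₂ = i₂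
  · rw [Xe_zero, Xe_zero]
    · rw [hPa', h3.1, h3.2, Equiv.swap_apply_left, hs2]
    · rw [hPa, h3.2, Equiv.swap_apply_left, h3.1]
  · have hq1 : Equiv.swap i₂ (π a) (π a₂) ≠ i₁ := by
      rw [Equiv.swap_apply_def]; split_ifs <;> grind
    have hq2 : s (Equiv.swap i₁ (π a₂) (π a)) ≠ i₁ := by
      rw [← hs2]; refine fun h => ?_
      have := s.injective h
      rw [Equiv.swap_apply_def] at this; split_ifs at this <;> grind
    rw [Xe_single _ _ _ _ _ (by rw [hPa]; exact hq1), Xe_single _ _ _ _ _ (by rw [hPa']; exact hq2),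
      hPa, hPa', cliff1 q hq i₁ i₂ (π a) (π a₂) hi' hh h1 h2 h3]
    congr 1
    exact perm1 π i₁ i₂ a a₂ hi' hj' h1 h2 h3

theorem X_braid2 (i₁ i₂ a a₂ : II r t) (hi' : i₁ ≠ i₂) (hj' : a ≠ a₂)
    (S T : Module.End R (MM R r t))
    (hS : ∀ π y, S (Finsupp.single π y) =
      Finsupp.single (Equiv.swap i₁ i₂ * π) (pm (Equiv.swap i₁ i₂) y))
    (hT : ∀ π y, T (Finsupp.single π y) = Finsupp.single (π * Equiv.swap a a₂) y) :
    S * Xe q i₁ a * S * T * Xe q i₁ a = T * Xe q i₁ a * S * T * Xe q i₁ a := by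
  refine op_ext fun π y => ?_
  simp only [Module.End.mul_apply]
  by_cases h : π a = i₁
  · rw [Xe_zero q _ _ _ _ h]; simp
  have h1 : (Equiv.swap i₁ (π a) * π) a = i₁ := by simp
  rw [Xe_single q _ _ _ _ h, hT, hS]
  generalize Equiv.swap i₁ (π a) * π = π1 at *
  set s := Equiv.swap i₁ i₂ with hs
  set s' := Equiv.swap a a₂ with hs'
  have hs1 : s i₁ = i₂ := by simp [s]
  have hs2 : s i₂ = i₁ := by simp [s]
  have hsi : s⁻¹ = s := by simp [s]
  have h3 : π1 a₂ ≠ i₁ := by rw [← h1]; intro h; exact hj' (π1.injective h).symm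
  have ha : (s * (π1 * s')) a = s (π1 a₂) := by simp [s']
  by_cases h2 : π1 a₂ = i₂
  · rw [Xe_zero]
    · simp
    · rw [ha, h2, hs2]
  · have hp : s (π1 a₂) = π1 a₂ := Equiv.swap_apply_of_ne_of_ne h3 h2
    rw [Xe_single _ _ _ _ _ (by rw [ha, hp]; exact h3), ha, hp, hS, hT,
      cliff2 q hq i₁ i₂ (π a) (π1 a₂) hi' h h3 h2]
    congr 1
    have := perm2 π1 i₁ i₂ a a₂ hi' h1 h2 h3
    have e1 : Equiv.swap i₂ (π1 a₂) = s * Equiv.swap i₁ (π1 a₂) * s⁻¹ := by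
      rw [← Equiv.swap_apply_apply, hs1, hp]
    rw [e1, hsi] at this
    simp only [mul_assoc] at this ⊢
    rw [show Equiv.swap a a₂ = s' from rfl] at this
    rw [this, show s' * s' = 1 by simp [s'], mul_one]

end fields

theorem sw_eq (n a b : ℕ) (ha : a < n) (hb : b < n) : sw n a b = Equiv.swap ⟨a, ha⟩ ⟨b, hb⟩ := by
  simp [sw, ha, hb]

/-- The flipped regular module as data for the presentation. -/
def XW (q : R) (hq : q * 2 = 1) (hr : 0 < r) (ht : 0 < t) :
    WBC R (Module.End R (MM R r t)) r t where
  σ := Xσ R r t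
  σb := Xσb R r t
  c i := Xc R r t (Sum.inl i)
  cb := Xcb R r t
  e := Xe q (Sum.inl ⟨0, hr⟩) (Sum.inr ⟨0, ht⟩)
  c_sq i := op_ext fun π y => by
    simp only [Module.End.mul_apply, Xc_single, g_sq', Finsupp.single_neg]; rfl
  c_anti i j h := op_ext fun π y => by
    simp only [Module.End.mul_apply, Xc_single, LinearMap.neg_apply]
    rw [g_anti' _ _ (by simpa using h), Finsupp.single_neg]
  c_conj w i := op_ext fun π y => by
    simp only [Module.End.mul_apply, Xc_single, Xσ_single, map_mul, pm_g, lw_inl]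
    rw [← pm_mul, ← mul_assoc, ← lw_mul]; simp [pm_one]
  cb_sq i := op_ext fun π y => by
    simp only [Module.End.mul_apply, Xcb_single, map_mul, Cl.inv_inv, inv_g, mul_assoc, neg_mul, g_sq]
    simp
  cb_anti i j h := op_ext fun π y => by
    simp only [Module.End.mul_apply, Xcb_single, map_mul, Cl.inv_inv, inv_g, mul_assoc, neg_mul,
      LinearMap.neg_apply]
    rw [g_anti _ _ (fun h' => h (Sum.inr_injective (π.injective h')).symm), ← Finsupp.single_neg]
    simp
  cb_conj w j := op_ext fun π y => by
    simp only [Module.End.mul_apply, Xcb_single, Xσb_single]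
    rw [← rw_inv, ← rw_inv]
    simp only [_root_.inv_inv, Equiv.Perm.mul_apply, rw_inr]
    rw [mul_assoc, ← rw_mul]; simp
  comm_σσb w v := op_ext fun π y => by
    simp only [Module.End.mul_apply, Xσb_single, Xσ_single, mul_assoc]
  comm_σcb w j := op_ext fun π y => by
    simp only [Module.End.mul_apply, Xcb_single, Xσ_single, map_mul, pm_g, pm_inv,
      Equiv.Perm.mul_apply]
  comm_σbc v i := op_ext fun π y => by
    simp only [Module.End.mul_apply, Xc_single, Xσb_single]
  anti_ccb i j := op_ext fun π y => by
    simp only [Module.End.mul_apply, Xc_single, Xcb_single, map_mul, inv_g, LinearMap.neg_apply]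
    rw [← Finsupp.single_neg]; simp only [neg_mul, neg_neg, mul_assoc]
  e_c1 h1 h2 := X_e_c1 q hq _ _
  c1_e h1 h2 := X_c1_e q hq _ _
  e_sq := X_e_sq q _ _
  e_s_e h := by
    rw [sw_eq r 0 1 hr h]
    exact X_e_s_e q hq _ _ _ (by simp)
  e_sb_e h := by
    rw [sw_eq t 0 1 ht h]
    exact X_e_sb_e q hq _ _ _ (by simp)
  s_e_comm i h h' := by
    rw [sw_eq r i (i + 1) (by omega) h']
    exact X_s_e q hq _ _ _ (Equiv.swap_apply_of_ne_of_ne (by simp; omega) (by simp))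
  sb_e_comm i h h' := by
    rw [sw_eq t i (i + 1) (by omega) h']
    exact X_sb_e q _ _ _ (Equiv.swap_apply_of_ne_of_ne (by simp; omega) (by simp))
  braid1 h h' := by
    rw [sw_eq t 0 1 ht h', sw_eq r 0 1 hr h]
    exact X_braid1 q hq _ (Sum.inl ⟨1, h⟩) _ (Sum.inr ⟨1, h'⟩) (by simp) (by simp) _ _
      (fun π y => by rw [Xσ_single, lw_swap]) (fun π y => by rw [Xσb_single, rw_swap, Equiv.swap_inv])
  braid2 h h' := by
    rw [sw_eq t 0 1 ht h', sw_eq r 0 1 hr h]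
    exact X_braid2 q hq _ (Sum.inl ⟨1, h⟩) _ (Sum.inr ⟨1, h'⟩) (by simp) (by simp) _ _
      (fun π y => by rw [Xσ_single, lw_swap]) (fun π y => by rw [Xσb_single, rw_swap, Equiv.swap_inv])
  c_e_comm i h := X_c_e q hq _ _ _ (by simpa [Fin.ext_iff] using h)
  cb_e_comm j h := X_cb_e q hq _ _ _ (by simpa [Fin.ext_iff, eq_comm] using h)
  e_c_e h := X_e_c_e q _ _
  e_cb_e h := X_e_cb_e q _ _

end FM
end

open Polynomial
noncomputable section

namespace WF

theorem perm_ind {ι : Type} [Fintype ι] [DecidableEq ι] (P : Equiv.Perm ι → Prop) (S : ι → Prop)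
    (h1 : P 1) (hs : ∀ a b w, a ≠ b → S a → S b → (∀ x, w x ≠ x → S x) → P w →
      P (Equiv.swap a b * w)) :
    ∀ w : Equiv.Perm ι, (∀ x, w x ≠ x → S x) → P w := by
  intro w
  induction hn : w.support.card using Nat.strong_induction_on generalizing w with
  | _ n ih =>
    intro hw
    by_cases h : w = 1
    · rw [h]; exact h1
    · obtain ⟨x, hx⟩ : ∃ x, w x ≠ x := by
        by_contra hc; push Not at hc; exact h (Equiv.ext hc)
      have hx2 : w (w x) ≠ w x := fun h' => hx (w.injective h')
      have hlt := Equiv.Perm.card_support_swap_mul hx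
      have hS : ∀ y, (Equiv.swap x (w x) * w) y ≠ y → S y := by
        intro y hy
        apply hw
        intro hy'
        apply hy
        have e1 : y ≠ x := by rintro rfl; exact hx hy'
        have e2 : y ≠ w x := by rintro rfl; exact hx2 hy'
        rw [Equiv.Perm.mul_apply, hy', Equiv.swap_apply_of_ne_of_ne e1 e2]
      have := hs x (w x) _ hx.symm (hw _ hx) (hw _ hx2) hS (ih _ (hn ▸ hlt) _ rfl hS)
      simpa using this

variable {R A : Type} [CommRing R] [Ring A] [Algebra R A] {r t : ℕ}
  (d : WBC R A (r + 1) (t + 1))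

theorem σσ (w v : Equiv.Perm (Fin (r + 1))) (x : A) : d.σ w * (d.σ v * x) = d.σ (w * v) * x := by
  rw [map_mul, mul_assoc]
theorem σbσb (w v : Equiv.Perm (Fin (t + 1))) (x : A) :
    d.σb w * (d.σb v * x) = d.σb (w * v) * x := by
  rw [map_mul, mul_assoc]

theorem comm_adj {n : ℕ} {B : Type} [Monoid B] (f : Equiv.Perm (Fin (n + 1)) →* B) (e : B)
    (h : ∀ i : ℕ, 0 < i → ∀ h : i + 1 < n + 1,
      f (Equiv.swap ⟨i, by omega⟩ ⟨i + 1, h⟩) * e = e * f (Equiv.swap ⟨i, by omega⟩ ⟨i + 1, h⟩))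
    (w : Equiv.Perm (Fin (n + 1))) (hw : w 0 = 0) : f w * e = e * f w := by
  have key : ∀ m a : ℕ, 0 < a → ∀ h : a + m + 1 < n + 1,
      f (Equiv.swap ⟨a, by omega⟩ ⟨a + m + 1, h⟩) * e =
        e * f (Equiv.swap ⟨a, by omega⟩ ⟨a + m + 1, h⟩) := by
    intro m
    induction m with
    | zero => intro a ha hh; exact h a ha hh
    | succ m ih =>
      intro a ha hh
      have h1 := ih a ha (by omega)
      have h2 := h (a + m + 1) (by omega) hh
      set s1 : Equiv.Perm (Fin (n + 1)) := Equiv.swap ⟨a, by omega⟩ ⟨a + m + 1, by omega⟩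
      set s2 : Equiv.Perm (Fin (n + 1)) := Equiv.swap ⟨a + m + 1, by omega⟩ ⟨a + m + 1 + 1, hh⟩
      have : Equiv.swap (⟨a, by omega⟩ : Fin (n + 1)) ⟨a + (m + 1) + 1, hh⟩ = s2 * s1 * s2⁻¹ := by
        rw [← Equiv.swap_apply_apply]
        congr 1
        · rw [Equiv.swap_apply_of_ne_of_ne] <;> simp <;> omega
        · simp [s2]; omega
      rw [this, show s2⁻¹ = s2 from Equiv.swap_inv _ _, map_mul, map_mul, mul_assoc, h2,
        mul_assoc, ← mul_assoc (f s1), h1]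
      simp only [← mul_assoc]
      rw [h2]
  refine perm_ind (fun w => f w * e = e * f w) (fun x => x ≠ 0) (by simp) ?_ w ?_
  · intro a b w hab ha hb _ hw
    have : f (Equiv.swap a b) * e = e * f (Equiv.swap a b) := by
      have hlt : ∀ a b : Fin (n + 1), a ≠ 0 → a < b →
          f (Equiv.swap a b) * e = e * f (Equiv.swap a b) := by
        intro a b ha hab
        have ha' : 0 < (a : ℕ) := Nat.pos_of_ne_zero (fun h => ha (Fin.ext h))
        have := key (b - a - 1) a ha' (by have := b.2; omega)
        have e1 : (⟨(a : ℕ) + (b - a - 1) + 1, by have := b.2; omega⟩ : Fin (n + 1)) = b :=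
          Fin.ext (by simp; omega)
        rw [e1] at this
        exact this
      rcases lt_or_gt_of_ne hab with h | h
      · exact hlt a b ha h
      · rw [Equiv.swap_comm]; exact hlt b a hb h
    rw [map_mul, mul_assoc, hw, ← mul_assoc, this, mul_assoc]
  · rintro x hx rfl; exact hx hw

theorem σ_e (w : Equiv.Perm (Fin (r + 1))) (hw : w 0 = 0) : d.σ w * d.e = d.e * d.σ w :=
  comm_adj d.σ d.e (fun i hi h => by
    have := d.s_e_comm i hi h
    rwa [FM.sw_eq _ _ _ (by omega) h] at this) w hw

theorem σb_e (w : Equiv.Perm (Fin (t + 1))) (hw : w 0 = 0) : d.σb w * d.e = d.e * d.σb w :=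
  comm_adj d.σb d.e (fun i hi h => by
    have := d.sb_e_comm i hi h
    rwa [FM.sw_eq _ _ _ (by omega) h] at this) w hw

/-- group element `(w, v)` -/
def N (w : Equiv.Perm (Fin (r + 1))) (v : Equiv.Perm (Fin (t + 1))) : A := d.σ w * d.σb v

theorem N_mul (w w' : Equiv.Perm (Fin (r + 1))) (v v' : Equiv.Perm (Fin (t + 1))) :
    N d w v * N d w' v' = N d (w * w') (v * v') := by
  simp only [N, map_mul, mul_assoc]
  rw [← mul_assoc (d.σb v), ← d.comm_σσb]; simp only [mul_assoc]

theorem N_one : N d 1 1 = 1 := by simp [N]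

theorem N_inv (w : Equiv.Perm (Fin (r + 1))) (v : Equiv.Perm (Fin (t + 1))) :
    N d w v * N d w⁻¹ v⁻¹ = 1 := by rw [N_mul]; simp [N_one]

theorem N_e (w : Equiv.Perm (Fin (r + 1))) (v : Equiv.Perm (Fin (t + 1))) (hw : w 0 = 0)
    (hv : v 0 = 0) : N d w v * d.e = d.e * N d w v := by
  rw [N, mul_assoc, σb_e d v hv, ← mul_assoc, σ_e d w hw, mul_assoc]

/-- transport of an identity by a group element -/
theorem N_transport (w : Equiv.Perm (Fin (r + 1))) (v : Equiv.Perm (Fin (t + 1))) {X Y X' Y' : A}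
    (h : X' = Y') (hX : N d w v * X' = X * N d w v) (hY : N d w v * Y' = Y * N d w v) : X = Y := by
  have : X * N d w v = Y * N d w v := by rw [← hX, ← hY, h]
  have := congrArg (· * N d w⁻¹ v⁻¹) this
  simpa [mul_assoc, N_inv] using this

/-- `e_{i,j}` (0-based) -/
def ep (i : Fin (r + 1)) (j : Fin (t + 1)) : A :=
  N d (Equiv.swap 0 i) (Equiv.swap 0 j) * d.e * N d (Equiv.swap 0 i) (Equiv.swap 0 j)

theorem ep_zero : ep d 0 0 = d.e := by
  have h1 : (Equiv.swap 0 0 : Equiv.Perm (Fin (r + 1))) = 1 := Equiv.swap_self 0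
  have h2 : (Equiv.swap 0 0 : Equiv.Perm (Fin (t + 1))) = 1 := Equiv.swap_self 0
  rw [ep, h1, h2, N_one]; simp

theorem N_ep (w : Equiv.Perm (Fin (r + 1))) (v : Equiv.Perm (Fin (t + 1))) (i : Fin (r + 1))
    (j : Fin (t + 1)) : N d w v * ep d i j = ep d (w i) (v j) * N d w v := by
  have h := N_e d (Equiv.swap 0 (w i) * w * Equiv.swap 0 i) (Equiv.swap 0 (v j) * v * Equiv.swap 0 j)
    (by simp) (by simp)
  have e1 : N d w v * N d (Equiv.swap 0 i) (Equiv.swap 0 j) =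
      N d (Equiv.swap 0 (w i)) (Equiv.swap 0 (v j)) *
      N d (Equiv.swap 0 (w i) * w * Equiv.swap 0 i) (Equiv.swap 0 (v j) * v * Equiv.swap 0 j) := by
    rw [N_mul, N_mul]; simp only [← mul_assoc, Equiv.swap_mul_self, one_mul]
  have e2 : N d (Equiv.swap 0 (w i) * w * Equiv.swap 0 i) (Equiv.swap 0 (v j) * v * Equiv.swap 0 j) *
      N d (Equiv.swap 0 i) (Equiv.swap 0 j) =
      N d (Equiv.swap 0 (w i)) (Equiv.swap 0 (v j)) * N d w v := by
    rw [N_mul, N_mul]; simp only [mul_assoc, Equiv.swap_mul_self, mul_one]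
  calc N d w v * ep d i j = N d w v * N d (Equiv.swap 0 i) (Equiv.swap 0 j) * d.e *
        N d (Equiv.swap 0 i) (Equiv.swap 0 j) := by simp only [ep, mul_assoc]
    _ = N d (Equiv.swap 0 (w i)) (Equiv.swap 0 (v j)) * d.e *
      (N d (Equiv.swap 0 (w i) * w * Equiv.swap 0 i) (Equiv.swap 0 (v j) * v * Equiv.swap 0 j) *
        N d (Equiv.swap 0 i) (Equiv.swap 0 j)) := by
        rw [e1, mul_assoc (N d (Equiv.swap 0 (w i)) _), h]; simp only [mul_assoc]
    _ = _ := by rw [e2]; simp only [ep, mul_assoc]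

theorem σ_ep (w : Equiv.Perm (Fin (r + 1))) (i : Fin (r + 1)) (j : Fin (t + 1)) :
    d.σ w * ep d i j = ep d (w i) j * d.σ w := by
  have := N_ep d w 1 i j
  simpa [N] using this

theorem σb_ep (v : Equiv.Perm (Fin (t + 1))) (i : Fin (r + 1)) (j : Fin (t + 1)) :
    d.σb v * ep d i j = ep d i (v j) * d.σb v := by
  have := N_ep d 1 v i j
  simpa [N] using this

theorem σ_c (w : Equiv.Perm (Fin (r + 1))) (i : Fin (r + 1)) :
    d.σ w * d.c i = d.c (w i) * d.σ w := by
  rw [← d.c_conj, mul_assoc, ← map_mul]; simp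

theorem σb_cb (w : Equiv.Perm (Fin (t + 1))) (i : Fin (t + 1)) :
    d.σb w * d.cb i = d.cb (w i) * d.σb w := by
  rw [← d.cb_conj, mul_assoc, ← map_mul]; simp

theorem N_c (w : Equiv.Perm (Fin (r + 1))) (v : Equiv.Perm (Fin (t + 1))) (i : Fin (r + 1)) :
    N d w v * d.c i = d.c (w i) * N d w v := by
  rw [N, mul_assoc, d.comm_σbc, ← mul_assoc, σ_c, mul_assoc]

theorem N_cb (w : Equiv.Perm (Fin (r + 1))) (v : Equiv.Perm (Fin (t + 1))) (i : Fin (t + 1)) :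
    N d w v * d.cb i = d.cb (v i) * N d w v := by
  rw [N, mul_assoc, σb_cb, ← mul_assoc, d.comm_σcb, mul_assoc]

/-- `N` moves past a product. -/
theorem N_mul_move {w : Equiv.Perm (Fin (r + 1))} {v : Equiv.Perm (Fin (t + 1))} {X Y X' Y' : A}
    (hX : N d w v * X' = X * N d w v) (hY : N d w v * Y' = Y * N d w v) :
    N d w v * (X' * Y') = X * Y * N d w v := by
  rw [← mul_assoc, hX, mul_assoc, hY, mul_assoc]

theorem N_ep0 (i : Fin (r + 1)) (j : Fin (t + 1)) :
    N d (Equiv.swap 0 i) (Equiv.swap 0 j) * d.e =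
      ep d i j * N d (Equiv.swap 0 i) (Equiv.swap 0 j) := by
  have := N_ep d (Equiv.swap 0 i) (Equiv.swap 0 j) 0 0
  simpa [ep_zero] using this

theorem c_ep (l i : Fin (r + 1)) (j : Fin (t + 1)) (h : l ≠ i) :
    d.c l * ep d i j = ep d i j * d.c l := by
  have h1 : Equiv.swap 0 i l ≠ 0 := fun h' => h (by
    have := congrArg (Equiv.swap 0 i) h'; simpa using this)
  have h3 := N_c d (Equiv.swap 0 i) (Equiv.swap 0 j) (Equiv.swap 0 i l)
  rw [Equiv.swap_apply_self] at h3
  exact N_transport d _ _ (d.c_e_comm (Equiv.swap 0 i l) (fun h' => h1 (Fin.ext h')))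
    (N_mul_move d h3 (N_ep0 d i j)) (N_mul_move d (N_ep0 d i j) h3)

theorem cb_ep (l : Fin (t + 1)) (i : Fin (r + 1)) (j : Fin (t + 1)) (h : l ≠ j) :
    d.cb l * ep d i j = ep d i j * d.cb l := by
  have h1 : Equiv.swap 0 j l ≠ 0 := fun h' => h (by
    have := congrArg (Equiv.swap 0 j) h'; simpa using this)
  have h3 := N_cb d (Equiv.swap 0 i) (Equiv.swap 0 j) (Equiv.swap 0 j l)
  rw [Equiv.swap_apply_self] at h3
  exact N_transport d _ _ (d.cb_e_comm (Equiv.swap 0 j l) (fun h' => h1 (Fin.ext h')))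
    (N_mul_move d h3 (N_ep0 d i j)) (N_mul_move d (N_ep0 d i j) h3)

theorem N_c0 (i : Fin (r + 1)) (j : Fin (t + 1)) :
    N d (Equiv.swap 0 i) (Equiv.swap 0 j) * d.c 0 =
      d.c i * N d (Equiv.swap 0 i) (Equiv.swap 0 j) := by simp [N_c]
theorem N_cb0 (i : Fin (r + 1)) (j : Fin (t + 1)) :
    N d (Equiv.swap 0 i) (Equiv.swap 0 j) * d.cb 0 =
      d.cb j * N d (Equiv.swap 0 i) (Equiv.swap 0 j) := by simp [N_cb]

theorem c_ep_cb (i : Fin (r + 1)) (j : Fin (t + 1)) : d.c i * ep d i j = d.cb j * ep d i j :=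
  N_transport d _ _ (d.c1_e (by omega) (by omega))
    (N_mul_move d (N_c0 d i j) (N_ep0 d i j)) (N_mul_move d (N_cb0 d i j) (N_ep0 d i j))

theorem ep_c_cb (i : Fin (r + 1)) (j : Fin (t + 1)) : ep d i j * d.c i = ep d i j * d.cb j :=
  N_transport d _ _ (d.e_c1 (by omega) (by omega))
    (N_mul_move d (N_ep0 d i j) (N_c0 d i j)) (N_mul_move d (N_ep0 d i j) (N_cb0 d i j))

theorem ep_sq (i : Fin (r + 1)) (j : Fin (t + 1)) : ep d i j * ep d i j = 0 :=
  N_transport d _ _ d.e_sq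
    (N_mul_move d (N_ep0 d i j) (N_ep0 d i j)) (by simp)

theorem ep_c_ep (i : Fin (r + 1)) (j : Fin (t + 1)) : ep d i j * d.c i * ep d i j = 0 :=
  N_transport d _ _ (d.e_c_e (by omega))
    (N_mul_move d (N_mul_move d (N_ep0 d i j) (N_c0 d i j)) (N_ep0 d i j)) (by simp)

theorem e_sb_e' (l : Fin (t + 1)) (h : l ≠ 0) : d.e * d.σb (Equiv.swap 0 l) * d.e = d.e := by
  have hl : 0 < (l : ℕ) := Nat.pos_of_ne_zero (fun h' => h (Fin.ext h'))
  have h1 : 1 < t + 1 := lt_of_le_of_lt hl l.2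
  have h2 := d.e_sb_e h1
  rw [FM.sw_eq _ _ _ (by omega) h1] at h2
  set o : Fin (t + 1) := ⟨1, h1⟩
  have ho : o ≠ 0 := by simp [o, Fin.ext_iff]
  have hc := σb_e d (Equiv.swap o l) (Equiv.swap_apply_of_ne_of_ne ho.symm h.symm)
  have e0 : N d 1 (Equiv.swap o l) * d.e = d.e * N d 1 (Equiv.swap o l) := by simpa [N] using hc
  refine N_transport d 1 (Equiv.swap o l) h2 (N_mul_move d (N_mul_move d e0 ?_) e0) e0
  simp only [N, map_one, one_mul]
  rw [← map_mul, ← map_mul]; congr 1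
  rw [← mul_inv_eq_iff_eq_mul, ← Equiv.swap_apply_apply, Equiv.swap_apply_left,
    Equiv.swap_apply_of_ne_of_ne]
  · rfl
  · exact ho.symm
  · exact h.symm

theorem e_s_e' (l : Fin (r + 1)) (h : l ≠ 0) : d.e * d.σ (Equiv.swap 0 l) * d.e = d.e := by
  have hl : 0 < (l : ℕ) := Nat.pos_of_ne_zero (fun h' => h (Fin.ext h'))
  have h1 : 1 < r + 1 := lt_of_le_of_lt hl l.2
  have h2 := d.e_s_e h1
  rw [FM.sw_eq _ _ _ (by omega) h1] at h2
  set o : Fin (r + 1) := ⟨1, h1⟩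
  have ho : o ≠ 0 := by simp [o, Fin.ext_iff]
  have hc := σ_e d (Equiv.swap o l) (Equiv.swap_apply_of_ne_of_ne ho.symm h.symm)
  have e0 : N d (Equiv.swap o l) 1 * d.e = d.e * N d (Equiv.swap o l) 1 := by simpa [N] using hc
  refine N_transport d (Equiv.swap o l) 1 h2 (N_mul_move d (N_mul_move d e0 ?_) e0) e0
  simp only [N, map_one, mul_one]
  rw [← map_mul, ← map_mul]; congr 1
  rw [← mul_inv_eq_iff_eq_mul, ← Equiv.swap_apply_apply, Equiv.swap_apply_left,
    Equiv.swap_apply_of_ne_of_ne]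
  · rfl
  · exact ho.symm
  · exact h.symm

theorem ep_sb_ep (i : Fin (r + 1)) (j l : Fin (t + 1)) (h : j ≠ l) :
    ep d i j * d.σb (Equiv.swap j l) * ep d i j = ep d i j := by
  have h1 : Equiv.swap 0 j l ≠ 0 := fun h' => h (by
    have := congrArg (Equiv.swap 0 j) h'; simpa using this.symm)
  refine N_transport d (Equiv.swap 0 i) (Equiv.swap 0 j) (e_sb_e' d _ h1)
    (N_mul_move d (N_mul_move d (N_ep0 d i j) ?_) (N_ep0 d i j)) (N_ep0 d i j)
  rw [show d.σb (Equiv.swap 0 (Equiv.swap 0 j l)) = N d 1 (Equiv.swap 0 (Equiv.swap 0 j l)) by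
    simp [N], show d.σb (Equiv.swap j l) = N d 1 (Equiv.swap j l) by simp [N], N_mul, N_mul]
  simp only [mul_one, one_mul]
  congr 1
  rw [← mul_inv_eq_iff_eq_mul, ← Equiv.swap_apply_apply]; simp

theorem ep_s_ep (i l : Fin (r + 1)) (j : Fin (t + 1)) (h : i ≠ l) :
    ep d i j * d.σ (Equiv.swap i l) * ep d i j = ep d i j := by
  have h1 : Equiv.swap 0 i l ≠ 0 := fun h' => h (by
    have := congrArg (Equiv.swap 0 i) h'; simpa using this.symm)
  refine N_transport d (Equiv.swap 0 i) (Equiv.swap 0 j) (e_s_e' d _ h1)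
    (N_mul_move d (N_mul_move d (N_ep0 d i j) ?_) (N_ep0 d i j)) (N_ep0 d i j)
  rw [show d.σ (Equiv.swap 0 (Equiv.swap 0 i l)) = N d (Equiv.swap 0 (Equiv.swap 0 i l)) 1 by
    simp [N], show d.σ (Equiv.swap i l) = N d (Equiv.swap i l) 1 by simp [N], N_mul, N_mul]
  simp only [mul_one, one_mul]
  congr 1
  rw [← mul_inv_eq_iff_eq_mul, ← Equiv.swap_apply_apply]; simp

/-- `e_{ij} e_{il} = e_{ij} (j̄ l̄)` -/
theorem ep_ep_b (i : Fin (r + 1)) (j l : Fin (t + 1)) (h : j ≠ l) :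
    ep d i j * ep d i l = ep d i j * d.σb (Equiv.swap j l) := by
  have h1 := σb_ep d (Equiv.swap j l) i j
  rw [Equiv.swap_apply_left] at h1
  have h2 : d.σb (Equiv.swap j l) * d.σb (Equiv.swap j l) = 1 := by rw [← map_mul]; simp
  calc ep d i j * ep d i l = ep d i j * (ep d i l * (d.σb (Equiv.swap j l) *
      d.σb (Equiv.swap j l))) := by rw [h2, mul_one]
    _ = ep d i j * d.σb (Equiv.swap j l) * ep d i j * d.σb (Equiv.swap j l) := by
      rw [← mul_assoc (ep d i l), ← h1]; simp only [mul_assoc]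
    _ = _ := by rw [ep_sb_ep d i j l h]

theorem ep_ep_b' (i : Fin (r + 1)) (j l : Fin (t + 1)) (h : j ≠ l) :
    ep d i j * ep d i l = d.σb (Equiv.swap j l) * ep d i l := by
  rw [ep_ep_b d i j l h, σb_ep, Equiv.swap_apply_right]

theorem ep_ep_a (i l : Fin (r + 1)) (j : Fin (t + 1)) (h : i ≠ l) :
    ep d i j * ep d l j = ep d i j * d.σ (Equiv.swap i l) := by
  have h1 := σ_ep d (Equiv.swap i l) i j
  rw [Equiv.swap_apply_left] at h1
  have h2 : d.σ (Equiv.swap i l) * d.σ (Equiv.swap i l) = 1 := by rw [← map_mul]; simp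
  calc ep d i j * ep d l j = ep d i j * (ep d l j * (d.σ (Equiv.swap i l) *
      d.σ (Equiv.swap i l))) := by rw [h2, mul_one]
    _ = ep d i j * d.σ (Equiv.swap i l) * ep d i j * d.σ (Equiv.swap i l) := by
      rw [← mul_assoc (ep d l j), ← h1]; simp only [mul_assoc]
    _ = _ := by rw [ep_s_ep d i l j h]

theorem ep_ep_a' (i l : Fin (r + 1)) (j : Fin (t + 1)) (h : i ≠ l) :
    ep d i j * ep d l j = d.σ (Equiv.swap i l) * ep d l j := by
  rw [ep_ep_a d i l j h, σ_ep, Equiv.swap_apply_right]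

/-- both braid relations at once -/
theorem ep_ep_01 (hr : 1 < r + 1) (ht : 1 < t + 1) :
    d.e * ep d ⟨1, hr⟩ ⟨1, ht⟩ = ep d ⟨1, hr⟩ ⟨1, ht⟩ * d.e ∧
    d.e * ep d ⟨1, hr⟩ ⟨1, ht⟩ * N d (Equiv.swap 0 ⟨1, hr⟩) (Equiv.swap 0 ⟨1, ht⟩) =
      d.e * ep d ⟨1, hr⟩ ⟨1, ht⟩ := by
  have b1 := d.braid1 hr ht
  have b2 := d.braid2 hr ht
  rw [FM.sw_eq _ _ _ (by omega) hr, FM.sw_eq _ _ _ (by omega) ht] at b1 b2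
  change d.e * d.σ (Equiv.swap 0 ⟨1, hr⟩) * d.σb (Equiv.swap 0 ⟨1, ht⟩) * d.e *
    d.σ (Equiv.swap 0 ⟨1, hr⟩) = d.e * d.σ (Equiv.swap 0 ⟨1, hr⟩) * d.σb (Equiv.swap 0 ⟨1, ht⟩) *
    d.e * d.σb (Equiv.swap 0 ⟨1, ht⟩) at b1
  change d.σ (Equiv.swap 0 ⟨1, hr⟩) * d.e * d.σ (Equiv.swap 0 ⟨1, hr⟩) *
    d.σb (Equiv.swap 0 ⟨1, ht⟩) * d.e = d.σb (Equiv.swap 0 ⟨1, ht⟩) * d.e *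
    d.σ (Equiv.swap 0 ⟨1, hr⟩) * d.σb (Equiv.swap 0 ⟨1, ht⟩) * d.e at b2
  have hS : d.σ (Equiv.swap 0 ⟨1, hr⟩) * d.σ (Equiv.swap 0 ⟨1, hr⟩) = 1 := by
    rw [← map_mul]; simp
  have hT : d.σb (Equiv.swap 0 ⟨1, ht⟩) * d.σb (Equiv.swap 0 ⟨1, ht⟩) = 1 := by
    rw [← map_mul]; simp
  have hST := d.comm_σσb (Equiv.swap 0 ⟨1, hr⟩) (Equiv.swap 0 ⟨1, ht⟩)
  simp only [ep, N]
  set S := d.σ (Equiv.swap 0 ⟨1, hr⟩)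
  set T := d.σb (Equiv.swap 0 ⟨1, ht⟩)
  have h1 : d.e * (S * T * d.e * (S * T)) = d.e * S * T * d.e := by
    have := congrArg (· * T) b1
    simp only [mul_assoc, hT, mul_one] at this
    simpa only [mul_assoc] using this
  have h2 : S * T * d.e * (S * T) * d.e = d.e * S * T * d.e := by
    have := congrArg (T * ·) b2
    simp only [← mul_assoc, hT, one_mul] at this
    rw [← this]
    simp only [← mul_assoc]
    rw [hST]
  refine ⟨by rw [h1, h2], ?_⟩
  rw [h1]
  simpa only [mul_assoc] using h1

theorem perm_two {n : ℕ} (h : 1 < n + 1) (i k : Fin (n + 1)) (hik : i ≠ k) :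
    ∃ w : Equiv.Perm (Fin (n + 1)), w 0 = i ∧ w ⟨1, h⟩ = k := by
  refine ⟨Equiv.swap 0 i * Equiv.swap ⟨1, h⟩ (Equiv.swap 0 i k), ?_, by simp⟩
  have h0 : Equiv.swap (⟨1, h⟩ : Fin (n + 1)) (Equiv.swap 0 i k) 0 = 0 := by
    apply Equiv.swap_apply_of_ne_of_ne
    · simp [Fin.ext_iff]
    · intro h'
      have := congrArg (Equiv.swap 0 i) h'
      rw [Equiv.swap_apply_self, Equiv.swap_apply_left] at this
      exact hik this
  rw [Equiv.Perm.mul_apply, h0, Equiv.swap_apply_left]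

theorem two_of_ne {n : ℕ} {i k : Fin (n + 1)} (h : i ≠ k) : 1 < n + 1 := by
  by_contra hc
  exact h (Fin.ext (by have := i.2; have := k.2; omega))

theorem ep_comm (i k : Fin (r + 1)) (j l : Fin (t + 1)) (h : i ≠ k) (h' : j ≠ l) :
    ep d i j * ep d k l = ep d k l * ep d i j := by
  have hr := two_of_ne h
  have ht := two_of_ne h'
  obtain ⟨w, hw0, hw1⟩ := perm_two hr i k h
  obtain ⟨v, hv0, hv1⟩ := perm_two ht j l h'
  have b := (ep_ep_01 d hr ht).1
  rw [← ep_zero] at b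
  have e1 := N_ep d w v 0 0
  have e2 := N_ep d w v ⟨1, hr⟩ ⟨1, ht⟩
  rw [hw0, hv0] at e1
  rw [hw1, hv1] at e2
  exact N_transport d w v b (N_mul_move d e1 e2) (N_mul_move d e2 e1)

theorem ep_ep_N (i k : Fin (r + 1)) (j l : Fin (t + 1)) (h : i ≠ k) (h' : j ≠ l) :
    ep d i j * ep d k l * N d (Equiv.swap i k) (Equiv.swap j l) = ep d i j * ep d k l := by
  have hr := two_of_ne h
  have ht := two_of_ne h'
  obtain ⟨w, hw0, hw1⟩ := perm_two hr i k h
  obtain ⟨v, hv0, hv1⟩ := perm_two ht j l h'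
  have b := (ep_ep_01 d hr ht).2
  rw [← ep_zero] at b
  have e1 := N_ep d w v 0 0
  have e2 := N_ep d w v ⟨1, hr⟩ ⟨1, ht⟩
  rw [hw0, hv0] at e1
  rw [hw1, hv1] at e2
  refine N_transport d w v b (N_mul_move d (N_mul_move d e1 e2) ?_) (N_mul_move d e1 e2)
  rw [N_mul, N_mul]
  congr 1
  · rw [← mul_inv_eq_iff_eq_mul, ← Equiv.swap_apply_apply, hw0, hw1]
  · rw [← mul_inv_eq_iff_eq_mul, ← Equiv.swap_apply_apply, hv0, hv1]

end WF
end

open Polynomial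
noncomputable section

namespace WF
open FM

variable {r t : ℕ}

abbrev LL (r t : ℕ) : Type := List (Fin (r + 1) × Fin (t + 1))

def OK (L : LL r t) : Prop := L.Pairwise (fun p q => p.1 ≠ q.1 ∧ p.2 ≠ q.2)

theorem OK_symm : Std.Symm (fun p q : Fin (r + 1) × Fin (t + 1) => p.1 ≠ q.1 ∧ p.2 ≠ q.2) :=
  ⟨fun _ _ h => ⟨h.1.symm, h.2.symm⟩⟩

theorem OK_nodup {L : LL r t} (h : OK L) : L.Nodup :=
  List.Pairwise.imp (fun h' e => h'.1 (congrArg Prod.fst e)) h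

theorem OK_pair {L : LL r t} (h : OK L) {p q : Fin (r + 1) × Fin (t + 1)} (hp : p ∈ L) (hq : q ∈ L)
    (hpq : p ≠ q) : p.1 ≠ q.1 ∧ p.2 ≠ q.2 := by
  haveI := OK_symm (r := r) (t := t)
  exact List.Pairwise.forall h hp hq hpq

theorem OK_fst {L : LL r t} (h : OK L) {i : Fin (r + 1)} {j l : Fin (t + 1)} (hp : (i, j) ∈ L)
    (hq : (i, l) ∈ L) : j = l := by
  by_contra hc
  exact (OK_pair h hp hq (fun e => hc (congrArg Prod.snd e))).1 rfl

theorem OK_snd {L : LL r t} (h : OK L) {i k : Fin (r + 1)} {j : Fin (t + 1)} (hp : (i, j) ∈ L)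
    (hq : (k, j) ∈ L) : i = k := by
  by_contra hc
  exact (OK_pair h hp hq (fun e => hc (congrArg Prod.fst e))).2 rfl

def D (g : Equiv.Perm (Fin (r + 1))) (h : Equiv.Perm (Fin (t + 1))) : LL r t → PP (r + 1) (t + 1)
  | [] => lw (t + 1) g * (rw' (r + 1) h)⁻¹
  | p :: L => Equiv.swap (Sum.inl p.1) (D g h L (Sum.inr p.2)) * D g h L

theorem D_char (g : Equiv.Perm (Fin (r + 1))) (h : Equiv.Perm (Fin (t + 1))) (L : LL r t)
    (hL : OK L) :
    (∀ i j, (i, j) ∈ L → D g h L (Sum.inr j) = Sum.inl i) ∧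
    (∀ j, (∀ i, (i, j) ∉ L) → D g h L (Sum.inr j) = Sum.inr (h⁻¹ j)) ∧
    (∀ a, (∀ j, (g a, j) ∉ L) → D g h L (Sum.inl a) = Sum.inl (g a)) ∧
    (∀ a j, (g a, j) ∈ L → D g h L (Sum.inl a) = Sum.inr (h⁻¹ j)) := by
  induction L with
  | nil => simp [D, ← rw_inv]
  | cons p L ih =>
    obtain ⟨i0, j0⟩ := p
    obtain ⟨hp, hL'⟩ := List.pairwise_cons.1 hL
    obtain ⟨c1, c2, c3, c4⟩ := ih hL'
    have hj0 : ∀ i, (i, j0) ∉ L := fun i hi => (hp _ hi).2 rfl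
    have hi0 : ∀ j, (i0, j) ∉ L := fun j hj => (hp _ hj).1 rfl
    have e0 := c2 j0 hj0
    have hD : D g h ((i0, j0) :: L) = Equiv.swap (Sum.inl i0) (Sum.inr (h⁻¹ j0)) * D g h L := by
      simp only [D]; rw [e0]
    rw [hD]
    refine ⟨?_, ?_, ?_, ?_⟩
    · intro i j hij
      rcases List.mem_cons.1 hij with e | hm
      · obtain ⟨rfl, rfl⟩ := Prod.mk.inj e
        rw [Equiv.Perm.mul_apply, e0, Equiv.swap_apply_right]
      · rw [Equiv.Perm.mul_apply, c1 i j hm, Equiv.swap_apply_of_ne_of_ne]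
        · intro e; rw [Sum.inl_injective e] at hm; exact hi0 _ hm
        · simp
    · intro j hj
      have hj' : j ≠ j0 := by rintro rfl; exact hj i0 (by simp)
      rw [Equiv.Perm.mul_apply, c2 j (fun i hi => hj i (List.mem_cons_of_mem _ hi)),
        Equiv.swap_apply_of_ne_of_ne]
      · simp
      · simpa using hj'
    · intro a ha
      have ha' : g a ≠ i0 := by intro e; exact ha j0 (by simp [e])
      rw [Equiv.Perm.mul_apply, c3 a (fun i hi => ha i (List.mem_cons_of_mem _ hi)),
        Equiv.swap_apply_of_ne_of_ne]
      · simpa using ha'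
      · simp
    · intro a j haj
      rcases List.mem_cons.1 haj with e | hm
      · obtain ⟨e1, rfl⟩ := Prod.mk.inj e
        rw [Equiv.Perm.mul_apply, c3 a (by rw [e1]; exact hi0), e1, Equiv.swap_apply_left]
      · have hj' : j ≠ j0 := by rintro rfl; exact hj0 _ hm
        rw [Equiv.Perm.mul_apply, c4 a j hm, Equiv.swap_apply_of_ne_of_ne]
        · simp
        · simpa using hj'

theorem D_mem {g : Equiv.Perm (Fin (r + 1))} {h : Equiv.Perm (Fin (t + 1))} {L : LL r t}
    (hL : OK L) (i : Fin (r + 1)) (j : Fin (t + 1)) :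
    (i, j) ∈ L ↔ D g h L (Sum.inr j) = Sum.inl i := by
  obtain ⟨c1, c2, -, -⟩ := D_char g h L hL
  refine ⟨c1 i j, fun hD => ?_⟩
  by_cases hj : ∀ i, (i, j) ∉ L
  · rw [c2 j hj] at hD; simp at hD
  · push Not at hj
    obtain ⟨k, hk⟩ := hj
    rw [c1 k j hk] at hD
    rw [← Sum.inl_injective hD]; exact hk

variable {R A : Type} [CommRing R] [Ring A] [Algebra R A] (d : WBC R A (r + 1) (t + 1))

def eL (L : LL r t) : A := (L.map (fun p => ep d p.1 p.2)).prod

theorem eL_cons (p : Fin (r + 1) × Fin (t + 1)) (L : LL r t) :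
    eL d (p :: L) = ep d p.1 p.2 * eL d L := by simp [eL]

theorem eL_perm {L L' : LL r t} (hL : OK L) (h : L.Perm L') : eL d L = eL d L' := by
  unfold eL
  refine (h.map _).prod_eq' ?_
  rw [List.pairwise_map]
  exact hL.imp fun h' => ep_comm d _ _ _ _ h'.1 h'.2

theorem eL_mem {L : LL r t} (hL : OK L) {p : Fin (r + 1) × Fin (t + 1)} (hp : p ∈ L) :
    eL d L = ep d p.1 p.2 * eL d (L.erase p) := by
  rw [eL_perm d hL (List.perm_cons_erase hp), eL_cons]

theorem N_eL (w : Equiv.Perm (Fin (r + 1))) (v : Equiv.Perm (Fin (t + 1))) (L : LL r t) :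
    N d w v * eL d L = eL d (L.map (Prod.map w v)) * N d w v := by
  induction L with
  | nil => simp [eL]
  | cons p L ih =>
    rw [List.map_cons, eL_cons, eL_cons]
    exact N_mul_move d (N_ep d _ _ _ _) ih

theorem OK_map {L : LL r t} (hL : OK L) (w : Equiv.Perm (Fin (r + 1)))
    (v : Equiv.Perm (Fin (t + 1))) : OK (L.map (Prod.map w v)) := by
  rw [OK, List.pairwise_map]
  exact hL.imp fun h => ⟨fun e => h.1 (w.injective e), fun e => h.2 (v.injective e)⟩

theorem OK_erase {L : LL r t} (hL : OK L) (p : Fin (r + 1) × Fin (t + 1)) : OK (L.erase p) :=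
  hL.sublist List.erase_sublist

theorem eL_swap {L : LL r t} (hL : OK L) {a b : Fin (r + 1)} {j l : Fin (t + 1)} (hab : a ≠ b)
    (h1 : (a, j) ∈ L) (h2 : (b, l) ∈ L) :
    eL d L * N d (Equiv.swap a b) (Equiv.swap j l) = eL d L := by
  have hjl := (OK_pair hL h1 h2 (fun e => hab (congrArg Prod.fst e))).2
  have h2' : (b, l) ∈ L.erase (a, j) :=
    (List.mem_erase_of_ne (fun e => hab (congrArg Prod.fst e).symm)).2 h2
  have hp : L.Perm ((L.erase (a, j)).erase (b, l) ++ [(a, j), (b, l)]) := by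
    refine (List.perm_cons_erase h1).trans ?_
    refine ((List.perm_cons_erase h2').cons _).trans ?_
    exact (List.perm_append_comm (l₁ := [(a, j), (b, l)]))
  rw [eL_perm d hL hp]
  have : eL d ((L.erase (a, j)).erase (b, l) ++ [(a, j), (b, l)]) =
      eL d ((L.erase (a, j)).erase (b, l)) * (ep d a j * ep d b l) := by simp [eL]
  rw [this, mul_assoc, ep_ep_N d _ _ _ _ hab hjl]

theorem eL_fix {L : LL r t} (hL : OK L) (u : Equiv.Perm (Fin (r + 1)))
    (hu : ∀ x, u x ≠ x → ∃ j, (x, j) ∈ L) :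
    ∀ v : Equiv.Perm (Fin (t + 1)), (∀ j, (∀ i, (i, j) ∉ L) → v j = j) →
      (∀ i j, (i, j) ∈ L → (u i, v j) ∈ L) → eL d L * N d u v = eL d L := by
  refine perm_ind (fun u => ∀ v : Equiv.Perm (Fin (t + 1)), (∀ j, (∀ i, (i, j) ∉ L) → v j = j) →
      (∀ i j, (i, j) ∈ L → (u i, v j) ∈ L) → eL d L * N d u v = eL d L)
      (fun x => ∃ j, (x, j) ∈ L) ?_ ?_ u hu
  · intro v hv h
    have : v = 1 := by
      ext j : 1
      by_cases hj : ∀ i, (i, j) ∉ L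
      · exact hv j hj
      · push Not at hj
        obtain ⟨i, hi⟩ := hj
        exact OK_fst hL (h i j hi) hi
    rw [this, N_one, mul_one]
  · rintro a b w hab ⟨j, hj⟩ ⟨l, hl⟩ hw ih v hv h
    have e1 : N d (Equiv.swap a b * w) v = N d (Equiv.swap a b) (Equiv.swap j l) *
        N d w (Equiv.swap j l * v) := by
      rw [N_mul, ← mul_assoc]; simp
    have hjl := (OK_pair hL hj hl (fun e => hab (congrArg Prod.fst e))).2
    rw [e1, ← mul_assoc, eL_swap d hL hab hj hl]
    apply ih
    · intro x hx
      rw [Equiv.Perm.mul_apply, hv x hx, Equiv.swap_apply_of_ne_of_ne]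
      · rintro rfl; exact hx _ hj
      · rintro rfl; exact hx _ hl
    · intro i x hx
      have h' := h i x hx
      rw [Equiv.Perm.mul_apply] at h' ⊢
      generalize w i = p at *
      generalize v x = s at *
      rcases eq_or_ne p a with rfl | pa
      · rw [Equiv.swap_apply_left] at h'
        rw [OK_fst hL h' hl, Equiv.swap_apply_right]; exact hj
      rcases eq_or_ne p b with rfl | pb
      · rw [Equiv.swap_apply_right] at h'
        rw [OK_fst hL h' hj, Equiv.swap_apply_left]; exact hl
      rw [Equiv.swap_apply_of_ne_of_ne pa pb] at h'
      rw [Equiv.swap_apply_of_ne_of_ne]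
      · exact h'
      · rintro rfl; exact pa (OK_snd hL h' hj)
      · rintro rfl; exact pb (OK_snd hL h' hl)

def nf (L : LL r t) (g : Equiv.Perm (Fin (r + 1))) (h : Equiv.Perm (Fin (t + 1))) : A :=
  eL d L * N d g h

theorem nf_unique {L L' : LL r t} {g g' : Equiv.Perm (Fin (r + 1))}
    {h h' : Equiv.Perm (Fin (t + 1))} (hL : OK L) (hL' : OK L') (hD : D g h L = D g' h' L') :
    nf d L g h = nf d L' g' h' := by
  have hmem : ∀ p, p ∈ L ↔ p ∈ L' := by
    rintro ⟨i, j⟩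
    rw [D_mem (g := g) (h := h) hL, D_mem (g := g') (h := h') hL', hD]
  have hp : L.Perm L' := (List.perm_ext_iff_of_nodup (OK_nodup hL) (OK_nodup hL')).2 hmem
  obtain ⟨c1, c2, c3, c4⟩ := D_char g h L hL
  obtain ⟨c1', c2', c3', c4'⟩ := D_char g' h' L' hL'
  simp only [← hD, ← hmem] at c1' c2' c3' c4'
  rw [nf, nf, ← eL_perm d hL hp]
  have e : N d g' h' = N d (g' * g⁻¹) (h' * h⁻¹) * N d g h := by rw [N_mul]; simp
  suffices key : eL d L * N d (g' * g⁻¹) (h' * h⁻¹) = eL d L by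
    rw [e, ← mul_assoc, key]
  refine eL_fix d hL _ ?_ _ ?_ ?_
  · intro x hx
    by_contra hc
    push Not at hc
    apply hx
    have h1 := c3 (g⁻¹ x) (by simpa using hc)
    have h2 : ∀ j, (g' (g⁻¹ x), j) ∉ L := by
      intro j hj
      rw [c4' _ _ hj] at h1; simp at h1
    rw [c3' _ h2] at h1
    simpa using h1
  · intro j hj
    have h1 := c2 j hj
    rw [c2' j hj] at h1
    rw [Equiv.Perm.mul_apply, ← Sum.inr_injective h1]; simp
  · intro i j hij
    have h1 := c4 (g⁻¹ i) j (by simpa using hij)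
    have h2 : ∃ j', (g' (g⁻¹ i), j') ∈ L := by
      by_contra hc; push Not at hc
      rw [c3' _ hc] at h1; simp at h1
    obtain ⟨j', hj'⟩ := h2
    rw [c4' _ _ hj'] at h1
    have : (h' * h⁻¹) j = j' := by
      rw [Equiv.Perm.mul_apply, ← Sum.inr_injective h1]; simp
    rw [this]; exact hj'

/-- being a normal form -/
def IsNf (x : A) : Prop := ∃ L g h, OK L ∧ x = nf d L g h

theorem isNf_one : IsNf d 1 := ⟨[], 1, 1, List.Pairwise.nil, by simp [nf, eL, N_one]⟩

theorem isNf_N {x : A} (hx : IsNf d x) (w : Equiv.Perm (Fin (r + 1)))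
    (v : Equiv.Perm (Fin (t + 1))) : IsNf d (N d w v * x) := by
  obtain ⟨L, g, h, hL, rfl⟩ := hx
  refine ⟨_, w * g, v * h, OK_map hL w v, ?_⟩
  rw [nf, ← mul_assoc, N_eL, mul_assoc, N_mul, nf]

theorem isNf_e {x : A} (hx : IsNf d x) : d.e * x = 0 ∨ IsNf d (d.e * x) := by
  obtain ⟨L, g, h, hL, rfl⟩ := hx
  rw [← ep_zero]
  by_cases h0 : ((0 : Fin (r + 1)), (0 : Fin (t + 1))) ∈ L
  · left
    rw [nf, eL_mem d hL h0, ← mul_assoc, ← mul_assoc, ep_sq, zero_mul, zero_mul]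
  right
  by_cases h1 : ∃ l, ((0 : Fin (r + 1)), l) ∈ L
  · obtain ⟨l, hl⟩ := h1
    have hl0 : 0 ≠ l := by rintro rfl; exact h0 hl
    have : ep d 0 0 * nf d L g h = N d 1 (Equiv.swap 0 l) * nf d L g h := by
      rw [nf, eL_mem d hL hl]
      simp only [← mul_assoc]
      rw [ep_ep_b' d _ _ _ hl0]; simp [N]
    rw [this]
    exact isNf_N d ⟨L, g, h, hL, rfl⟩ _ _
  by_cases h2 : ∃ i, (i, (0 : Fin (t + 1))) ∈ L
  · obtain ⟨l, hl⟩ := h2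
    have hl0 : 0 ≠ l := by rintro rfl; exact h0 hl
    have : ep d 0 0 * nf d L g h = N d (Equiv.swap 0 l) 1 * nf d L g h := by
      rw [nf, eL_mem d hL hl]
      simp only [← mul_assoc]
      rw [ep_ep_a' d _ _ _ hl0]; simp [N]
    rw [this]
    exact isNf_N d ⟨L, g, h, hL, rfl⟩ _ _
  · push Not at h1 h2
    refine ⟨(0, 0) :: L, g, h, List.pairwise_cons.2 ⟨?_, hL⟩, ?_⟩
    · rintro ⟨i, j⟩ hij
      exact ⟨by rintro rfl; exact h1 _ hij, by rintro rfl; exact h2 _ hij⟩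
    · rw [nf, nf, eL_cons, mul_assoc]

/-- left multiplication of a normal form by `c̄_1` -/
theorem nf_cb {x : A} (hx : IsNf d x) :
    (∃ i, d.cb 0 * x = d.c i * x ∧ (i = 0 → d.e * d.c 0 * x = 0)) ∨
      (∃ j, d.cb 0 * x = x * d.cb j) := by
  obtain ⟨L, g, h, hL, rfl⟩ := hx
  by_cases h2 : ∃ i, (i, (0 : Fin (t + 1))) ∈ L
  · obtain ⟨i, hi⟩ := h2
    left
    refine ⟨i, ?_, ?_⟩
    · rw [nf, eL_mem d hL hi]
      simp only [← mul_assoc]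
      rw [← c_ep_cb]
    · rintro rfl
      rw [nf, eL_mem d hL hi]
      simp only [← mul_assoc]
      have := ep_c_ep d 0 0
      rw [ep_zero] at this
      rw [ep_zero, this]; simp
  · push Not at h2
    right
    refine ⟨h⁻¹ 0, ?_⟩
    have h1 : d.cb 0 * eL d L = eL d L * d.cb 0 := by
      clear hL
      induction L with
      | nil => simp [eL]
      | cons p L ih =>
        rw [eL_cons, ← mul_assoc, cb_ep d 0 p.1 p.2, mul_assoc, ih, mul_assoc]
        · intro i hi; exact h2 i (List.mem_cons_of_mem _ hi)
        · intro e; exact h2 p.1 (by rw [e]; simp)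
    have h3 := N_cb d g h (h⁻¹ 0)
    rw [show h (h⁻¹ 0) = 0 by simp] at h3
    rw [nf, ← mul_assoc, h1, mul_assoc, ← h3, mul_assoc]

end WF
end

open Polynomial
noncomputable section

namespace WF
open FM

variable {r t : ℕ}
variable {R A : Type} [CommRing R] [Ring A] [Algebra R A]

/-- the data with all odd generators negated -/
def neg {r t : ℕ} (d : WBC R A r t) : WBC R A r t where
  σ := d.σ
  σb := d.σb
  c i := - d.c i
  cb i := - d.cb i
  e := d.e
  c_sq i := by simp [d.c_sq]
  c_anti i j h := by simpa using d.c_anti i j h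
  c_conj w i := by simp [d.c_conj]
  cb_sq i := by simp [d.cb_sq]
  cb_anti i j h := by simpa using d.cb_anti i j h
  cb_conj w i := by simp [d.cb_conj]
  comm_σσb := d.comm_σσb
  comm_σcb w j := by simp [d.comm_σcb]
  comm_σbc w j := by simp [d.comm_σbc]
  anti_ccb i j := by simpa using d.anti_ccb i j
  e_c1 h1 h2 := by simpa using d.e_c1 h1 h2
  c1_e h1 h2 := by simpa using d.c1_e h1 h2
  e_sq := d.e_sq
  e_s_e := d.e_s_e
  e_sb_e := d.e_sb_e
  s_e_comm := d.s_e_comm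
  sb_e_comm := d.sb_e_comm
  braid1 := d.braid1
  braid2 := d.braid2
  c_e_comm i h := by simpa using d.c_e_comm i h
  cb_e_comm i h := by simpa using d.cb_e_comm i h
  e_c_e h := by simpa using d.e_c_e h
  e_cb_e h := by simpa using d.e_cb_e h

section
variable {B : Type} [Ring B] [Algebra R B] {d : WBC R A (r + 1) (t + 1)}
  {d' : WBC R B (r + 1) (t + 1)} {φ : A →ₐ[R] B}

theorem hom_N (h : WBCHom d d' φ) (w v) : φ (N d w v) = N d' w v := by
  simp [N, h.map_σ, h.map_σb]

theorem hom_ep (h : WBCHom d d' φ) (i j) : φ (ep d i j) = ep d' i j := by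
  simp [ep, hom_N h, h.map_e]

theorem hom_eL (h : WBCHom d d' φ) (L) : φ (eL d L) = eL d' L := by
  induction L with
  | nil => simp [eL]
  | cons p L ih => rw [eL_cons, eL_cons, map_mul, hom_ep h, ih]

theorem hom_nf (h : WBCHom d d' φ) (L g k) : φ (nf d L g k) = nf d' L g k := by
  simp [nf, hom_eL h, hom_N h]

end

section X
variable (q : R) (hq : q * 2 = 1)

abbrev XX (r t : ℕ) : WBC R (Module.End R (MM R (r + 1) (t + 1))) (r + 1) (t + 1) :=
  XW q hq (Nat.succ_pos r) (Nat.succ_pos t)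

theorem XN_single (w v) (π : PP (r + 1) (t + 1)) (y) :
    N (XX q hq r t) w v (Finsupp.single π y) =
      Finsupp.single (lw _ w * π * (rw' _ v)⁻¹) (Cl.pm (lw _ w) y) := by
  simp [N, XX, XW, mul_assoc]

theorem Xep_single (i j) (π : PP (r + 1) (t + 1)) (h : π (Sum.inr j) ≠ Sum.inl i) :
    ep (XX q hq r t) i j (Finsupp.single π 1) =
      Finsupp.single (Equiv.swap (Sum.inl i) (π (Sum.inr j)) * π) 1 := by
  unfold ep
  have h0 : (lw (t + 1) (Equiv.swap 0 i) * π * (rw' (r + 1) (Equiv.swap 0 j))⁻¹) (Sum.inr 0) =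
      lw (t + 1) (Equiv.swap 0 i) (π (Sum.inr j)) := by
    rw [← rw_inv]; simp
  have h1 : lw (t + 1) (Equiv.swap 0 i) (π (Sum.inr j)) ≠ Sum.inl 0 := by
    intro e
    apply h
    apply (lw (t + 1) (Equiv.swap 0 i)).injective
    rw [e]; simp
  rw [Module.End.mul_apply, Module.End.mul_apply, XN_single, map_one]
  have h2 : (XX q hq r t).e = Xe q (Sum.inl 0) (Sum.inr 0) := rfl
  rw [h2, Xe_single _ _ _ _ _ (by rw [h0]; exact h1), h0, Cl.sub_one q hq, XN_single, map_one]
  congr 1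
  have h3 : (Sum.inl 0 : II (r + 1) (t + 1)) = lw (t + 1) (Equiv.swap 0 i) (Sum.inl i) := by simp
  rw [h3, Equiv.swap_apply_apply]
  have h4 : lw (t + 1) (Equiv.swap 0 i) * lw (t + 1) (Equiv.swap 0 i) = 1 := by
    rw [← lw_mul]; simp
  have h5 : rw' (r + 1) (Equiv.swap 0 j) * rw' (r + 1) (Equiv.swap 0 j) = 1 := by
    rw [← rw_mul]; simp
  have h4' : (lw (t + 1) (Equiv.swap 0 i))⁻¹ = lw (t + 1) (Equiv.swap 0 i) :=
    inv_eq_of_mul_eq_one_left h4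
  have h5' : (rw' (r + 1) (Equiv.swap 0 j))⁻¹ = rw' (r + 1) (Equiv.swap 0 j) :=
    inv_eq_of_mul_eq_one_left h5
  rw [h4', h5']
  simp only [← mul_assoc, h4, one_mul]
  simp only [mul_assoc, h5, mul_one]
  rw [← mul_assoc (lw (t + 1) (Equiv.swap 0 i)) (lw (t + 1) (Equiv.swap 0 i)), h4, one_mul]

theorem Xnf_single (L : LL r t) (hL : OK L) (g h) :
    nf (XX q hq r t) L g h (Finsupp.single 1 1) = Finsupp.single (D g h L) 1 := by
  induction L with
  | nil => simp [nf, eL, XN_single, D]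
  | cons p L ih =>
    obtain ⟨hp, hL'⟩ := List.pairwise_cons.1 hL
    have e : nf (XX q hq r t) (p :: L) g h = ep (XX q hq r t) p.1 p.2 * nf (XX q hq r t) L g h := by
      rw [nf, nf, eL_cons, mul_assoc]
    rw [e, Module.End.mul_apply, ih hL', Xep_single]
    · rfl
    · intro hD
      exact (hp _ ((D_mem hL' p.1 p.2).2 hD)).1 rfl

end X

variable {d : WBC R A (r + 1) (t + 1)}

def tau (hu : d.IsUniversal) : A →ₐ[R] A := (hu A (neg d)).choose

theorem tau_hom (hu : d.IsUniversal) : WBCHom d (neg d) (tau hu) := (hu A (neg d)).choose_spec.1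

theorem tau_nf (hu : d.IsUniversal) {n : A} (hn : IsNf d n) : tau hu n = n := by
  obtain ⟨L, g, h, hL, rfl⟩ := hn
  rw [hom_nf (tau_hom hu)]; rfl

theorem tau_c (hu : d.IsUniversal) (i) : tau hu (d.c i) = - d.c i := (tau_hom hu).map_c i
theorem tau_cb (hu : d.IsUniversal) (i) : tau hu (d.cb i) = - d.cb i := (tau_hom hu).map_cb i
theorem tau_σ (hu : d.IsUniversal) (i) : tau hu (d.σ i) = d.σ i := (tau_hom hu).map_σ i
theorem tau_σb (hu : d.IsUniversal) (i) : tau hu (d.σb i) = d.σb i := (tau_hom hu).map_σb i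
theorem tau_e (hu : d.IsUniversal) : tau hu d.e = d.e := (tau_hom hu).map_e

theorem tau_tau (hu : d.IsUniversal) (a : A) : tau hu (tau hu a) = a := by
  have : (tau hu).comp (tau hu) = AlgHom.id R A := by
    refine (hu A d).unique ?_ ?_
    · constructor <;> intros <;> simp [tau_c, tau_cb, tau_σ, tau_σb, tau_e]
    · constructor <;> intros <;> simp
  exact congrArg (fun f : A →ₐ[R] A => f a) this

def rg (hu : d.IsUniversal) : II (r + 1) (t + 1) → Module.End R A
  | Sum.inl i => LinearMap.mulLeft R (d.c i)
  | Sum.inr j => LinearMap.mulRight R (d.cb j) ∘ₗ (tau hu).toLinearMap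

theorem rg_sq (hu : d.IsUniversal) (x) : rg hu x * rg hu x = -1 := by
  ext a
  cases x with
  | inl i => simp [rg, ← mul_assoc, d.c_sq]
  | inr i => simp [rg, tau_tau, tau_cb, mul_assoc, d.cb_sq]

theorem rg_anti (hu : d.IsUniversal) (x y) (h : x ≠ y) : rg hu x * rg hu y = -(rg hu y * rg hu x) := by
  ext a
  cases x with
  | inl i =>
    cases y with
    | inl j =>
      have hij : i ≠ j := fun e => h (by rw [e])
      simp [rg, ← mul_assoc, d.c_anti i j hij]
    | inr j => simp [rg, tau_c, mul_assoc]
  | inr i =>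
    cases y with
    | inl j => simp [rg, tau_c, mul_assoc]
    | inr j =>
      have hij : i ≠ j := fun e => h (by rw [e])
      simp [rg, tau_tau, tau_cb, mul_assoc, d.cb_anti i j hij]

def rho (hu : d.IsUniversal) : Cl R (II (r + 1) (t + 1)) →ₐ[R] Module.End R A :=
  Cl.lift (rg hu) (rg_sq hu) (rg_anti hu)

@[simp] theorem rho_inl (hu : d.IsUniversal) (i) (m : A) :
    rho hu (Cl.g R (Sum.inl i)) m = d.c i * m := by
  simp [rho, rg]

@[simp] theorem rho_inr (hu : d.IsUniversal) (j) (m : A) :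
    rho hu (Cl.g R (Sum.inr j)) m = tau hu m * d.cb j := by
  simp [rho, rg]

def MS (hu : d.IsUniversal) : Submodule R A :=
  Submodule.span R {x | ∃ y n, IsNf d n ∧ x = rho hu y n}

theorem MS_nf (hu : d.IsUniversal) (y) {n : A} (hn : IsNf d n) : rho hu y n ∈ MS hu :=
  Submodule.subset_span ⟨y, n, hn, rfl⟩

theorem MS_nf' (hu : d.IsUniversal) {n : A} (hn : IsNf d n) : n ∈ MS hu := by
  simpa using MS_nf hu 1 hn

theorem MS_ind (hu : d.IsUniversal) (f : A →ₗ[R] A)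
    (h : ∀ y n, IsNf d n → f (rho hu y n) ∈ MS hu) (x) (hx : x ∈ MS hu) : f x ∈ MS hu := by
  have : MS hu ≤ (MS hu).comap f := Submodule.span_le.2 (by
    rintro _ ⟨y, n, hn, rfl⟩
    exact h y n hn)
  exact this hx

theorem MS_rho (hu : d.IsUniversal) (y) (x : A) (hx : x ∈ MS hu) : rho hu y x ∈ MS hu := by
  refine MS_ind hu (rho hu y) ?_ x hx
  intro z n hn
  have := MS_nf hu (y * z) hn
  simpa using this

/-- moving a linear operator past `rho` -/
theorem rho_move (hu : d.IsUniversal) (f : A →ₗ[R] A) (θ : Cl R (II (r + 1) (t + 1)) →ₐ[R] Cl R (II (r + 1) (t + 1)))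
    (h : ∀ x z, f (rho hu (Cl.g R x) z) = rho hu (θ (Cl.g R x)) (f z)) (y) :
    ∀ n, f (rho hu y n) = rho hu (θ y) (f n) := by
  intro n
  have := Cl.induct (LinearMap.eqLocus (f ∘ₗ (LinearMap.applyₗ n) ∘ₗ (rho hu).toLinearMap)
    ((LinearMap.applyₗ (f n)) ∘ₗ (rho hu).toLinearMap ∘ₗ θ.toLinearMap)) (by simp)
    (by
      intro i y hy
      simp [LinearMap.mem_eqLocus] at hy ⊢
      rw [h, hy]) y
  simpa [LinearMap.mem_eqLocus] using this

theorem MS_σ (hu : d.IsUniversal) (w) (x : A) (hx : x ∈ MS hu) : d.σ w * x ∈ MS hu := by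
  refine MS_ind hu (LinearMap.mulLeft R (d.σ w)) ?_ x hx
  intro y n hn
  rw [rho_move hu _ (Cl.pm (lw _ w))]
  · have := isNf_N d hn w 1
    simp only [N, map_one, mul_one] at this
    exact MS_nf hu _ this
  · rintro (i | j) z
    · simp [← mul_assoc, σ_c]
    · simp [← mul_assoc, tau_σ]

theorem MS_σb (hu : d.IsUniversal) (v) (x : A) (hx : x ∈ MS hu) : d.σb v * x ∈ MS hu := by
  refine MS_ind hu (LinearMap.mulLeft R (d.σb v)) ?_ x hx
  intro y n hn
  rw [rho_move hu _ (AlgHom.id R _)]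
  · have := isNf_N d hn 1 v
    simp only [N, map_one, one_mul] at this
    exact MS_nf hu _ this
  · rintro (i | j) z
    · simp [← mul_assoc, d.comm_σbc]
    · simp [← mul_assoc, tau_σb]

theorem MS_c (hu : d.IsUniversal) (i) (x : A) (hx : x ∈ MS hu) : d.c i * x ∈ MS hu := by
  simpa using MS_rho hu (Cl.g R (Sum.inl i)) x hx

theorem MS_cb (hu : d.IsUniversal) (x : A) (hx : x ∈ MS hu) : d.cb 0 * x ∈ MS hu := by
  refine MS_ind hu (LinearMap.mulLeft R (d.cb 0)) ?_ x hx
  intro y n hn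
  rw [rho_move hu _ (Cl.inv R _)]
  · apply MS_rho
    rw [LinearMap.mulLeft_apply]
    rcases nf_cb d hn with ⟨i, hi, -⟩ | ⟨j, hj⟩
    · rw [hi]; exact MS_c hu _ _ (MS_nf' hu hn)
    · rw [hj]
      have := MS_nf hu (Cl.g R (Sum.inr j)) hn
      rwa [rho_inr, tau_nf hu hn] at this
  · rintro (i | j) z
    · simp [← mul_assoc, d.anti_ccb]
    · simp [← mul_assoc, tau_cb]

theorem MS_e (hu : d.IsUniversal) (x : A) (hx : x ∈ MS hu) : d.e * x ∈ MS hu := by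
  refine MS_ind hu (LinearMap.mulLeft R d.e) ?_ x hx
  intro y n hn
  have he : d.e * n ∈ MS hu := by
    rcases isNf_e d hn with h | h
    · rw [h]; exact zero_mem _
    · exact MS_nf' hu h
  have := Cl.induct1 (Sum.inl 0) ((MS hu).comap
    (LinearMap.mulLeft R d.e ∘ₗ (LinearMap.applyₗ n) ∘ₗ (rho hu).toLinearMap)) (by simpa using he)
    (by
      simp only [Submodule.mem_comap, LinearMap.comp_apply, LinearMap.mulLeft_apply,
        AlgHom.toLinearMap_apply, LinearMap.applyₗ_apply_apply, rho_inl]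
      have h0 : d.e * d.c 0 = d.e * d.cb 0 := d.e_c1 (Nat.succ_pos _) (Nat.succ_pos _)
      rcases nf_cb d hn with ⟨i, hi, hi0⟩ | ⟨j, hj⟩
      · rcases eq_or_ne i 0 with rfl | hi1
        · rw [← mul_assoc, hi0 rfl]; exact zero_mem _
        · rw [← mul_assoc, h0, mul_assoc, hi, ← mul_assoc,
            ← d.c_e_comm i (fun h => hi1 (Fin.ext h)), mul_assoc]
          exact MS_c hu _ _ he
      · rw [← mul_assoc, h0, mul_assoc, hj, ← mul_assoc]
        have := MS_rho hu (Cl.g R (Sum.inr j)) _ he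
        rwa [rho_inr, map_mul, tau_nf hu hn, tau_e] at this)
    (by
      rintro (i | j) hi y hy
      · simp only [Submodule.mem_comap, LinearMap.comp_apply, LinearMap.mulLeft_apply,
          AlgHom.toLinearMap_apply, LinearMap.applyₗ_apply_apply, map_mul, Module.End.mul_apply,
          rho_inl] at hy ⊢
        rw [← mul_assoc, ← d.c_e_comm i (fun h => hi (congrArg Sum.inl (Fin.ext h))), mul_assoc]
        exact MS_c hu _ _ hy
      · simp only [Submodule.mem_comap, LinearMap.comp_apply, LinearMap.mulLeft_apply,
          AlgHom.toLinearMap_apply, LinearMap.applyₗ_apply_apply, map_mul, Module.End.mul_apply,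
          rho_inr] at hy ⊢
        have := MS_rho hu (Cl.g R (Sum.inr j)) _ hy
        rwa [rho_inr, map_mul, tau_e, mul_assoc] at this) y
  simpa using this

/-- the subalgebra of elements preserving `MS` from the left -/
def stab (hu : d.IsUniversal) : Subalgebra R A where
  carrier := {b | ∀ x ∈ MS hu, b * x ∈ MS hu}
  mul_mem' ha hb x hx := by rw [mul_assoc]; exact ha _ (hb _ hx)
  add_mem' ha hb x hx := by rw [add_mul]; exact add_mem (ha _ hx) (hb _ hx)
  algebraMap_mem' a x hx := by
    rw [← Algebra.smul_def]; exact Submodule.smul_mem _ _ hx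

theorem lower_MS (hu : d.IsUniversal) (m : ℕ) (b : A) (hb : b ∈ Algebra.adjoin R (d.lowerGens m)) :
    b ∈ MS hu := by
  have h : Algebra.adjoin R (d.lowerGens m) ≤ stab hu := Algebra.adjoin_le (by
    rintro x (⟨-, rfl⟩ | ⟨j, -, -, rfl⟩ | ⟨j, -, -, rfl⟩ | ⟨-, rfl⟩ | ⟨-, rfl⟩)
    · exact MS_e hu
    · exact MS_σ hu _
    · exact MS_σb hu _
    · exact MS_c hu 0
    · exact MS_cb hu)
  have := h hb 1 (MS_nf' hu (isNf_one d))
  simpa using this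

end WF
end

open Polynomial
noncomputable section

namespace WF
open FM

variable {r t : ℕ}
variable {R A : Type} [CommRing R] [Ring A] [Algebra R A]
variable {d : WBC R A (r + 1) (t + 1)} (q : R) (hq : q * 2 = 1)

def phi (hu : d.IsUniversal) : A →ₐ[R] Module.End R (MM R (r + 1) (t + 1)) :=
  (hu _ (XX q hq r t)).choose

theorem phi_hom (hu : d.IsUniversal) : WBCHom d (XX q hq r t) (phi q hq hu) :=
  (hu _ (XX q hq r t)).choose_spec.1

/-- conjugation by an element of square `-1` -/
def conjA {B : Type} [Ring B] [Algebra R B] (Λ : B) (hΛ : Λ * Λ = -1) : B →ₐ[R] B :=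
  AlgHom.ofLinearMap (-(LinearMap.mulLeft R Λ ∘ₗ LinearMap.mulRight R Λ))
    (by simp [hΛ]) (by
      intro a b
      simp only [LinearMap.neg_apply, LinearMap.comp_apply, LinearMap.mulLeft_apply,
        LinearMap.mulRight_apply, neg_mul_neg]
      have : Λ * (a * Λ) * (Λ * (b * Λ)) = Λ * a * (Λ * Λ) * b * Λ := by simp only [mul_assoc]
      rw [this, hΛ]; simp [mul_assoc])

theorem conjA_apply {B : Type} [Ring B] [Algebra R B] (Λ : B) (hΛ : Λ * Λ = -1) (a : B) :
    conjA (R := R) Λ hΛ a = -(Λ * a * Λ) := by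
  simp [conjA, mul_assoc]

theorem conjA_comm {B : Type} [Ring B] [Algebra R B] (Λ : B) (hΛ : Λ * Λ = -1) (a : B)
    (h : Λ * a = a * Λ) : conjA (R := R) Λ hΛ a = a := by
  rw [conjA_apply, h, mul_assoc, hΛ]; simp

theorem conjA_anti {B : Type} [Ring B] [Algebra R B] (Λ : B) (hΛ : Λ * Λ = -1) (a : B)
    (h : Λ * a = -(a * Λ)) : conjA (R := R) Λ hΛ a = -a := by
  rw [conjA_apply, h, neg_mul, mul_assoc, hΛ]; simp

theorem conjA_mul {B : Type} [Ring B] [Algebra R B] (Λ : B) (hΛ : Λ * Λ = -1) (a b : B)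
    (h : b = conjA (R := R) Λ hΛ a) : b * Λ = Λ * a := by
  rw [h, conjA_apply, neg_mul, mul_assoc, hΛ]; simp

theorem Xc_sq (x : II r t) : Xc R r t x * Xc R r t x = -1 := op_ext fun π y => by
    simp only [Module.End.mul_apply, Xc_single, Cl.g_sq', Finsupp.single_neg]; rfl

theorem Xc_anti (x y : II r t) (h : x ≠ y) : Xc R r t x * Xc R r t y = -(Xc R r t y * Xc R r t x) :=
  op_ext fun π z => by
    simp only [Module.End.mul_apply, Xc_single, LinearMap.neg_apply]
    rw [Cl.g_anti' _ _ h, Finsupp.single_neg]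

theorem phi_tau (hu : d.IsUniversal) (j : Fin (t + 1)) (m : A) :
    phi q hq hu (tau hu m) * Xc R _ _ (Sum.inr j) = Xc R _ _ (Sum.inr j) * phi q hq hu m := by
  have key : (phi q hq hu).comp (tau hu) =
      (conjA (Xc R _ _ (Sum.inr j)) (Xc_sq _)).comp (phi q hq hu) := by
    have h := phi_hom q hq hu
    refine (hu _ (neg (XX q hq r t))).unique ?_ ?_
    · constructor <;> intros <;>
        simp [tau_c, tau_cb, tau_σ, tau_σb, tau_e, h.map_σ, h.map_σb, h.map_c, h.map_cb, h.map_e, neg]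
    · constructor
      · intro w
        rw [AlgHom.comp_apply, h.map_σ, conjA_comm]
        · rfl
        · refine op_ext fun π y => ?_
          change Xc R _ _ (Sum.inr j) (Xσ R _ _ w _) = Xσ R _ _ w (Xc R _ _ (Sum.inr j) _)
          simp only [Xc_single, Xσ_single, map_mul, Cl.pm_g, lw_inr]
      · intro w
        rw [AlgHom.comp_apply, h.map_σb, conjA_comm]
        · rfl
        · refine op_ext fun π y => ?_
          change Xc R _ _ (Sum.inr j) (Xσb R _ _ w _) = Xσb R _ _ w (Xc R _ _ (Sum.inr j) _)
          simp only [Xc_single, Xσb_single]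
      · intro i
        rw [AlgHom.comp_apply, h.map_c, conjA_anti]
        · rfl
        · exact Xc_anti _ _ (by simp)
      · intro i
        rw [AlgHom.comp_apply, h.map_cb, conjA_anti]
        · rfl
        · refine op_ext fun π y => ?_
          change Xc R _ _ (Sum.inr j) (Xcb R _ _ i _) = -(Xcb R _ _ i (Xc R _ _ (Sum.inr j) _))
          simp only [Xc_single, Xcb_single, map_mul, Cl.inv_g]
          rw [← Finsupp.single_neg]; simp [mul_assoc]
      · rw [AlgHom.comp_apply, h.map_e, conjA_comm]
        · rfl
        · exact X_c_e q hq _ _ _ (by simp)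
  have h2 := congrArg (fun f : A →ₐ[R] _ => f m) key
  simp only [AlgHom.comp_apply] at h2
  exact conjA_mul _ _ _ _ h2

def Lam (R : Type) [CommRing R] (r t : ℕ) : Cl R (II r t) →ₐ[R] Module.End R (MM R r t) :=
  Cl.lift (Xc R r t) Xc_sq Xc_anti

theorem Lam_single (y : Cl R (II r t)) (π : PP r t) :
    Lam R r t y (Finsupp.single π 1) = Finsupp.single π y := by
  have := Cl.induct (LinearMap.eqLocus ((LinearMap.applyₗ (Finsupp.single π 1)) ∘ₗ (Lam R r t).toLinearMap)
    (Finsupp.lsingle π)) (by simp) (by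
      intro i y hy
      simp [LinearMap.mem_eqLocus] at hy ⊢
      rw [hy]; simp [Lam]) y
  simpa [LinearMap.mem_eqLocus] using this

theorem phi_rho (hu : d.IsUniversal) (y : Cl R (II (r + 1) (t + 1))) (m : A) :
    phi q hq hu (rho hu y m) (Finsupp.single 1 1) =
      Lam R _ _ y (phi q hq hu m (Finsupp.single 1 1)) := by
  have := Cl.induct (LinearMap.eqLocus
    ((LinearMap.applyₗ (Finsupp.single 1 1)) ∘ₗ (phi q hq hu).toLinearMap ∘ₗ
      (LinearMap.applyₗ m) ∘ₗ (rho hu).toLinearMap)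
    ((LinearMap.applyₗ (phi q hq hu m (Finsupp.single 1 1))) ∘ₗ (Lam R _ _).toLinearMap))
    (by simp) (by
      intro i y hy
      simp only [LinearMap.mem_eqLocus, LinearMap.comp_apply, AlgHom.toLinearMap_apply,
        LinearMap.applyₗ_apply_apply, map_mul, Module.End.mul_apply] at hy ⊢
      rw [← hy]
      generalize rho hu y m = z
      have h := phi_hom q hq hu
      have hL : Lam R _ _ (Cl.g R i) = Xc R (r + 1) (t + 1) i := by simp [Lam]
      rw [hL]
      cases i with
      | inl i => rw [rho_inl, map_mul, h.map_c]; rfl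
      | inr j =>
        rw [rho_inr, map_mul, h.map_cb, Module.End.mul_apply]
        have h1 : (XX q hq r t).cb j (Finsupp.single 1 1) =
            Xc R _ _ (Sum.inr j) (Finsupp.single 1 1) := by
          change Xcb R _ _ j _ = _
          simp
        rw [h1, ← Module.End.mul_apply, phi_tau, Module.End.mul_apply]) y
  simpa [LinearMap.mem_eqLocus] using this

open Classical in
def psi (d : WBC R A (r + 1) (t + 1)) (π : PP (r + 1) (t + 1)) : A :=
  if h : ∃ x : LL r t × Equiv.Perm (Fin (r + 1)) × Equiv.Perm (Fin (t + 1)),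
      OK x.1 ∧ D x.2.1 x.2.2 x.1 = π then
    nf d h.choose.1 h.choose.2.1 h.choose.2.2 else 0

theorem psi_D (L : LL r t) (hL : OK L) (g h) : psi d (D g h L) = nf d L g h := by
  have hx : ∃ x : LL r t × Equiv.Perm (Fin (r + 1)) × Equiv.Perm (Fin (t + 1)),
      OK x.1 ∧ D x.2.1 x.2.2 x.1 = D g h L := ⟨(L, g, h), hL, rfl⟩
  rw [psi, dif_pos hx]
  exact nf_unique d hx.choose_spec.1 hL hx.choose_spec.2

def Psi (hu : d.IsUniversal) : MM R (r + 1) (t + 1) →ₗ[R] A :=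
  Finsupp.lsum R (fun π => (LinearMap.applyₗ (psi d π)) ∘ₗ (rho hu).toLinearMap)

theorem Psi_phi (hu : d.IsUniversal) (m : A) (hm : m ∈ MS hu) :
    Psi hu (phi q hq hu m (Finsupp.single 1 1)) = m := by
  have : MS hu ≤ LinearMap.eqLocus
    (Psi hu ∘ₗ (LinearMap.applyₗ (Finsupp.single 1 1)) ∘ₗ (phi q hq hu).toLinearMap) LinearMap.id := by
    refine Submodule.span_le.2 ?_
    rintro _ ⟨y, n, ⟨L, g, h, hL, rfl⟩, rfl⟩
    simp only [SetLike.mem_coe, LinearMap.mem_eqLocus, LinearMap.comp_apply,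
      AlgHom.toLinearMap_apply, LinearMap.applyₗ_apply_apply, LinearMap.id_apply]
    rw [phi_rho, hom_nf (phi_hom q hq hu), Xnf_single q hq L hL, Lam_single]
    simp [Psi, psi_D L hL]
  simpa using this hm

/-- right translation -/
def TT (R : Type) [CommRing R] {r t : ℕ} (s : PP r t) : Module.End R (MM R r t) :=
  Op (fun π => π * s) (fun _ => LinearMap.id)

include q hq in
theorem lower_unique (hu : d.IsUniversal) (m : ℕ) (hm : 1 ≤ m) (h1 : m < r + 1) (h2 : m < t + 1)
    (b : A) (hb : b ∈ Algebra.adjoin R (d.lowerGens m)) (hz : b * ep d ⟨m, h1⟩ ⟨m, h2⟩ = 0) :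
    b = 0 := by
  set s : PP (r + 1) (t + 1) := Equiv.swap (Sum.inl ⟨m, h1⟩) (Sum.inr ⟨m, h2⟩) with hs
  have h := phi_hom q hq hu
  have hm0 : (0 : Fin (t + 1)) ≠ ⟨m, h2⟩ := by
    intro e; have := congrArg Fin.val e; simp at this; omega
  have s0 : s (Sum.inr 0) = Sum.inr 0 := by
    rw [hs, Equiv.swap_apply_of_ne_of_ne (by simp) (by simpa using hm0)]
  have hT : Algebra.adjoin R (d.lowerGens m) ≤
      (Subalgebra.centralizer R {TT R s}).comap (phi q hq hu) := by
    refine Algebra.adjoin_le ?_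
    have sv : ∀ v : Equiv.Perm (Fin (t + 1)), v ⟨m, h2⟩ = ⟨m, h2⟩ →
        s * (rw' (r + 1) v)⁻¹ = (rw' (r + 1) v)⁻¹ * s := by
      intro v hv
      rw [← rw_inv, hs, Equiv.mul_swap_eq_swap_mul]
      congr 2
      simp only [rw_inr]
      rw [Equiv.Perm.inv_eq_iff_eq.2 hv.symm]
    rintro x (⟨-, rfl⟩ | ⟨j, -, -, rfl⟩ | ⟨j, hj1, hj, rfl⟩ | ⟨-, rfl⟩ | ⟨-, rfl⟩) <;>
      simp only [SetLike.mem_coe, Subalgebra.mem_comap, Subalgebra.mem_centralizer_iff,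
        Set.mem_singleton_iff, forall_eq]
    · rw [h.map_e]
      refine op_ext fun π y => ?_
      change TT R s (Xe q (Sum.inl 0) (Sum.inr 0) _) = Xe q (Sum.inl 0) (Sum.inr 0) (TT R s _)
      have e0 : (π * s) (Sum.inr 0) = π (Sum.inr 0) := by rw [Equiv.Perm.mul_apply, s0]
      simp only [TT, Op_single, LinearMap.id_apply]
      by_cases hπ : π (Sum.inr 0) = Sum.inl 0
      · rw [Xe_zero _ _ _ _ _ hπ, Xe_zero _ _ _ _ _ (by rw [e0, hπ]), map_zero]
      · rw [Xe_single _ _ _ _ _ hπ, Xe_single _ _ _ _ _ (by rw [e0]; exact hπ), e0]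
        simp [mul_assoc]
    · rw [WBC.s, h.map_σ]
      refine op_ext fun π y => ?_
      change TT R s (Xσ R _ _ _ _) = Xσ R _ _ _ (TT R s _)
      simp [TT, mul_assoc]
    · rw [WBC.sb, h.map_σb]
      refine op_ext fun π y => ?_
      change TT R s (Xσb R _ _ _ _) = Xσb R _ _ _ (TT R s _)
      simp only [TT, Xσb_single, Op_single, LinearMap.id_apply, mul_assoc]
      rw [sv]
      rw [sw_eq _ _ _ (by omega) (by omega)]
      apply Equiv.swap_apply_of_ne_of_ne
      · intro e; have := congrArg Fin.val e; simp at this; omega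
      · intro e; have := congrArg Fin.val e; simp at this; omega
    · have : d.cn 1 = d.c 0 := by simp [WBC.cn]
      rw [this, h.map_c]
      refine op_ext fun π y => ?_
      change TT R s (Xc R _ _ (Sum.inl 0) _) = Xc R _ _ (Sum.inl 0) (TT R s _)
      simp only [TT, Op_single, Xc_single, LinearMap.id_apply]
    · have : d.cbn 1 = d.cb 0 := by simp [WBC.cbn]
      rw [this, h.map_cb]
      refine op_ext fun π y => ?_
      change TT R s (Xcb R _ _ 0 _) = Xcb R _ _ 0 (TT R s _)
      simp only [TT, Op_single, Xcb_single, LinearMap.id_apply, Equiv.Perm.mul_apply, s0]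
  have hc := hT hb
  simp only [Subalgebra.mem_comap, Subalgebra.mem_centralizer_iff,
        Set.mem_singleton_iff, forall_eq] at hc
  have h3 := congrArg (fun a => phi q hq hu a (Finsupp.single 1 1)) hz
  simp only [map_mul, map_zero, Module.End.mul_apply, hom_ep h, LinearMap.zero_apply] at h3
  rw [Xep_single q hq _ _ _ (by simp)] at h3
  have h4 : (Finsupp.single (Equiv.swap (Sum.inl ⟨m, h1⟩) ((1 : PP (r + 1) (t + 1)) (Sum.inr ⟨m, h2⟩)) * 1) 1 : MM R (r + 1) (t + 1)) = TT R s (Finsupp.single 1 1) := by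
    simp [TT, hs]
  rw [h4, ← Module.End.mul_apply, ← hc] at h3
  have h5 : TT R s * TT R s = 1 := op_ext fun π y => by simp [TT, mul_assoc, hs]
  have h6 := congrArg (TT R s) h3
  rw [← Module.End.mul_apply, ← mul_assoc, h5, one_mul, map_zero] at h6
  rw [← Psi_phi q hq hu b (lower_MS hu m b hb), h6, map_zero]

end WF
end

open Polynomial
noncomputable section

namespace WF
open FM

/-! ### Auxiliary identities in a ring -/
section ringlemmas
variable {B : Type} [Ring B]

theorem mz {a b w : B} (h : a * b = w) (z : B) : a * (b * z) = w * z := by rw [← mul_assoc, h]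

theorem A1 (c b e : B) (hcc : c * c = -1) (hbb : b * b = 1) (hcb : c * b = -(b * c))
    (h1 : c * e = b * e) (h2 : e * c = e * b) :
    c * (e + c * e * c) = -((e + c * e * c) * c) ∧ b * (e + c * e * c) = (e + c * e * c) * b ∧
    c * (e - c * e * c) = (e - c * e * c) * c ∧ b * (e - c * e * c) = -((e - c * e * c) * b) := by
  have k1 : c * (c * e * c) = -(e * c) := by
    simp only [mul_assoc]; rw [mz hcc]; simp
  have k2 : c * e * c * c = -(c * e) := by rw [mul_assoc, hcc]; simp
  have hbc : b * c = -(c * b) := by rw [hcb, neg_neg]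
  have k3 : b * (c * e * c) = e * c := by
    rw [mul_assoc, mz hbc, neg_mul, mul_assoc, mz h1.symm, mul_assoc, mz hcc]; simp
  have k4 : c * e * c * b = c * e := by
    rw [mul_assoc c e c, h2, mul_assoc, mul_assoc, hbb, mul_one]
  refine ⟨?_, ?_, ?_, ?_⟩
  · rw [mul_add, add_mul, k1, k2]; abel
  · rw [mul_add, add_mul, k3, k4, ← h1, ← h2]; abel
  · rw [mul_sub, sub_mul, k1, k2]; abel
  · rw [mul_sub, sub_mul, k3, k4, ← h1, ← h2]; abel

theorem A2 (c e z : B) (hz : z * e = e * z) (hc : z * c = -(c * z)) :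
    z * (c * e * c) = c * e * c * z := by
  rw [mul_assoc, mz hc, neg_mul, mul_assoc, mz hz, mul_assoc, hc]; simp [mul_assoc]

theorem A2' (c e z : B) (hz : z * e = e * z) (hc : z * c = c * z) :
    z * (c * e * c) = c * e * c * z := by
  rw [mul_assoc, mz hc, mul_assoc, mz hz, mul_assoc, hc]; simp [mul_assoc]

theorem A3 (a c s : B) (haa : a * a = -1) (hcc : c * c = -1) (hac : a * c = -(c * a))
    (h1 : s * a = c * s) (h2 : s * c = a * s) :
    a * (s + c * s * c) = (s + c * s * c) * a ∧ c * (s + c * s * c) = -((s + c * s * c) * c) := by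
  have k1 : a * (c * s * c) = c * s := by
    rw [mul_assoc, mz hac, neg_mul, mul_assoc, mz h2.symm, mul_assoc, hcc]; simp
  have k2 : c * s * c * a = s * c := by
    have : c * a = -(a * c) := by rw [hac, neg_neg]
    rw [mul_assoc, this, mul_neg, mul_assoc, mz h1, mul_assoc, mz hcc]; simp
  have k3 : c * (c * s * c) = -(s * c) := by
    simp only [mul_assoc]; rw [mz hcc]; simp
  have k4 : c * s * c * c = -(c * s) := by rw [mul_assoc, hcc]; simp
  constructor
  · rw [mul_add, add_mul, k1, k2, h1, h2]; abel
  · rw [mul_add, add_mul, k3, k4]; abel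

theorem A4 (a c s : B) (haa : a * a = 1) (hcc : c * c = 1) (hac : a * c = -(c * a))
    (h1 : s * a = c * s) (h2 : s * c = a * s) :
    a * (s - c * s * c) = (s - c * s * c) * a ∧ c * (s - c * s * c) = -((s - c * s * c) * c) := by
  have k1 : a * (c * s * c) = -(c * s) := by
    rw [mul_assoc, mz hac, neg_mul, mul_assoc, mz h2.symm, mul_assoc, hcc]; simp
  have k2 : c * s * c * a = -(s * c) := by
    have : c * a = -(a * c) := by rw [hac, neg_neg]
    rw [mul_assoc, this, mul_neg, mul_assoc, mz h1, mul_assoc, mz hcc]; simp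
  have k3 : c * (c * s * c) = (s * c) := by
    simp only [mul_assoc]; rw [mz hcc]; simp
  have k4 : c * s * c * c = (c * s) := by rw [mul_assoc, hcc]; simp
  constructor
  · rw [mul_sub, sub_mul, k1, k2, h1, h2]; abel
  · rw [mul_sub, sub_mul, k3, k4]; abel

theorem B1 (E F s c b : B) (h1 : E * F = E * s) (h2 : E * c = E * b) (h3 : b * F = F * b)
    (h4 : c * b = -(b * c)) (h5 : s * c = c * s) :
    E * (F + c * F * c) = E * (s - b * s * b) := by
  have hbc : b * c = -(c * b) := by rw [h4, neg_neg]
  have k : E * (c * F * c) = -(E * (b * s * b)) := by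
    rw [mul_assoc, mz h2, mul_assoc, mz h3, mul_assoc F, mz h1, mul_assoc, hbc, mul_neg, mz h5,
      mul_neg, mul_assoc c, mz h2, mul_assoc, mul_assoc]
  rw [mul_add, mul_sub, k, h1]; abel

theorem B1' (E F s c b : B) (h1 : F * E = s * E) (h2 : c * E = b * E) (h3 : b * F = F * b)
    (h4 : c * b = -(b * c)) (h5 : s * c = c * s) :
    (F + c * F * c) * E = (s - b * s * b) * E := by
  have k : c * F * c * E = -(b * s * b * E) := by
    simp only [mul_assoc]
    rw [h2, mz h3.symm, mul_assoc, h1, mz h4, neg_mul, mul_assoc, mz h5.symm, mul_assoc, h2]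
  rw [add_mul, sub_mul, k, h1]; abel

theorem B2 (E F s c c' b : B) (h1 : E * F = E * s) (h2 : E * c = E * b) (h3 : c * F = F * c)
    (h4 : c' * F = b * F) (h5 : s * c = c' * s) (h5' : s * c' = c * s) (h6 : c * c' = -(c' * c)) :
    E * (F - c' * F * c') = E * (s + c * s * c) := by
  have k : E * (c' * F * c') = -(E * (c * s * c)) := by
    rw [h4, mul_assoc b, mz h2.symm, mul_assoc, mz h3, mul_assoc F, mz h1, mul_assoc, h6, mul_neg,
      mz h5', mul_neg, mul_assoc c]
  rw [mul_add, mul_sub, k, h1]; abel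

theorem B2' (E F s c c' b : B) (h1 : F * E = s * E) (h2 : c * E = b * E) (h3 : c * F = F * c)
    (h4 : F * c' = F * b) (h5 : s * c = c' * s) (h5' : s * c' = c * s) (h6 : c * c' = -(c' * c)) :
    (F - c' * F * c') * E = (s + c * s * c) * E := by
  have h6' : c' * c = -(c * c') := by rw [h6, neg_neg]
  have k : c' * F * c' * E = -(c * s * c * E) := by
    simp only [mul_assoc]
    rw [mz h4, mul_assoc, ← h2, mz h3.symm, mul_assoc, h1, mz h6', neg_mul, mul_assoc, mz h5.symm,
      mul_assoc]
  rw [add_mul, sub_mul, k, h1]; abel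

theorem B3 (E F s c b b' : B) (h1 : E * F = E * s) (h2 : E * c = E * b) (h3 : b * F = F * b)
    (h4 : c * b = -(b * c)) (h5 : s * c = c * s) (h6 : b * b' = -(b' * b)) (h7 : b * s = s * b')
    (h8 : b' * s = s * b) :
    E * (F - c * F * c) = E * (s - b' * s * b') := by
  have h := B1 E F s c b h1 h2 h3 h4 h5
  have e : b' * s * b' = -(b * s * b) := by
    rw [h8, mul_assoc, h6, mul_neg, ← mul_assoc, ← h7]
  rw [e]
  rw [mul_add, mul_sub, h1] at h
  have h' := add_left_cancel (h.trans (sub_eq_add_neg _ _))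
  rw [mul_sub, mul_sub, h1, h', mul_neg]

theorem B3' (E F s c b b' : B) (h1 : F * E = s * E) (h2 : c * E = b * E) (h3 : b * F = F * b)
    (h4 : c * b = -(b * c)) (h5 : s * c = c * s) (h6 : b * b' = -(b' * b)) (h7 : b * s = s * b')
    (h8 : b' * s = s * b) :
    (F - c * F * c) * E = (s - b' * s * b') * E := by
  have h := B1' E F s c b h1 h2 h3 h4 h5
  have e : b' * s * b' = -(b * s * b) := by
    rw [h8, mul_assoc, h6, mul_neg, ← mul_assoc, ← h7]
  rw [e]
  rw [add_mul, sub_mul, h1] at h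
  have h' := add_left_cancel (h.trans (sub_eq_add_neg _ _))
  rw [sub_mul, sub_mul, h1, h', neg_mul]

theorem B4 (E F s c : B) (h1 : E * F = E * s) (h2 : c * E = E * c) :
    E * (F + c * F * c) = E * (s + c * s * c) := by
  have k : E * (c * F * c) = E * (c * s * c) := by
    rw [mul_assoc, mz h2.symm, mul_assoc, mz h1]
    simp only [mul_assoc]; rw [mz h2.symm]; simp only [mul_assoc]
  rw [mul_add, mul_add, k, h1]

theorem B4' (E F s c : B) (h1 : F * E = s * E) (h2 : c * E = E * c) :
    (F + c * F * c) * E = (s + c * s * c) * E := by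
  have k : (c * F * c) * E = (c * s * c) * E := by
    simp only [mul_assoc]; rw [h2, mz h1, mul_assoc]
  rw [add_mul, add_mul, k, h1]

theorem B5 (E s c b : B) (h1 : E * s * E = E) (h2 : E * c = E * b) (h2' : c * E = b * E)
    (hcc : c * c = -1) (h5 : s * c = c * s) : E * (s - b * s * b) * E = E + E := by
  have k : E * (b * s * b) * E = -E := by
    have : E * (b * s * b) * E = (E * b) * (s * (b * E)) := by simp only [mul_assoc]
    rw [this, ← h2, ← h2', mz h5, mul_assoc E, ← mul_assoc c, ← mul_assoc c, hcc]
    rw [neg_one_mul, neg_mul, mul_neg, ← mul_assoc, h1]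
  rw [mul_sub, sub_mul, k, h1]; abel

theorem B6 (E s c b : B) (h1 : E * s * E = E) (h2 : E * c = E * b) (h2' : c * E = b * E)
    (hbb : b * b = 1) (h5 : s * b = b * s) : E * (s + c * s * c) * E = E + E := by
  have k : E * (c * s * c) * E = E := by
    have : E * (c * s * c) * E = (E * c) * (s * (c * E)) := by simp only [mul_assoc]
    rw [this, h2, h2', mz h5, mul_assoc E, ← mul_assoc b, ← mul_assoc b, hbb]
    rw [one_mul, ← mul_assoc, h1]
  rw [mul_add, add_mul, k, h1]

theorem comm_split {ι κ : Type} [DecidableEq ι] [DecidableEq κ] (s : Finset ι) (s' : Finset κ)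
    (f : ι → B) (g : κ → B) (a : ι) (b : κ) (ha : a ∈ s) (hb : b ∈ s') (z : B)
    (h1 : z * f a = z * g b) (h2 : f a * z = g b * z)
    (hf : ∀ j ∈ s, j ≠ a → z * f j = f j * z) (hg : ∀ j ∈ s', j ≠ b → z * g j = g j * z) :
    z * (∑ j ∈ s, f j - ∑ j ∈ s', g j) = (∑ j ∈ s, f j - ∑ j ∈ s', g j) * z := by
  rw [← Finset.add_sum_erase s f ha, ← Finset.add_sum_erase s' g hb]
  have e1 : z * ∑ j ∈ s.erase a, f j = (∑ j ∈ s.erase a, f j) * z := by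
    rw [Finset.mul_sum, Finset.sum_mul]
    exact Finset.sum_congr rfl fun j hj => hf j (Finset.mem_of_mem_erase hj) (Finset.ne_of_mem_erase hj)
  have e2 : z * ∑ j ∈ s'.erase b, g j = (∑ j ∈ s'.erase b, g j) * z := by
    rw [Finset.mul_sum, Finset.sum_mul]
    exact Finset.sum_congr rfl fun j hj => hg j (Finset.mem_of_mem_erase hj) (Finset.ne_of_mem_erase hj)
  rw [mul_sub, mul_add, mul_add, sub_mul, add_mul, add_mul, e1, e2, h1, h2]; abel

theorem comm_perm {ι : Type} (s : Finset ι) (f : ι → B) (w : Equiv.Perm ι) (hw : ∀ i, i ∈ s ↔ w i ∈ s)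
    (z : B) (h : ∀ i ∈ s, z * f i = f (w i) * z) : z * ∑ i ∈ s, f i = (∑ i ∈ s, f i) * z := by
  rw [Finset.mul_sum, Finset.sum_mul]
  exact Finset.sum_equiv w hw h

theorem comm_sum {ι : Type} (s : Finset ι) (f : ι → B)
    (z : B) (h : ∀ i ∈ s, z * f i = f i * z) : z * ∑ i ∈ s, f i = (∑ i ∈ s, f i) * z := by
  rw [Finset.mul_sum, Finset.sum_mul]
  exact Finset.sum_congr rfl h

theorem anti_sum {ι : Type} (s : Finset ι) (f : ι → B)
    (z : B) (h : ∀ i ∈ s, z * f i = -(f i * z)) : z * ∑ i ∈ s, f i = -((∑ i ∈ s, f i) * z) := by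
  rw [Finset.mul_sum, Finset.sum_mul, ← Finset.sum_neg_distrib]
  exact Finset.sum_congr rfl h

theorem comm_sub {z a b : B} (h1 : z * a = a * z) (h2 : z * b = b * z) :
    z * (a - b) = (a - b) * z := by rw [mul_sub, sub_mul, h1, h2]

theorem comm_addd {z a b : B} (h1 : z * a = a * z) (h2 : z * b = b * z) :
    z * (a + b) = (a + b) * z := by rw [mul_add, add_mul, h1, h2]

end ringlemmas

end WF
end

open Polynomial
noncomputable section

namespace WF
open FM

variable {R A : Type} [CommRing R] [Ring A] [Algebra R A] {r t : ℕ}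

/-! ### The Jucys-Murphy type elements in terms of `Fin` indices -/

def Pp (d : WBC R A (r+1) (t+1)) (i : Fin (r+1)) (j : Fin (t+1)) : A :=
  ep d i j + d.c i * ep d i j * d.c i
def Mm (d : WBC R A (r+1) (t+1)) (i : Fin (r+1)) (j : Fin (t+1)) : A :=
  ep d i j - d.c i * ep d i j * d.c i
def Ss (d : WBC R A (r+1) (t+1)) (i k : Fin (r+1)) : A :=
  d.σ (Equiv.swap i k) + d.c k * d.σ (Equiv.swap i k) * d.c k
def Sb (d : WBC R A (r+1) (t+1)) (j k : Fin (t+1)) : A :=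
  d.σb (Equiv.swap j k) - d.cb k * d.σb (Equiv.swap j k) * d.cb k
def xe (d : WBC R A (r+1) (t+1)) (K : Fin (r+1)) (K' : Fin (t+1)) : A :=
  ∑ j ∈ Finset.Iio K', Pp d K j - ∑ i ∈ Finset.Iio K, Ss d i K
def xbe (d : WBC R A (r+1) (t+1)) (K : Fin (r+1)) (K' : Fin (t+1)) : A :=
  ∑ i ∈ Finset.Iio K, Mm d i K' - ∑ j ∈ Finset.Iio K', Sb d j K'
def Ze (d : WBC R A (r+1) (t+1)) (K : Fin (r+1)) (K' : Fin (t+1)) : A :=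
  ∑ i ∈ Finset.Iic K, Mm d i K' - ∑ j ∈ Finset.Iio K', Sb d j K'

variable (d : WBC R A (r+1) (t+1))

theorem σ_swap_conj (w : Equiv.Perm (Fin (r+1))) (i k : Fin (r+1)) :
    d.σ w * d.σ (Equiv.swap i k) = d.σ (Equiv.swap (w i) (w k)) * d.σ w := by
  rw [← map_mul, ← map_mul, ← Equiv.mul_swap_eq_swap_mul]

theorem σb_swap_conj (w : Equiv.Perm (Fin (t+1))) (i k : Fin (t+1)) :
    d.σb w * d.σb (Equiv.swap i k) = d.σb (Equiv.swap (w i) (w k)) * d.σb w := by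
  rw [← map_mul, ← map_mul, ← Equiv.mul_swap_eq_swap_mul]

theorem conj3 {B : Type} [Ring B] {z a b c a' b' c' : B} (h1 : z * a = a' * z) (h2 : z * b = b' * z)
    (h3 : z * c = c' * z) : z * (a * b * c) = a' * b' * c' * z := by
  rw [mul_assoc, mz h1, mul_assoc, mz h2, mul_assoc, h3]; simp only [mul_assoc]

theorem σ_Pp (w i j) : d.σ w * Pp d i j = Pp d (w i) j * d.σ w := by
  rw [Pp, Pp, mul_add, add_mul, σ_ep, conj3 (σ_c d w i) (σ_ep d w i j) (σ_c d w i)]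
theorem σ_Mm (w i j) : d.σ w * Mm d i j = Mm d (w i) j * d.σ w := by
  rw [Mm, Mm, mul_sub, sub_mul, σ_ep, conj3 (σ_c d w i) (σ_ep d w i j) (σ_c d w i)]
theorem σb_Pp (w i j) : d.σb w * Pp d i j = Pp d i (w j) * d.σb w := by
  rw [Pp, Pp, mul_add, add_mul, σb_ep, conj3 (d.comm_σbc w i) (σb_ep d w i j) (d.comm_σbc w i)]
theorem σb_Mm (w i j) : d.σb w * Mm d i j = Mm d i (w j) * d.σb w := by
  rw [Mm, Mm, mul_sub, sub_mul, σb_ep, conj3 (d.comm_σbc w i) (σb_ep d w i j) (d.comm_σbc w i)]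
theorem σ_Ss (w i k) : d.σ w * Ss d i k = Ss d (w i) (w k) * d.σ w := by
  rw [Ss, Ss, mul_add, add_mul, σ_swap_conj,
    conj3 (σ_c d w k) (σ_swap_conj d w i k) (σ_c d w k)]
theorem σb_Ss (w i k) : d.σb w * Ss d i k = Ss d i k * d.σb w := by
  rw [Ss, mul_add, add_mul, ← d.comm_σσb,
    conj3 (d.comm_σbc w k) (d.comm_σσb (Equiv.swap i k) w).symm (d.comm_σbc w k)]
theorem σb_Sb (w i k) : d.σb w * Sb d i k = Sb d (w i) (w k) * d.σb w := by
  rw [Sb, Sb, mul_sub, sub_mul, σb_swap_conj,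
    conj3 (σb_cb d w k) (σb_swap_conj d w i k) (σb_cb d w k)]
theorem σ_Sb (w i k) : d.σ w * Sb d i k = Sb d i k * d.σ w := by
  rw [Sb, mul_sub, sub_mul, d.comm_σσb,
    conj3 (d.comm_σcb w k) (d.comm_σσb w (Equiv.swap i k)) (d.comm_σcb w k)]

theorem c_σ_fix (w : Equiv.Perm (Fin (r+1))) (l) (h : w l = l) : d.c l * d.σ w = d.σ w * d.c l := by
  rw [σ_c, h]
theorem cb_σb_fix (w : Equiv.Perm (Fin (t+1))) (l) (h : w l = l) :
    d.cb l * d.σb w = d.σb w * d.cb l := by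
  rw [σb_cb, h]
theorem cb_c (l i) : d.cb l * d.c i = -(d.c i * d.cb l) := by rw [d.anti_ccb, neg_neg]

theorem c_Pp (l i j) (h : l ≠ i) : d.c l * Pp d i j = Pp d i j * d.c l :=
  comm_addd (c_ep d l i j h) (A2 _ _ _ (c_ep d l i j h) (d.c_anti l i h))
theorem c_Mm (l i j) (h : l ≠ i) : d.c l * Mm d i j = Mm d i j * d.c l :=
  comm_sub (c_ep d l i j h) (A2 _ _ _ (c_ep d l i j h) (d.c_anti l i h))
theorem cb_Pp (l i j) (h : l ≠ j) : d.cb l * Pp d i j = Pp d i j * d.cb l :=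
  comm_addd (cb_ep d l i j h) (A2 _ _ _ (cb_ep d l i j h) (cb_c d l i))
theorem c_Ss (l i k) (h : l ≠ i) (h' : l ≠ k) : d.c l * Ss d i k = Ss d i k * d.c l :=
  comm_addd (c_σ_fix d _ _ (Equiv.swap_apply_of_ne_of_ne h h'))
    (A2 _ _ _ (c_σ_fix d _ _ (Equiv.swap_apply_of_ne_of_ne h h')) (d.c_anti l k h'))
theorem cb_Ss (l i k) : d.cb l * Ss d i k = Ss d i k * d.cb l :=
  comm_addd (d.comm_σcb _ _).symm (A2 _ _ _ (d.comm_σcb _ _).symm (cb_c d l k))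
theorem c_Sb (l i k) : d.c l * Sb d i k = Sb d i k * d.c l :=
  comm_sub (d.comm_σbc _ _).symm (A2 _ _ _ (d.comm_σbc _ _).symm (d.anti_ccb l k))

theorem ep_Pp (i j k l) (h : i ≠ k) (h' : j ≠ l) : ep d i j * Pp d k l = Pp d k l * ep d i j :=
  comm_addd (ep_comm d i k j l h h') (A2' _ _ _ (ep_comm d i k j l h h') (c_ep d k i j h.symm).symm)
theorem ep_Mm (i j k l) (h : i ≠ k) (h' : j ≠ l) : ep d i j * Mm d k l = Mm d k l * ep d i j :=
  comm_sub (ep_comm d i k j l h h') (A2' _ _ _ (ep_comm d i k j l h h') (c_ep d k i j h.symm).symm)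
theorem ep_σ_fix (w : Equiv.Perm (Fin (r+1))) (i j) (h : w i = i) :
    ep d i j * d.σ w = d.σ w * ep d i j := by rw [σ_ep, h]
theorem ep_σb_fix (w : Equiv.Perm (Fin (t+1))) (i j) (h : w j = j) :
    ep d i j * d.σb w = d.σb w * ep d i j := by rw [σb_ep, h]
theorem ep_Ss (i j k l) (h : i ≠ k) (h' : i ≠ l) : ep d i j * Ss d k l = Ss d k l * ep d i j :=
  comm_addd (ep_σ_fix d _ i j (Equiv.swap_apply_of_ne_of_ne h h'))
    (A2' _ _ _ (ep_σ_fix d _ i j (Equiv.swap_apply_of_ne_of_ne h h')) (c_ep d l i j h'.symm).symm)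
theorem ep_Sb (i j k l) (h : j ≠ k) (h' : j ≠ l) : ep d i j * Sb d k l = Sb d k l * ep d i j :=
  comm_sub (ep_σb_fix d _ i j (Equiv.swap_apply_of_ne_of_ne h h'))
    (A2' _ _ _ (ep_σb_fix d _ i j (Equiv.swap_apply_of_ne_of_ne h h')) (cb_ep d l i j h'.symm).symm)

section KK
variable (K : Fin (r+1)) (K' : Fin (t+1))

theorem swap_c_right (i K : Fin (r+1)) : d.σ (Equiv.swap i K) * d.c K = d.c i * d.σ (Equiv.swap i K) := by
  rw [σ_c, Equiv.swap_apply_right]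
theorem swap_c_left (i K : Fin (r+1)) : d.σ (Equiv.swap i K) * d.c i = d.c K * d.σ (Equiv.swap i K) := by
  rw [σ_c, Equiv.swap_apply_left]
theorem swap_cb_right (i K : Fin (t+1)) : d.σb (Equiv.swap i K) * d.cb K = d.cb i * d.σb (Equiv.swap i K) := by
  rw [σb_cb, Equiv.swap_apply_right]
theorem swap_cb_left (i K : Fin (t+1)) : d.σb (Equiv.swap i K) * d.cb i = d.cb K * d.σb (Equiv.swap i K) := by
  rw [σb_cb, Equiv.swap_apply_left]

/-! commutation with generators -/
theorem e_xe (hK : 0 < K) (hK' : 0 < K') : ep d 0 0 * xe d K K' = xe d K K' * ep d 0 0 := by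
  refine comm_split (Finset.Iio K') (Finset.Iio K) (fun j => Pp d K j) (fun i => Ss d i K) 0 0
    (by simpa using hK') (by simpa using hK) _ ?_ ?_ ?_ ?_
  · exact B4 _ _ _ _ (ep_ep_a d 0 K 0 hK.ne) (c_ep d K 0 0 hK.ne')
  · refine B4' _ _ _ _ ?_ (c_ep d K 0 0 hK.ne')
    rw [ep_ep_a' d K 0 0 hK.ne', Equiv.swap_comm]
  · intro j _ hj; exact ep_Pp d 0 0 K j hK.ne hj.symm
  · intro i _ hi; exact ep_Ss d 0 0 i K hi.symm hK.ne

theorem σ_xe (w : Equiv.Perm (Fin (r+1))) (hw : w K = K) (hw' : ∀ i, i < K ↔ w i < K) :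
    d.σ w * xe d K K' = xe d K K' * d.σ w := by
  refine comm_sub (comm_sum _ _ _ ?_) (comm_perm _ _ w (by simpa using hw') _ ?_)
  · intro j _; rw [σ_Pp, hw]
  · intro i _; rw [σ_Ss, hw]

theorem σb_xe (w : Equiv.Perm (Fin (t+1))) (hw' : ∀ i, i < K' ↔ w i < K') :
    d.σb w * xe d K K' = xe d K K' * d.σb w := by
  refine comm_sub (comm_perm _ _ w (by simpa using hw') _ ?_) (comm_sum _ _ _ ?_)
  · intro j _; rw [σb_Pp]
  · intro i _; rw [σb_Ss]

theorem c_xe (hK : 0 < K) : d.c 0 * xe d K K' = xe d K K' * d.c 0 := by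
  refine comm_sub (comm_sum _ _ _ ?_) (comm_sum _ _ _ ?_)
  · intro j _; exact c_Pp d 0 K j hK.ne
  · intro i _
    by_cases hi : i = 0
    · subst hi
      exact (A3 _ _ _ (d.c_sq 0) (d.c_sq K) (d.c_anti 0 K hK.ne) (swap_c_left d 0 K)
        (swap_c_right d 0 K)).1
    · exact c_Ss d 0 i K (Ne.symm hi) hK.ne

theorem cb_Pp' (l i j) : d.cb l * Pp d i j = Pp d i j * d.cb l := by
  by_cases h : l = j
  · subst h
    exact (A1 _ _ _ (d.c_sq i) (d.cb_sq l) (d.anti_ccb i l) (c_ep_cb d i l) (ep_c_cb d i l)).2.1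
  · exact cb_Pp d l i j h

theorem cb_xe (l) : d.cb l * xe d K K' = xe d K K' * d.cb l :=
  comm_sub (comm_sum _ _ _ fun j _ => cb_Pp' d l K j) (comm_sum _ _ _ fun i _ => cb_Ss d l i K)

theorem cK_xe : d.c K * xe d K K' = -(xe d K K' * d.c K) := by
  rw [xe, mul_sub, sub_mul, anti_sum, anti_sum]
  · abel
  · intro i hi
    have hi' : i ≠ K := (Finset.mem_Iio.1 hi).ne
    exact (A3 _ _ _ (d.c_sq i) (d.c_sq K) (d.c_anti i K hi') (swap_c_left d i K)
        (swap_c_right d i K)).2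
  · intro j _
    exact (A1 _ _ _ (d.c_sq K) (d.cb_sq j) (d.anti_ccb K j) (c_ep_cb d K j) (ep_c_cb d K j)).1

theorem c_Mm' (l i j) : d.c l * Mm d i j = Mm d i j * d.c l := by
  by_cases h : l = i
  · subst h
    exact (A1 _ _ _ (d.c_sq l) (d.cb_sq j) (d.anti_ccb l j) (c_ep_cb d l j) (ep_c_cb d l j)).2.2.1
  · exact c_Mm d l i j h

theorem c_xbe (l) : d.c l * xbe d K K' = xbe d K K' * d.c l :=
  comm_sub (comm_sum _ _ _ fun i _ => c_Mm' d l i K') (comm_sum _ _ _ fun j _ => c_Sb d l j K')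

theorem c_Ze (l) : d.c l * Ze d K K' = Ze d K K' * d.c l :=
  comm_sub (comm_sum _ _ _ fun i _ => c_Mm' d l i K') (comm_sum _ _ _ fun j _ => c_Sb d l j K')

theorem σ_Ze (w : Equiv.Perm (Fin (r+1))) (hw' : ∀ i, i ≤ K ↔ w i ≤ K) :
    d.σ w * Ze d K K' = Ze d K K' * d.σ w := by
  refine comm_sub (comm_perm _ _ w (by simpa using hw') _ ?_) (comm_sum _ _ _ ?_)
  · intro j _; rw [σ_Mm]
  · intro i _; rw [σ_Sb]

theorem ep_Ze (j) (hj : j < K') : ep d K j * Ze d K K' = Ze d K K' * ep d K j := by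
  refine comm_split (Finset.Iic K) (Finset.Iio K') (fun i => Mm d i K') (fun j => Sb d j K') K j
    (by simp) (by simpa using hj) _ ?_ ?_ ?_ ?_
  · exact B3 _ _ _ _ (d.cb j) _ (ep_ep_b d K j K' hj.ne) (ep_c_cb d K j) (cb_ep d j K K' hj.ne)
      (d.anti_ccb K j) (d.comm_σbc _ _) (d.cb_anti j K' hj.ne) (swap_cb_right d j K').symm
      (swap_cb_left d j K').symm
  · refine B3' _ _ _ _ (d.cb j) _ ?_ (c_ep_cb d K j) (cb_ep d j K K' hj.ne)
      (d.anti_ccb K j) (d.comm_σbc _ _) (d.cb_anti j K' hj.ne) (swap_cb_right d j K').symm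
      (swap_cb_left d j K').symm
    rw [ep_ep_b' d K K' j hj.ne', Equiv.swap_comm]
  · intro i _ hi; exact ep_Mm d K j i K' hi.symm hj.ne
  · intro i _ hi; exact ep_Sb d K j i K' hi.symm hj.ne

theorem comm_mul3 {B : Type} [Ring B] {z a b c : B} (h1 : a * z = z * a) (h2 : b * z = z * b)
    (h3 : c * z = z * c) : z * (a * b * c) = a * b * c * z := conj3 h1.symm h2.symm h3.symm

theorem swap_le (i K x : Fin (r+1)) (hi : i ≤ K) : x ≤ K ↔ Equiv.swap i K x ≤ K := by
  rcases eq_or_ne x i with rfl | h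
  · simp [hi]
  rcases eq_or_ne x K with rfl | h'
  · simp [hi]
  rw [Equiv.swap_apply_of_ne_of_ne h h']

theorem xe_Ze : Ze d K K' * xe d K K' = xe d K K' * Ze d K K' := by
  refine comm_sub (comm_sum _ _ _ ?_) (comm_sum _ _ _ ?_)
  · intro j hj
    have h := ep_Ze d K K' j (Finset.mem_Iio.1 hj)
    exact comm_addd h.symm (comm_mul3 (c_Ze d K K' K) h (c_Ze d K K' K))
  · intro i hi
    have h := σ_Ze d K K' (Equiv.swap i K) (fun x => swap_le i K x (Finset.mem_Iio.1 hi).le)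
    exact comm_addd h.symm (comm_mul3 (c_Ze d K K' K) h (c_Ze d K K' K))

theorem Ze_eq : Ze d K K' = xbe d K K' + Mm d K K' := by
  rw [Ze, xbe, ← Finset.Iio_insert, Finset.sum_insert (by simp)]; abel

theorem ep_Pp_Sb (j) (hj : j < K') : ep d K K' * Pp d K j = ep d K K' * Sb d j K' := by
  refine B1 _ _ _ _ _ ?_ (ep_c_cb d K K') (cb_ep d K' K j hj.ne') (d.anti_ccb K K') (d.comm_σbc _ _)
  rw [ep_ep_b d K K' j hj.ne', Equiv.swap_comm]
theorem Pp_ep_Sb (j) (hj : j < K') : Pp d K j * ep d K K' = Sb d j K' * ep d K K' := by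
  refine B1' _ _ _ _ _ ?_ (c_ep_cb d K K') (cb_ep d K' K j hj.ne') (d.anti_ccb K K') (d.comm_σbc _ _)
  rw [ep_ep_b' d K j K' hj.ne]
theorem ep_Mm_Ss (i) (hi : i < K) : ep d K K' * Mm d i K' = ep d K K' * Ss d i K := by
  refine B2 _ _ _ _ _ (d.cb K') ?_ (ep_c_cb d K K') (c_ep d K i K' hi.ne') (c_ep_cb d i K')
    (swap_c_right d i K) (swap_c_left d i K) (d.c_anti K i hi.ne')
  rw [ep_ep_a d K i K' hi.ne', Equiv.swap_comm]
theorem Mm_ep_Ss (i) (hi : i < K) : Mm d i K' * ep d K K' = Ss d i K * ep d K K' := by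
  refine B2' _ _ _ _ _ (d.cb K') ?_ (c_ep_cb d K K') (c_ep d K i K' hi.ne') (ep_c_cb d i K')
    (swap_c_right d i K) (swap_c_left d i K) (d.c_anti K i hi.ne')
  rw [ep_ep_a' d i K K' hi.ne]

theorem ep_xsum : ep d K K' * (xe d K K' + xbe d K K') = 0 := by
  rw [xe, xbe, mul_add, mul_sub, mul_sub, Finset.mul_sum, Finset.mul_sum, Finset.mul_sum,
    Finset.mul_sum, Finset.sum_congr rfl fun j hj => ep_Pp_Sb d K K' j (Finset.mem_Iio.1 hj),
    Finset.sum_congr rfl fun j hj => ep_Mm_Ss d K K' j (Finset.mem_Iio.1 hj)]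
  abel

theorem xsum_ep : (xe d K K' + xbe d K K') * ep d K K' = 0 := by
  rw [xe, xbe, add_mul, sub_mul, sub_mul, Finset.sum_mul, Finset.sum_mul, Finset.sum_mul,
    Finset.sum_mul, Finset.sum_congr rfl fun j hj => Pp_ep_Sb d K K' j (Finset.mem_Iio.1 hj),
    Finset.sum_congr rfl fun j hj => Mm_ep_Ss d K K' j (Finset.mem_Iio.1 hj)]
  abel

theorem ep_xe_ep (h : (K : ℕ) = K') : ep d K K' * xe d K K' * ep d K K' = 0 := by
  rw [xe, mul_sub, sub_mul, Finset.mul_sum, Finset.mul_sum, Finset.sum_mul, Finset.sum_mul,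
    Finset.sum_congr rfl (g := fun _ => ep d K K' + ep d K K'),
    Finset.sum_congr (s₁ := Finset.Iio K) rfl (g := fun _ => ep d K K' + ep d K K')]
  · simp [h]
  · intro i hi
    have hi := Finset.mem_Iio.1 hi
    refine B6 _ _ _ (d.cb K') ?_ (ep_c_cb d K K') (c_ep_cb d K K') (d.cb_sq K') (d.comm_σcb _ _)
    rw [Equiv.swap_comm, ep_s_ep d K i K' hi.ne']
  · intro j hj
    have hj := Finset.mem_Iio.1 hj
    rw [ep_Pp_Sb d K K' j hj]
    refine B5 _ _ (d.c K) _ ?_ (ep_c_cb d K K') (c_ep_cb d K K') (d.c_sq K) (d.comm_σbc _ _)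
    rw [Equiv.swap_comm, ep_sb_ep d K K' j hj.ne']

end KK
end WF
end

open Polynomial
noncomputable section

namespace WF
open FM

/-! ### Abstract computation of `e * xb ^ (2n+1)` -/
structure Abs {B : Type} [Ring B] (e x xb c cb : B) : Prop where
  hq : ∀ z : B, z + z = 0 → z = 0
  ee : e * e = 0
  ece : e * c * e = 0
  cc : c * c = -1
  bb : cb * cb = 1
  cx : c * x = -(x * c)
  cxb : c * xb = xb * c
  bx : cb * x = x * cb
  ec : e * c = e * cb
  ce : c * e = cb * e
  s1 : e * (x + xb) = 0
  s2 : (x + xb) * e = 0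
  zx : (xb + (e - c * e * c)) * x = x * (xb + (e - c * e * c))

namespace Abs
variable {B : Type} [Ring B] {e x xb c cb : B} (H : Abs e x xb c cb)
include H

theorem exb : e * xb = -(e * x) := by
  have := H.s1
  rw [mul_add, add_comm] at this
  exact eq_neg_of_add_eq_zero_left this
theorem xbe : xb * e = -(x * e) := by
  have := H.s2
  rw [add_mul, add_comm] at this
  exact eq_neg_of_add_eq_zero_left this

theorem eu : e * (e - c * e * c) = 0 := by
  rw [mul_sub, H.ee]; simp only [← mul_assoc]; rw [H.ece]; simp
theorem uce : (e - c * e * c) * (c * e) = 0 := by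
  rw [sub_mul, ← mul_assoc e, H.ece, mul_assoc _ c, mz H.cc, mul_assoc c e]
  simp [H.ee]

theorem step (m : ℕ) : e * x ^ m * xb = -(e * x ^ (m+1)) - e * x ^ m * (e - c * e * c) := by
  have hc : (xb + (e - c * e * c)) * x ^ m = x ^ m * (xb + (e - c * e * c)) :=
    (Commute.pow_right (show Commute _ x from H.zx) m)
  have h : e * x ^ m * (xb + (e - c * e * c)) = -(e * x ^ (m+1)) := by
    rw [mul_assoc, ← hc, ← mul_assoc, mul_add, H.eu, H.exb, add_zero, neg_mul, mul_assoc, ← pow_succ']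
  rw [mul_add] at h
  exact eq_sub_of_add_eq h

theorem exce (m : ℕ) : e * x ^ m * (c * e) = 0 := by
  cases m with
  | zero => rw [pow_zero, mul_one, ← mul_assoc, H.ece]
  | succ m =>
    have h := congrArg (· * (c * e)) (H.step m)
    simp only [sub_mul, neg_mul] at h
    rw [mul_assoc (e * x ^ m) (e - _), H.uce, mul_zero, sub_zero] at h
    have k : e * x ^ m * xb * (c * e) = e * x ^ (m+1) * (c * e) := by
      rw [mul_assoc _ xb, mz H.cxb.symm, mul_assoc c, H.xbe, mul_neg, mz H.cx, neg_mul, neg_neg,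
        pow_succ]
      simp only [mul_assoc]
    rw [k] at h
    exact H.hq _ (eq_neg_iff_add_eq_zero.1 h)

theorem exu (m : ℕ) : e * x ^ m * (e - c * e * c) = e * x ^ m * e := by
  rw [mul_sub, ← mul_assoc _ (c * e), H.exce]; simp

theorem cxx : Commute c (x ^ 2) := by
  have : c * (x * x) = x * x * c := by
    rw [mz H.cx, neg_mul, mul_assoc, H.cx]; simp [mul_assoc]
  rw [pow_two]; exact this

theorem even (m : ℕ) : e * x ^ (2 * m) * e = 0 := by
  have h1 : c * x ^ (2 * m) = x ^ (2 * m) * c := by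
    rw [pow_mul]; exact H.cxx.pow_right m
  have h2 : cb * x ^ (2 * m) = x ^ (2 * m) * cb := (show Commute cb x from H.bx).pow_right _
  have k1 : (e * c) * x ^ (2 * m) * (c * e) = -(e * x ^ (2 * m) * e) := by
    rw [mul_assoc e c, h1]
    simp only [mul_assoc]
    rw [mz H.cc]; simp
  have k2 : (e * c) * x ^ (2 * m) * (c * e) = e * x ^ (2 * m) * e := by
    rw [H.ec, H.ce, mul_assoc e cb, h2]
    simp only [mul_assoc]
    rw [mz H.bb]; simp
  rw [k2] at k1
  exact H.hq _ (eq_neg_iff_add_eq_zero.1 k1)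

theorem step2 (ω : ℕ → B) (hω : ∀ a, e * x ^ a * e = ω a * e) (j : ℕ) :
    e * x ^ (2 * j + 1) * xb ^ 2 = e * x ^ (2 * j + 3) + ω (2 * j + 1) * (e * x) := by
  rw [pow_two, ← mul_assoc, H.step, H.exu, hω, sub_mul, neg_mul, H.step, H.exu,
    show 2 * j + 1 + 1 = 2 * (j + 1) by ring, H.even, mul_assoc (ω _), H.exb,
    show 2 * (j + 1) + 1 = 2 * j + 3 by ring]
  simp

theorem exbpow (ω : ℕ → B) (hω : ∀ a, e * x ^ a * e = ω a * e) (n : ℕ) :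
    e * xb ^ (2 * n + 1) =
      ∑ j ∈ Finset.range (n+1), acoef ω n j * (e * x ^ (2 * j + 1)) := by
  induction n with
  | zero => simp [acoef, H.exb]
  | succ n ih =>
    rw [show 2 * (n + 1) + 1 = (2 * n + 1) + 2 by ring, pow_add, ← mul_assoc, ih, Finset.sum_mul,
      Finset.sum_range_succ' _ (n + 1)]
    simp only [acoef]
    simp only [mul_assoc (acoef ω n _) (e * _), H.step2 ω hω, mul_add, Finset.sum_add_distrib,
      Finset.sum_mul]
    congr 1
    refine Finset.sum_congr rfl fun j _ => ?_
    simp [mul_assoc]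

theorem omb (ω ωb : ℕ → B) (hω : ∀ a, e * x ^ a * e = ω a * e)
    (hωb : ∀ a, e * xb ^ a * e = ωb a * e) (n : ℕ) :
    ωb (2 * n + 1) * e = (∑ j ∈ Finset.range (n+1), acoef ω n j * ω (2 * j + 1)) * e := by
  rw [← hωb, H.exbpow ω hω, Finset.sum_mul, Finset.sum_mul]
  refine Finset.sum_congr rfl fun j _ => ?_
  rw [mul_assoc, hω, mul_assoc]

end Abs

theorem acoef_mem {R A : Type} [CommRing R] [Ring A] [Algebra R A] (ω : ℕ → A) (T : Subalgebra R A)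
    (n : ℕ) (h : ∀ j, j < n → ω (2 * j + 1) ∈ T) (p : ℕ) (hp : p ≤ n) (j : ℕ) :
    acoef ω p j ∈ T := by
  induction p generalizing j with
  | zero => rw [acoef]; exact T.neg_mem T.one_mem
  | succ p ih =>
    cases j with
    | zero =>
      rw [acoef]
      exact T.sum_mem fun i hi => T.mul_mem (ih (by omega) i)
        (h i (by have := Finset.mem_range.1 hi; omega))
    | succ j => rw [acoef]; exact ih (by omega) j

theorem obar_mem {R A : Type} [CommRing R] [Ring A] [Algebra R A] (ω : ℕ → A) (T : Subalgebra R A)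
    (n : ℕ) (h : ∀ j, j ≤ n → ω (2 * j + 1) ∈ T) :
    ∑ j ∈ Finset.range (n+1), acoef ω n j * ω (2 * j + 1) ∈ T :=
  T.sum_mem fun i hi => T.mul_mem (acoef_mem ω T n (fun j hj => h j hj.le) n le_rfl i)
    (h i (by have := Finset.mem_range.1 hi; omega))

end WF
end

open Polynomial
noncomputable section

namespace WF
open FM

variable {R A : Type} [CommRing R] [Ring A] [Algebra R A] {r t : ℕ}
variable (d : WBC R A (r+1) (t+1))

/-! ### Comparison with the 1-based definitions -/
theorem E_eq (i j : ℕ) (hi : i < r + 1) (hj : j < t + 1) :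
    d.E (i+1) (j+1) = ep d ⟨i, hi⟩ ⟨j, hj⟩ := by
  have h0 : (⟨0, Nat.succ_pos r⟩ : Fin (r+1)) = 0 := rfl
  have h0' : (⟨0, Nat.succ_pos t⟩ : Fin (t+1)) = 0 := rfl
  rw [WBC.E, WBC.tr, WBC.trb, Nat.sub_self, Nat.add_sub_cancel, Nat.add_sub_cancel,
    sw_eq _ 0 i (Nat.succ_pos r) hi, sw_eq _ 0 j (Nat.succ_pos t) hj, ep, N, h0, h0']
  rw [← d.comm_σσb, ← mul_assoc]
theorem cn_eq (i : ℕ) (hi : i < r + 1) : d.cn (i+1) = d.c ⟨i, hi⟩ := by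
  rw [WBC.cn, dif_pos (by simpa using hi)]; rfl
theorem cbn_eq (i : ℕ) (hi : i < t + 1) : d.cbn (i+1) = d.cb ⟨i, hi⟩ := by
  rw [WBC.cbn, dif_pos (by simpa using hi)]; rfl

theorem sum_Ico_eq {B : Type} [AddCommMonoid B] (n m : ℕ) (hm : m < n) (f : ℕ → B) (g : Fin n → B)
    (h : ∀ i (hi : i < m), f (i+1) = g ⟨i, hi.trans hm⟩) :
    ∑ i ∈ Finset.Ico 1 (m+1), f i = ∑ i ∈ Finset.Iio (⟨m, hm⟩ : Fin n), g i := by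
  refine Finset.sum_bij' (fun i hi => ⟨i - 1, ?_⟩) (fun i _ => (i : ℕ) + 1) ?_ ?_ ?_ ?_ ?_
  · have := Finset.mem_Ico.1 hi; omega
  · intro i hi
    have := Finset.mem_Ico.1 hi
    simp only [Finset.mem_Iio, Fin.mk_lt_mk]; omega
  · intro i hi
    have : (i : ℕ) < m := Fin.lt_def.1 (Finset.mem_Iio.1 hi)
    simp only [Finset.mem_Ico]; omega
  · intro i hi
    have := Finset.mem_Ico.1 hi
    simp only; omega
  · intro i hi
    simp
  · intro i hi
    have := Finset.mem_Ico.1 hi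
    obtain ⟨i, rfl⟩ : ∃ l, i = l + 1 := ⟨i - 1, by omega⟩
    exact h i (by omega)

theorem y_eq (m : ℕ) (h1 : m < r + 1) (h2 : m < t + 1) : d.y (m+1) = xe d ⟨m, h1⟩ ⟨m, h2⟩ := by
  rw [WBC.y, xe]
  congr 1
  · refine sum_Ico_eq _ m h2 _ _ fun j hj => ?_
    rw [WBC.Eb, E_eq d m j h1 (hj.trans h2), cn_eq d m h1, Pp]
  · rw [WBC.L, WBC.LL, cn_eq d m h1]
    simp only [Ss, Finset.sum_add_distrib, ← Finset.sum_mul, ← Finset.mul_sum]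
    rw [sum_Ico_eq _ m h1 _ (fun i => d.σ (Equiv.swap i ⟨m, h1⟩))]
    intro j hj
    rw [WBC.tr, Nat.add_sub_cancel, Nat.add_sub_cancel, sw_eq _ j m (hj.trans h1) h1]

theorem yb_eq (m : ℕ) (h1 : m < r + 1) (h2 : m < t + 1) : d.yb (m+1) = xbe d ⟨m, h1⟩ ⟨m, h2⟩ := by
  rw [WBC.yb, xbe]
  congr 1
  · refine sum_Ico_eq _ m h1 _ _ fun j hj => ?_
    rw [WBC.Eb, E_eq d j m (hj.trans h1) h2, cn_eq d j (hj.trans h1), Mm]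
  · rw [WBC.Lb, WBC.LLb, cbn_eq d m h2]
    simp only [Sb, Finset.sum_sub_distrib, ← Finset.sum_mul, ← Finset.mul_sum]
    rw [sum_Ico_eq _ m h2 _ (fun i => d.σb (Equiv.swap i ⟨m, h2⟩))]
    intro j hj
    rw [WBC.trb, Nat.add_sub_cancel, Nat.add_sub_cancel, sw_eq _ j m (hj.trans h2) h2]

theorem swap_lt {n : ℕ} (a b K x : Fin n) (ha : a < K) (hb : b < K) :
    x < K ↔ Equiv.swap a b x < K := by
  rcases eq_or_ne x a with rfl | h
  · simp [ha, hb]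
  rcases eq_or_ne x b with rfl | h'
  · simp [ha, hb]
  rw [Equiv.swap_apply_of_ne_of_ne h h']

theorem gens_comm (m : ℕ) (hm : 1 ≤ m) (h1 : m < r + 1) (h2 : m < t + 1) (b : A)
    (hb : b ∈ Algebra.adjoin R (d.lowerGens m)) :
    b * xe d ⟨m, h1⟩ ⟨m, h2⟩ = xe d ⟨m, h1⟩ ⟨m, h2⟩ * b ∧
    b * ep d ⟨m, h1⟩ ⟨m, h2⟩ = ep d ⟨m, h1⟩ ⟨m, h2⟩ * b := by
  have hK : (0 : Fin (r+1)) < ⟨m, h1⟩ := Fin.lt_def.2 hm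
  have hK' : (0 : Fin (t+1)) < ⟨m, h2⟩ := Fin.lt_def.2 hm
  have key : Algebra.adjoin R (d.lowerGens m) ≤
      Subalgebra.centralizer R {xe d ⟨m, h1⟩ ⟨m, h2⟩, ep d ⟨m, h1⟩ ⟨m, h2⟩} := by
    refine Algebra.adjoin_le ?_
    intro z hz
    suffices h : z * xe d ⟨m, h1⟩ ⟨m, h2⟩ = xe d ⟨m, h1⟩ ⟨m, h2⟩ * z ∧
        z * ep d ⟨m, h1⟩ ⟨m, h2⟩ = ep d ⟨m, h1⟩ ⟨m, h2⟩ * z by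
      rw [SetLike.mem_coe, Subalgebra.mem_centralizer_iff]
      rintro g (rfl | rfl)
      · exact h.1.symm
      · exact h.2.symm
    rcases hz with ⟨_, rfl⟩ | ⟨j, hj, hj', rfl⟩ | ⟨j, hj, hj', rfl⟩ | ⟨_, rfl⟩ | ⟨_, rfl⟩
    · rw [← ep_zero d]
      exact ⟨e_xe d _ _ hK hK', ep_comm d _ _ _ _ hK.ne hK'.ne⟩
    · rw [WBC.s, sw_eq _ (j-1) j (by omega) (by omega)]
      have a1 : (⟨j - 1, by omega⟩ : Fin (r+1)) < ⟨m, h1⟩ := Fin.lt_def.2 (by simp only; omega)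
      have a2 : (⟨j, by omega⟩ : Fin (r+1)) < ⟨m, h1⟩ := Fin.lt_def.2 (by simp only; omega)
      have a3 := Equiv.swap_apply_of_ne_of_ne a1.ne' a2.ne'
      refine ⟨σ_xe d _ _ _ a3 fun i => swap_lt _ _ _ _ a1 a2, ?_⟩
      exact (ep_σ_fix d _ _ _ a3).symm
    · rw [WBC.sb, sw_eq _ (j-1) j (by omega) (by omega)]
      have a1 : (⟨j - 1, by omega⟩ : Fin (t+1)) < ⟨m, h2⟩ := Fin.lt_def.2 (by simp only; omega)
      have a2 : (⟨j, by omega⟩ : Fin (t+1)) < ⟨m, h2⟩ := Fin.lt_def.2 (by simp only; omega)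
      have a3 := Equiv.swap_apply_of_ne_of_ne a1.ne' a2.ne'
      refine ⟨σb_xe d _ _ _ fun i => swap_lt _ _ _ _ a1 a2, ?_⟩
      exact (ep_σb_fix d _ _ _ a3).symm
    · rw [cn_eq d 0 (Nat.succ_pos r)]
      exact ⟨c_xe d _ _ hK, c_ep d 0 _ _ hK.ne⟩
    · rw [cbn_eq d 0 (Nat.succ_pos t)]
      exact ⟨cb_xe d _ _ 0, cb_ep d 0 _ _ hK'.ne⟩
  have h := Subalgebra.mem_centralizer_iff R |>.1 (key hb)
  exact ⟨(h _ (by simp)).symm, (h _ (by simp)).symm⟩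

theorem abs_inst (q : R) (hq : q * 2 = 1) (m : ℕ) (h1 : m < r + 1) (h2 : m < t + 1) :
    Abs (ep d ⟨m, h1⟩ ⟨m, h2⟩) (xe d ⟨m, h1⟩ ⟨m, h2⟩) (xbe d ⟨m, h1⟩ ⟨m, h2⟩) (d.c ⟨m, h1⟩)
      (d.cb ⟨m, h2⟩) where
  hq z hz := by
    have : q • (z + z) = z := by rw [← two_smul R z, smul_smul, hq, one_smul]
    rw [← this, hz, smul_zero]
  ee := ep_sq d _ _
  ece := ep_c_ep d _ _
  cc := d.c_sq _
  bb := d.cb_sq _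
  cx := cK_xe d _ _
  cxb := c_xbe d _ _ _
  bx := cb_xe d _ _ _
  ec := ep_c_cb d _ _
  ce := c_ep_cb d _ _
  s1 := ep_xsum d _ _
  s2 := xsum_ep d _ _
  zx := by
    have := xe_Ze d ⟨m, h1⟩ ⟨m, h2⟩
    rw [Ze_eq] at this
    exact this

theorem main (q : R) (hq : q * 2 = 1) (hu : d.IsUniversal) (m : ℕ) (hm : 1 ≤ m)
    (h1 : m < r + 1) (h2 : m < t + 1) (ω ωb : ℕ → A)
    (hω : ∀ a : ℕ, ω a ∈ Algebra.adjoin R (d.lowerGens m) ∧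
      d.E (m+1) (m+1) * d.y (m+1) ^ a * d.E (m+1) (m+1) = ω a * d.E (m+1) (m+1))
    (hωb : ∀ a : ℕ, ωb a ∈ Algebra.adjoin R (d.lowerGens m) ∧
      d.E (m+1) (m+1) * d.yb (m+1) ^ a * d.E (m+1) (m+1) = ωb a * d.E (m+1) (m+1)) :
    (∀ n : ℕ, ωb (2 * n + 1) ∈
        Algebra.adjoin R {x : A | ∃ l : ℕ, 1 ≤ l ∧ l ≤ n ∧ x = ω (2 * l + 1)}) ∧
    (∀ n : ℕ, ∀ b ∈ Algebra.adjoin R (d.lowerGens m),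
      ω n * b = b * ω n ∧ ωb (2 * n + 1) * b = b * ωb (2 * n + 1)) := by
  rw [E_eq d m m h1 h2, y_eq d m h1 h2] at hω
  rw [E_eq d m m h1 h2, yb_eq d m h1 h2] at hωb
  set e := ep d ⟨m, h1⟩ ⟨m, h2⟩ with he
  set x := xe d ⟨m, h1⟩ ⟨m, h2⟩ with hx
  have H := abs_inst d q hq m h1 h2
  have uniq : ∀ a b, a ∈ Algebra.adjoin R (d.lowerGens m) → b ∈ Algebra.adjoin R (d.lowerGens m) →
      a * e = b * e → a = b := by
    intro a b ha hb hab
    refine sub_eq_zero.1 (lower_unique q hq hu m hm h1 h2 (a - b) (sub_mem ha hb) ?_)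
    rw [sub_mul, ← he, hab, sub_self]
  have w1 : ω 1 = 0 := by
    refine uniq _ _ (hω 1).1 (zero_mem _) ?_
    rw [← (hω 1).2, pow_one, zero_mul]
    exact ep_xe_ep d _ _ rfl
  have hbar : ∀ n, ωb (2 * n + 1) = ∑ j ∈ Finset.range (n+1), acoef ω n j * ω (2 * j + 1) := by
    intro n
    refine uniq _ _ (hωb _).1 (obar_mem ω _ n fun j _ => (hω _).1) ?_
    exact H.omb ω ωb (fun a => (hω a).2) (fun a => (hωb a).2) n
  have cent : ∀ n, ∀ b ∈ Algebra.adjoin R (d.lowerGens m), ω n * b = b * ω n := by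
    intro n b hb
    have hc := gens_comm d m hm h1 h2 b hb
    refine uniq _ _ (mul_mem (hω n).1 hb) (mul_mem hb (hω n).1) ?_
    have hp : b * x ^ n = x ^ n * b := (show Commute b x from hc.1).pow_right n
    have hc2 : b * e = e * b := hc.2
    rw [mul_assoc, hc2, ← mul_assoc, mul_assoc b, ← (hω n).2, mul_assoc (e * x ^ n), ← hc2,
      ← mul_assoc, mul_assoc e, ← hp, ← mul_assoc, ← hc2]
    simp only [mul_assoc]
  refine ⟨fun n => ?_, fun n b hb => ⟨cent n b hb, ?_⟩⟩
  · rw [hbar]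
    refine obar_mem ω _ n fun j hj => ?_
    rcases Nat.eq_zero_or_pos j with rfl | hj0
    · rw [mul_zero, zero_add, w1]; exact zero_mem _
    · exact Algebra.subset_adjoin ⟨j, hj0, hj, rfl⟩
  · have : ωb (2 * n + 1) ∈ Subalgebra.centralizer R (Algebra.adjoin R (d.lowerGens m) : Set A) := by
      rw [hbar]
      refine obar_mem ω _ n fun j _ => ?_
      rw [Subalgebra.mem_centralizer_iff]
      intro g hg; exact (cent _ g hg).symm
    exact ((Subalgebra.mem_centralizer_iff R).1 this b hb).symm

end WF

end

theorem statement5 (R A : Type) [CommRing R] [IsDomain R] [Ring A] [Algebra R A]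
    (h2 : IsUnit (2 : R)) (r t : ℕ) (hr : 1 ≤ r) (ht : 1 ≤ t)
    (d : WBC R A r t) (hu : d.IsUniversal)
    (k : ℕ) (hk1 : 1 ≤ k) (hkr : k ≤ r) (hkt : k ≤ t)
    (ω ωb : ℕ → A)
    (hω : ∀ a : ℕ, ω a ∈ Algebra.adjoin R (d.lowerGens (k - 1)) ∧
      d.E k k * d.y k ^ a * d.E k k = ω a * d.E k k)
    (hωb : ∀ a : ℕ, ωb a ∈ Algebra.adjoin R (d.lowerGens (k - 1)) ∧
      d.E k k * d.yb k ^ a * d.E k k = ωb a * d.E k k) :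
    (∀ n : ℕ, 2 ≤ n → 2 ≤ k →
      ωb (2 * n - 1) ∈
        Algebra.adjoin R {x : A | ∃ l : ℕ, 1 ≤ l ∧ l + 1 ≤ n ∧ x = ω (2 * l + 1)}) ∧
    (∀ n : ℕ, 1 ≤ n → ∀ b ∈ Algebra.adjoin R (d.lowerGens (k - 1)),
      ω (2 * n - 1) * b = b * ω (2 * n - 1) ∧ ωb (2 * n - 1) * b = b * ωb (2 * n - 1)) := by
  obtain ⟨q, hq⟩ := h2.exists_left_inv
  obtain ⟨r, rfl⟩ : ∃ s, r = s + 1 := ⟨r - 1, by omega⟩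
  obtain ⟨t, rfl⟩ : ∃ s, t = s + 1 := ⟨t - 1, by omega⟩
  obtain ⟨m, rfl⟩ : ∃ s, k = s + 1 := ⟨k - 1, by omega⟩
  rw [Nat.add_sub_cancel] at *
  rcases Nat.eq_zero_or_pos m with rfl | hm
  · refine ⟨fun n _ h => by omega, fun n _ b hb => ?_⟩
    have hg : d.lowerGens 0 = ∅ := by
      ext z
      simp only [WBC.lowerGens, Set.mem_ofPred_eq, Set.mem_empty_iff_false, iff_false]
      rintro (⟨h, _⟩ | ⟨j, h, h', _⟩ | ⟨j, h, h', _⟩ | ⟨h, _⟩ | ⟨h, _⟩) <;> omega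
    rw [hg, Algebra.adjoin_empty, Algebra.mem_bot] at hb
    obtain ⟨s, rfl⟩ := hb
    exact ⟨(Algebra.commutes s _).symm, (Algebra.commutes s _).symm⟩
  · obtain ⟨p1, p2⟩ := WF.main d q hq hu m hm (by omega) (by omega) ω ωb hω hωb
    constructor
    · intro n hn _
      obtain ⟨n, rfl⟩ : ∃ s, n = s + 1 := ⟨n - 1, by omega⟩
      have := p1 n
      rw [show 2 * (n + 1) - 1 = 2 * n + 1 by omega]
      simpa using this
    · intro n hn b hb
      obtain ⟨n, rfl⟩ : ∃ s, n = s + 1 := ⟨n - 1, by omega⟩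
      rw [show 2 * (n + 1) - 1 = 2 * n + 1 by omega]
      exact ⟨(p2 _ b hb).1, (p2 n b hb).2⟩
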